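/- arXiv:2508.01703 — 2 statements merged into one kernel-verified Lean document; each statement's English description precedes it below -/
import Mathlib

section
/- Let J : ℕ → ℝ satisfy J(k) ≥ 0 for all k ≥ 1 and additionally ∑_{i=1}^∞ (∑_{k=i}^∞ J(k))² < ∞ (which in particular entails ∑_{k=1}^∞ J(k) < ∞). Then for every β with 0 ≤ β < β_c(Φ), letting ν be the unique eigenprobability of L*_{βφ} with eigenvalue λ > 0, there exists a continuous function h : X₊ → ℝ with h(x) > 0 for every x ∈ X₊ such that L_{βφ} h(x) = λ·h(x) for every x ∈ X₊. -/
open MeasureTheory Real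

noncomputable section

/-- The configuration space `X = {-1,+1}^ℤ`, with spins encoded by booleans. -/
abbrev Config : Type := ℤ → Bool

/-- The real value of a spin: `true ↦ +1`, `false ↦ -1`. -/
def spin (b : Bool) : ℝ := if b then 1 else -1

/-- Spin flipAt at site `i`. -/
def flipAt (i : ℤ) (ω : Config) : Config := fun j => if j = i then !(ω j) else ω j

/-- A function is local if it depends on finitely many coordinates. -/
def IsLocal (F : Config → ℝ) : Prop :=
  ∃ S : Finset ℤ, ∀ ω η : Config, (∀ i ∈ S, ω i = η i) → F ω = F η

/-- The oscillation `δ_k F` at site `k`. -/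
def osc (F : Config → ℝ) (k : ℤ) : ℝ :=
  sSup {d : ℝ | ∃ ξ η : Config, (∀ j : ℤ, j ≠ k → ξ j = η j) ∧ d = F ξ - F η}

/-- The total squared oscillation `‖δ(F)‖₂²`. -/
def oscSq (F : Config → ℝ) : ℝ := ∑' k : ℤ, (osc F k) ^ 2

/-- The Gaussian Concentration Bound with constant `D`. -/
def GCB (μ : Measure Config) (D : ℝ) : Prop :=
  ∀ F : Config → ℝ, IsLocal F → Continuous F →
    (∫ ω, exp (F ω - ∫ η, F η ∂μ) ∂μ) ≤ exp (D * oscSq F)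

/-- The entropy functional `Ent_μ(g)`. -/
def entropy (μ : Measure Config) (g : Config → ℝ) : ℝ :=
  (∫ ω, g ω * log (g ω) ∂μ) - (∫ ω, g ω ∂μ) * log (∫ ω, g ω ∂μ)

/-- The log-Sobolev inequality with constant `D`. -/
def SatisfiesLSI (μ : Measure Config) (D : ℝ) : Prop :=
  ∀ f : Config → ℝ, IsLocal f → Continuous f →
    entropy μ (fun ω => (f ω) ^ 2) ≤ 2 * D * ∫ ω, ∑' i : ℤ, (f ω - f (flipAt i ω)) ^ 2 ∂μ

/-- The Hamiltonian `H^{βK}_Λ(ω) = -β ∑_{{i,j}∩Λ≠∅, i≠j} K(i,j) ω_i ω_j`,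
where the sum runs over ordered pairs with `i < j`. -/
def hamiltonian (K : ℤ → ℤ → ℝ) (β : ℝ) (Λ : Finset ℤ) (ω : Config) : ℝ :=
  -β * ∑' p : ℤ × ℤ,
      (if p.1 < p.2 ∧ (p.1 ∈ Λ ∨ p.2 ∈ Λ) then K p.1 p.2 * spin (ω p.1) * spin (ω p.2) else 0)

/-- The configuration equal to `a` in `Λ` and to `ω` off `Λ`. -/
def concat (Λ : Finset ℤ) (a : Λ → Bool) (ω : Config) : Config :=
  fun j => if h : j ∈ Λ then a ⟨j, h⟩ else ω j

/-- The Gibbs kernel `γ^{βK}_Λ(a | ω)`. -/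
def gibbsKernel (K : ℤ → ℤ → ℝ) (β : ℝ) (Λ : Finset ℤ) (a : Λ → Bool) (ω : Config) : ℝ :=
  exp (-(hamiltonian K β Λ (concat Λ a ω))) /
    ∑ b : Λ → Bool, exp (-(hamiltonian K β Λ (concat Λ b ω)))

/-- The σ-algebra `F_{Λᶜ}` generated by the coordinates outside `Λ`. -/
def outsideAlgebra (Λ : Finset ℤ) : MeasurableSpace Config :=
  MeasurableSpace.comap (fun (ω : Config) (j : {j : ℤ // j ∉ Λ}) => ω j.1) inferInstance

/-- The cylinder event `{σ_Λ = a}`. -/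
def cylinderEvent (Λ : Finset ℤ) (a : Λ → Bool) : Set Config :=
  {ω | ∀ i : Λ, ω i.1 = a i}

/-- `μ` is a Gibbs measure for the pair coupling `K` at inverse temperature `β`
(the DLR equations). -/
def IsGibbs (K : ℤ → ℤ → ℝ) (β : ℝ) (μ : Measure Config) : Prop :=
  IsProbabilityMeasure μ ∧
  ∀ (Λ : Finset ℤ) (a : Λ → Bool) (B : Set Config),
    MeasurableSet[outsideAlgebra Λ] B →
    (μ (cylinderEvent Λ a ∩ B)).toReal = ∫ ω in B, gibbsKernel K β Λ a ω ∂μ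

/-- The Dyson pair couplings `K(i,j) = J(|i-j|)` for `i ≠ j`. -/
def dysonK (J : ℕ → ℝ) : ℤ → ℤ → ℝ := fun i j => if i = j then 0 else J (i - j).natAbs

/-- The critical inverse temperature `β_c(K)`. -/
def betaC (K : ℤ → ℤ → ℝ) : ℝ :=
  sSup {β : ℝ | 0 ≤ β ∧ ∃! μ : Measure Config, IsGibbs K β μ}

/-- The susceptibility `χ(μ) = ∑_{i∈ℤ} ∫ ω₀ ω_i dμ`. -/
def suscept (μ : Measure Config) : ℝ := ∑' i : ℤ, ∫ ω, spin (ω 0) * spin (ω i) ∂μ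

/-- The half-line configuration space `X₊ = {-1,+1}^{ℤ₊}`. -/
abbrev ConfigP : Type := ℕ → Bool

/-- Concatenation `ax`: `(ax)₀ = a`, `(ax)ₙ = x_{n-1}` for `n ≥ 1`. -/
def consP (a : Bool) (x : ConfigP) : ConfigP := fun n =>
  match n with
  | 0 => a
  | Nat.succ m => x m

/-- The half-line potential `φ(x) = ∑_{n≥1} J(n) x₀ xₙ`. -/
def potential (J : ℕ → ℝ) (x : ConfigP) : ℝ :=
  ∑' n : ℕ, J (n + 1) * spin (x 0) * spin (x (n + 1))

/-- The transfer operator `L_{βφ}`. -/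
def transfer (J : ℕ → ℝ) (β : ℝ) (f : ConfigP → ℝ) (x : ConfigP) : ℝ :=
  ∑ a : Bool, exp (β * potential J (consP a x)) * f (consP a x)

/-- `ν` is an eigenprobability of the adjoint transfer operator `L*_{βφ}`
with eigenvalue `lam`. -/
def IsEigenprob (J : ℕ → ℝ) (β lam : ℝ) (ν : Measure ConfigP) : Prop :=
  IsProbabilityMeasure ν ∧
  ∀ f : ConfigP → ℝ, Continuous f → (∫ x, transfer J β f x ∂ν) = lam * ∫ x, f x ∂ν

/-- A local function on the half-line configuration space. -/
def IsLocalP (F : ConfigP → ℝ) : Prop :=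
  ∃ S : Finset ℕ, ∀ ω η : ConfigP, (∀ i ∈ S, ω i = η i) → F ω = F η

/-- The oscillation `δ_k F` at site `k ∈ ℤ₊`. -/
def oscP (F : ConfigP → ℝ) (k : ℕ) : ℝ :=
  sSup {d : ℝ | ∃ ξ η : ConfigP, (∀ j : ℕ, j ≠ k → ξ j = η j) ∧ d = F ξ - F η}

/-- The total squared oscillation on the half-line. -/
def oscSqP (F : ConfigP → ℝ) : ℝ := ∑' k : ℕ, (oscP F k) ^ 2

/-- The Gaussian Concentration Bound on the half-line with constant `D`. -/
def GCBP (ν : Measure ConfigP) (D : ℝ) : Prop :=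
  ∀ F : ConfigP → ℝ, IsLocalP F → Continuous F →
    (∫ x, exp (F x - ∫ y, F y ∂ν) ∂ν) ≤ exp (D * oscSqP F)

set_option linter.unusedSectionVars false

namespace Ising

/-- The real value of a sign. -/
def sg (x : ℤˣ) : ℝ := ((x : ℤ) : ℝ)

@[simp] lemma sg_one : sg 1 = 1 := by simp [sg]

@[simp] lemma sg_neg (x : ℤˣ) : sg (-x) = -sg x := by simp [sg]

@[simp] lemma sg_mul (x y : ℤˣ) : sg (x * y) = sg x * sg y := by simp [sg]

lemma sg_eq (x : ℤˣ) : sg x = 1 ∨ sg x = -1 := by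
  rcases Int.units_eq_one_or x with h | h <;> simp [h]

@[simp] lemma sg_mul_self (x : ℤˣ) : sg x * sg x = 1 := by
  rcases sg_eq x with h | h <;> simp [h]

lemma sg_le_one (x : ℤˣ) : sg x ≤ 1 := by
  rcases sg_eq x with h | h <;> rw [h]; norm_num

lemma sg_prod {ι : Type*} (s : Finset ι) (f : ι → ℤˣ) : sg (∏ i ∈ s, f i) = ∏ i ∈ s, sg (f i) := by
  classical
  induction s using Finset.induction_on with
  | empty => simp
  | insert a s ha ih => simp [Finset.prod_insert ha, ih]

variable {V : Type*}

/-- Characters of the group of spin configurations. -/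
abbrev Chr (V : Type*) : Type _ := (V → ℤˣ) →* ℤˣ

/-- The spin at `v`. -/
def site (v : V) : Chr V := Pi.evalMonoidHom (fun _ => ℤˣ) v

@[simp] lemma site_apply (v : V) (σ : V → ℤˣ) : site v σ = σ v := rfl

/-- The product of the two spins at the ends of `e`. -/
def bond (e : V × V) : Chr V := site e.1 * site e.2

@[simp] lemma bond_apply (e : V × V) (σ : V → ℤˣ) : bond e σ = σ e.1 * σ e.2 := rfl

lemma bond_eq_one {e : V × V} {σ : V → ℤˣ} : bond e σ = 1 ↔ σ e.1 = σ e.2 := by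
  rw [bond_apply]
  rcases Int.units_eq_one_or (σ e.1) with h | h <;> rcases Int.units_eq_one_or (σ e.2) with h' | h' <;>
    simp [h, h']

lemma config_mul_self (σ : V → ℤˣ) : σ * σ = 1 := by
  funext v; simp

variable [Fintype V] [DecidableEq V]

/-- Configurations that are constant along the edges of `G`. -/
def comp (G : Finset (V × V)) : Finset (V → ℤˣ) :=
  Finset.univ.filter fun σ => ∀ e ∈ G, bond e σ = 1

lemma mem_comp {G : Finset (V × V)} {σ : V → ℤˣ} : σ ∈ comp G ↔ ∀ e ∈ G, bond e σ = 1 := by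
  simp [comp]

lemma mul_mem_comp {G : Finset (V × V)} {σ τ : V → ℤˣ} (h : σ ∈ comp G) (h' : τ ∈ comp G) :
    σ * τ ∈ comp G := by
  rw [mem_comp] at *
  intro e he
  rw [map_mul, h e he, h' e he, mul_one]

lemma sum_chr_comp (G : Finset (V × V)) (χ : Chr V) :
    (∀ σ ∈ comp G, χ σ = 1) ∨ ∑ σ ∈ comp G, sg (χ σ) = 0 := by
  by_cases h : ∀ σ ∈ comp G, χ σ = 1
  · exact Or.inl h
  · right
    push Not at h
    obtain ⟨σ₀, hσ₀, h⟩ := h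
    have h1 : χ σ₀ = -1 := (Int.units_eq_one_or _).resolve_left h
    have h2 : ∑ σ ∈ comp G, sg (χ σ) = ∑ σ ∈ comp G, sg (χ (σ₀ * σ)) := by
      refine Finset.sum_bij' (fun σ _ => σ₀ * σ) (fun σ _ => σ₀ * σ) ?_ ?_ ?_ ?_ ?_
      · intro σ hσ; exact mul_mem_comp hσ₀ hσ
      · intro σ hσ; exact mul_mem_comp hσ₀ hσ
      · intro σ hσ; simp [← mul_assoc, config_mul_self]
      · intro σ hσ; simp [← mul_assoc, config_mul_self]
      · intro σ hσ; simp [← mul_assoc, config_mul_self]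
    simp only [map_mul, h1, sg_neg, neg_mul, one_mul, Finset.sum_neg_distrib] at h2
    linarith

lemma sum_chr_comp_nonneg (G : Finset (V × V)) (χ : Chr V) : 0 ≤ ∑ σ ∈ comp G, sg (χ σ) := by
  rcases sum_chr_comp G χ with h | h
  · exact Finset.sum_nonneg fun σ hσ => by simp [h σ hσ]
  · exact h.ge

lemma comp_empty : comp (∅ : Finset (V × V)) = Finset.univ := by simp [comp]

lemma sum_chr (χ : Chr V) : (∀ σ, χ σ = 1) ∨ ∑ σ, sg (χ σ) = 0 := by
  simpa [comp_empty] using sum_chr_comp ∅ χ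

/-- The Boltzmann weight for the pair coupling `K`. -/
def wt (K : V × V → ℝ) (σ : V → ℤˣ) : ℝ := exp (∑ e, K e * sg (bond e σ))

lemma wt_pos (K : V × V → ℝ) (σ : V → ℤˣ) : 0 < wt K σ := exp_pos _

/-- Unnormalised expectation. -/
def pf (K : V × V → ℝ) (F : (V → ℤˣ) → ℝ) : ℝ := ∑ σ, F σ * wt K σ

/-- Unnormalised expectation of a character. -/
def pc (K : V × V → ℝ) (χ : Chr V) : ℝ := pf K fun σ => sg (χ σ)

lemma pf_one_pos (K : V × V → ℝ) : 0 < pc K 1 := by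
  simp only [pc, pf, MonoidHom.one_apply, sg_one, one_mul]
  exact Finset.sum_pos (fun σ _ => wt_pos K σ) Finset.univ_nonempty

lemma exp_double (K : ℝ) (s u : ℤˣ) :
    exp (K * sg s) * exp (K * sg (s * u)) =
      sinh (2 * K) * (if u = 1 then 1 else 0) * sg s +
        ((cosh (2 * K) - 1) * (if u = 1 then 1 else 0) + 1) := by
  rw [← exp_add]
  rcases Int.units_eq_one_or s with h | h <;> rcases Int.units_eq_one_or u with h' | h' <;>
    simp [h, h']
  · ring
  · rw [← neg_add, ← two_mul, ← cosh_sub_sinh]; ring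

lemma wt_double (K : V × V → ℝ) (σ u : V → ℤˣ) :
    wt K σ * wt K (σ * u) =
      ∏ e, (sinh (2 * K e) * (if bond e u = 1 then 1 else 0) * sg (bond e σ) +
        ((cosh (2 * K e) - 1) * (if bond e u = 1 then 1 else 0) + 1)) := by
  simp only [wt, exp_sum, ← Finset.prod_mul_distrib, map_mul, exp_double]

lemma prod_ind_comp (G : Finset (V × V)) (u : V → ℤˣ) :
    (∏ e ∈ G, (if bond e u = 1 then (1 : ℝ) else 0)) = if u ∈ comp G then 1 else 0 := by
  rw [Finset.prod_ite_zero]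
  simp [mem_comp]

/-- Positivity principle for two independent copies: expand the doubled weight in graphs. -/
lemma double_nonneg {K : V × V → ℝ} (hK : 0 ≤ K) (χ : Chr V) (g : (V → ℤˣ) → ℝ)
    (hg : ∀ E G : Finset (V × V), E ⊆ G → (∀ e ∈ G, K e ≠ 0) →
      (∀ σ, (χ * ∏ e ∈ E, bond e) σ = 1) → 0 ≤ ∑ u ∈ comp G, g u) :
    0 ≤ ∑ σ, ∑ τ, sg (χ σ) * g (σ * τ) * (wt K σ * wt K τ) := by
  have h1 : ∑ σ, ∑ τ, sg (χ σ) * g (σ * τ) * (wt K σ * wt K τ) =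
      ∑ u, ∑ σ, sg (χ σ) * g u * (wt K σ * wt K (σ * u)) := by
    rw [Finset.sum_comm]
    rw [Finset.sum_comm]
    conv_rhs => rw [Finset.sum_comm]
    refine Finset.sum_congr rfl fun σ _ => ?_
    refine Fintype.sum_equiv (Equiv.mulLeft σ) _ _ fun τ => ?_
    simp [← mul_assoc, config_mul_self]
  have h2 : ∀ u σ : V → ℤˣ, sg (χ σ) * g u * (wt K σ * wt K (σ * u)) =
      ∑ E : Finset (V × V), ∑ H ∈ Eᶜ.powerset,
        ((∏ e ∈ E, sinh (2 * K e)) * ∏ e ∈ H, (cosh (2 * K e) - 1)) *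
          ((if u ∈ comp (E ∪ H) then g u else 0) * sg ((χ * ∏ e ∈ E, bond e) σ)) := by
    intro u σ
    rw [wt_double, Fintype.prod_add, Finset.mul_sum]
    refine Finset.sum_congr rfl fun E _ => ?_
    rw [Finset.prod_add_one, Finset.mul_sum, Finset.mul_sum]
    refine Finset.sum_congr rfl fun H hH => ?_
    have hdis : Disjoint E H :=
      Finset.disjoint_left.2 fun e he he' => by
        have := Finset.mem_powerset.1 hH he'
        simp at this; exact this he
    have h3 : (if u ∈ comp (E ∪ H) then g u else 0) = g u *
        ((∏ e ∈ E, (if bond e u = 1 then (1 : ℝ) else 0)) *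
          ∏ e ∈ H, (if bond e u = 1 then (1 : ℝ) else 0)) := by
      rw [← Finset.prod_union hdis, prod_ind_comp]; simp
    rw [h3]
    simp only [Finset.prod_mul_distrib, MonoidHom.mul_apply, sg_mul, MonoidHom.finsetProd_apply,
      sg_prod]
    ring
  rw [h1]
  simp only [h2]
  rw [show (∑ u : V → ℤˣ, ∑ σ : V → ℤˣ, ∑ E : Finset (V × V), ∑ H ∈ Eᶜ.powerset,
        ((∏ e ∈ E, sinh (2 * K e)) * ∏ e ∈ H, (cosh (2 * K e) - 1)) *
          ((if u ∈ comp (E ∪ H) then g u else 0) * sg ((χ * ∏ e ∈ E, bond e) σ))) =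
      ∑ E : Finset (V × V), ∑ H ∈ Eᶜ.powerset,
        ((∏ e ∈ E, sinh (2 * K e)) * ∏ e ∈ H, (cosh (2 * K e) - 1)) *
          ((∑ u ∈ comp (E ∪ H), g u) * ∑ σ, sg ((χ * ∏ e ∈ E, bond e) σ)) from ?_]
  · refine Finset.sum_nonneg fun E _ => Finset.sum_nonneg fun H _ => ?_
    have hs : ∀ e, 0 ≤ sinh (2 * K e) := fun e => sinh_nonneg_iff.2 (by have := hK e; simp at this; linarith)
    have hc : ∀ e, 0 ≤ cosh (2 * K e) - 1 := fun e => by linarith [one_le_cosh (2 * K e)]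
    by_cases h0 : ∀ e ∈ E ∪ H, K e ≠ 0
    · refine mul_nonneg (mul_nonneg (Finset.prod_nonneg fun e _ => hs e)
        (Finset.prod_nonneg fun e _ => hc e)) ?_
      rcases sum_chr (χ * ∏ e ∈ E, bond e) with h | h
      · exact mul_nonneg (hg E (E ∪ H) Finset.subset_union_left h0 h)
          (Finset.sum_nonneg fun σ _ => by simp [h σ])
      · rw [h, mul_zero]
    · push Not at h0
      obtain ⟨e, he, h0⟩ := h0
      rcases Finset.mem_union.1 he with he | he
      · rw [Finset.prod_eq_zero he (by simp [h0])]; simp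
      · rw [Finset.prod_eq_zero (s := H) he (by simp [h0])]; simp
  · simp_rw [Finset.sum_comm (s := (Finset.univ : Finset (V → ℤˣ))) (t := (Finset.univ : Finset (Finset (V × V))))]
    refine Finset.sum_congr rfl fun E _ => ?_
    simp_rw [Finset.sum_comm (s := (Finset.univ : Finset (V → ℤˣ))) (t := Eᶜ.powerset)]
    refine Finset.sum_congr rfl fun H _ => ?_
    simp_rw [← Finset.mul_sum, ← Finset.sum_mul]
    rw [← Finset.sum_filter, Finset.filter_univ_mem]

/-- Second Griffiths inequality for characters. -/
lemma gks_two {K : V × V → ℝ} (hK : 0 ≤ K) (χ ψ : Chr V) :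
    pc K χ * pc K ψ ≤ pc K 1 * pc K (χ * ψ) := by
  have h := double_nonneg hK (χ * ψ) (fun u => 1 - sg (ψ u)) fun E G _ _ _ =>
    Finset.sum_nonneg fun u _ => by linarith [sg_le_one (ψ u)]
  have h2 : ∑ σ, ∑ τ, sg ((χ * ψ) σ) * (1 - sg (ψ (σ * τ))) * (wt K σ * wt K τ) =
      pc K 1 * pc K (χ * ψ) - pc K χ * pc K ψ := by
    simp only [pc, pf, mul_comm (∑ σ, sg ((1 : Chr V) σ) * wt K σ), Finset.sum_mul_sum, ← Finset.sum_sub_distrib]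
    refine Finset.sum_congr rfl fun σ _ => Finset.sum_congr rfl fun τ _ => ?_
    simp only [MonoidHom.mul_apply, map_mul, sg_mul, MonoidHom.one_apply, sg_one]
    linear_combination (-(sg (χ σ) * sg (ψ τ) * wt K σ * wt K τ)) * sg_mul_self (ψ σ)
  linarith

/-- First Griffiths inequality for characters. -/
lemma gks_one {K : V × V → ℝ} (hK : 0 ≤ K) (χ : Chr V) : 0 ≤ pc K χ := by
  have h := double_nonneg hK χ (fun _ => 1) fun E G _ _ _ =>
    Finset.sum_nonneg fun u _ => zero_le_one
  have h2 : ∑ σ, ∑ τ, sg (χ σ) * 1 * (wt K σ * wt K τ) = pc K χ * pc K 1 := by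
    simp only [pc, pf, Finset.sum_mul_sum]
    refine Finset.sum_congr rfl fun σ _ => Finset.sum_congr rfl fun τ _ => ?_
    simp only [MonoidHom.one_apply, sg_one]
    ring
  rw [h2] at h
  exact nonneg_of_mul_nonneg_left h (pf_one_pos K)

/-- Gaussian (Newman) inequality, with a spectator character `θ` living outside `S`. -/
lemma newman {K : V × V → ℝ} (hK : 0 ≤ K) (S : Set V)
    (hS : ∀ e, K e ≠ 0 → (e.1 ∈ S ↔ e.2 ∈ S)) (o : V) (ho : o ∈ S) (θ : Chr V)
    (hθ : ∀ u : V → ℤˣ, (∀ v ∉ S, u v = 1) → θ u = 1)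
    {ι : Type*} [DecidableEq ι] (B : Finset ι) (x : ι → V) :
    pc K (site o * θ * ∏ i ∈ B, site (x i)) * pc K 1 ≤
      ∑ i ∈ B, pc K (site o * site (x i)) * pc K (θ * ∏ j ∈ B.erase i, site (x j)) := by
  classical
  set χ : Chr V := site o * θ * ∏ i ∈ B, site (x i) with hχ
  have hfac : ∀ i ∈ B, ∀ u, χ u = (site o * site (x i)) u * (θ * ∏ j ∈ B.erase i, site (x j)) u := by
    intro i hi u
    rw [hχ, ← Finset.mul_prod_erase B (fun i => site (x i)) hi, ← MonoidHom.mul_apply]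
    congr 1
    exact mul_mul_mul_comm _ _ _ _
  have h := double_nonneg hK χ
    (fun u => ∑ i ∈ B, sg ((θ * ∏ j ∈ B.erase i, site (x j)) u) - 1) ?_
  · have h2 : ∑ σ, ∑ τ, sg (χ σ) * (∑ i ∈ B, sg ((θ * ∏ j ∈ B.erase i, site (x j)) (σ * τ)) - 1) *
          (wt K σ * wt K τ) =
        ∑ i ∈ B, pc K (site o * site (x i)) * pc K (θ * ∏ j ∈ B.erase i, site (x j)) -
          pc K χ * pc K 1 := by
      simp only [pc, pf, Finset.sum_mul_sum]
      rw [Finset.sum_comm (s := B)]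
      simp_rw [Finset.sum_comm (s := B)]
      simp only [← Finset.sum_sub_distrib]
      refine Finset.sum_congr rfl fun σ _ => Finset.sum_congr rfl fun τ _ => ?_
      rw [mul_sub, sub_mul, Finset.mul_sum, Finset.sum_mul]
      congr 1
      · refine Finset.sum_congr rfl fun i hi => ?_
        rw [hfac i hi, map_mul (θ * ∏ j ∈ B.erase i, site (x j)), sg_mul, sg_mul]
        linear_combination (sg ((site o * site (x i)) σ) *
          sg ((θ * ∏ j ∈ B.erase i, site (x j)) τ) * wt K σ * wt K τ) *
          sg_mul_self ((θ * ∏ j ∈ B.erase i, site (x j)) σ)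
      · simp only [MonoidHom.one_apply, sg_one]; ring
    linarith
  · intro E G hEG hG hone
    have hχ1 : ∀ u ∈ comp G, χ u = 1 := by
      intro u hu
      have := hone u
      rw [MonoidHom.mul_apply, MonoidHom.finsetProd_apply,
        Finset.prod_eq_one fun e he => mem_comp.1 hu e (hEG he), mul_one] at this
      exact this
    obtain ⟨i, hi, hconn⟩ : ∃ i ∈ B, ∀ σ ∈ comp G, σ (x i) = σ o := by
      by_contra! hcon
      let u : V → ℤˣ := fun v => if ∀ σ ∈ comp G, σ v = σ o then -1 else 1
      have hu : u ∈ comp G := by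
        refine mem_comp.2 fun e he => bond_eq_one.2 ?_
        have : (∀ σ ∈ comp G, σ e.1 = σ o) ↔ ∀ σ ∈ comp G, σ e.2 = σ o :=
          forall₂_congr fun σ hσ => by rw [bond_eq_one.1 (mem_comp.1 hσ e he)]
        simp only [u, this]
      have h1 := hχ1 u hu
      have huS : ∀ v ∉ S, u v = 1 := by
        intro v hv
        refine if_neg fun hc => ?_
        have h2 := hc (fun w => if w ∈ S then -1 else 1) (mem_comp.2 fun e he => bond_eq_one.2 (by
          simp only [hS e (hG e he)]))
        simp [hv, ho] at h2
      rw [hχ, MonoidHom.mul_apply, MonoidHom.mul_apply, hθ u huS, MonoidHom.finsetProd_apply,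
        Finset.prod_eq_one] at h1
      · simp [u] at h1
      · intro i hi
        obtain ⟨σ, hσ, hne⟩ := hcon i hi
        exact if_neg fun hc => hne (hc σ hσ)
    have hsg : ∀ i ∈ B, ∀ u ∈ comp G, sg ((θ * ∏ j ∈ B.erase i, site (x j)) u) =
        sg ((site o * site (x i)) u) := by
      intro i hi u hu
      have h1 := congrArg sg (hχ1 u hu)
      rw [hfac i hi, sg_mul, sg_one] at h1
      rcases sg_eq ((site o * site (x i)) u) with h | h <;> rw [h] at h1 ⊢ <;> linarith
    rw [Finset.sum_sub_distrib, Finset.sum_comm]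
    have h3 : ∑ u ∈ comp G, (1 : ℝ) = ∑ u ∈ comp G, sg ((θ * ∏ j ∈ B.erase i, site (x j)) u) :=
      Finset.sum_congr rfl fun u hu => by
        rw [hsg i hi u hu]; simp [hconn u hu]
    rw [h3, sub_nonneg]
    exact Finset.single_le_sum (f := fun i => ∑ u ∈ comp G, sg ((θ * ∏ j ∈ B.erase i, site (x j)) u))
      (fun i _ => sum_chr_comp_nonneg G _) hi

end Ising

namespace Ising

lemma sinh_le_mul_cosh {a : ℝ} (ha : 0 ≤ a) : sinh a ≤ a * cosh a := by
  have h : MonotoneOn (fun t => t * cosh t - sinh t) (Set.Ici 0) := by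
    refine monotoneOn_of_hasDerivWithinAt_nonneg (convex_Ici 0) (by fun_prop)
      (f' := fun t => t * sinh t) (fun t _ => ?_) fun t ht => ?_
    · have := (((hasDerivAt_id t).mul (hasDerivAt_cosh t)).sub (hasDerivAt_sinh t)).hasDerivWithinAt
        (s := interior (Set.Ici 0))
      refine this.congr_deriv ?_
      simp only [id]
      ring
    · have ht' : 0 < t := by simpa using ht
      exact mul_nonneg ht'.le (sinh_nonneg_iff.2 ht'.le)
  have := h Set.self_mem_Ici ha ha
  simp at this
  linarith

variable {V : Type*} [Fintype V] [DecidableEq V]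

variable (V) in
/-- Nonnegative multiples of characters. -/
def posMonoid : Submonoid ((V → ℤˣ) → ℝ) where
  carrier := {f | ∃ (c : ℝ) (χ : Chr V), 0 ≤ c ∧ f = fun σ => c * sg (χ σ)}
  one_mem' := ⟨1, 1, zero_le_one, by ext; simp⟩
  mul_mem' := by
    rintro _ _ ⟨c, χ, hc, rfl⟩ ⟨d, ψ, hd, rfl⟩
    refine ⟨c * d, χ * ψ, mul_nonneg hc hd, ?_⟩
    ext σ
    simp only [Pi.mul_apply, MonoidHom.mul_apply, sg_mul]
    ring

variable (V) in
/-- The cone of nonnegative combinations of characters. -/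
def cone : Subsemiring ((V → ℤˣ) → ℝ) := (posMonoid V).subsemiringClosure

lemma mul_chr_mem_cone {c : ℝ} (hc : 0 ≤ c) (χ : Chr V) : (fun σ => c * sg (χ σ)) ∈ cone V :=
  AddSubmonoid.subset_closure ⟨c, χ, hc, rfl⟩

lemma chr_mem_cone (χ : Chr V) : (fun σ => sg (χ σ)) ∈ cone V := by
  simpa using mul_chr_mem_cone zero_le_one χ

lemma const_mem_cone {c : ℝ} (hc : 0 ≤ c) : (fun _ => c) ∈ cone V := by
  simpa using mul_chr_mem_cone hc (1 : Chr V)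

lemma exp_mul_sg (a : ℝ) (x : ℤˣ) : exp (a * sg x) = sinh a * sg x + cosh a := by
  rcases sg_eq x with h | h <;> rw [h]
  · rw [mul_one, ← cosh_add_sinh]; ring
  · rw [mul_neg_one, ← cosh_sub_sinh]; ring

lemma exp_mem_cone {c : ℝ} (hc : 0 ≤ c) (χ : Chr V) : (fun σ => exp (c * sg (χ σ))) ∈ cone V := by
  simp only [exp_mul_sg]
  exact (cone V).add_mem (mul_chr_mem_cone (sinh_nonneg_iff.2 hc) χ)
    (const_mem_cone (cosh_pos c).le)

lemma exp_sum_mem_cone {ι : Type*} (s : Finset ι) {c : ι → ℝ} (hc : ∀ i ∈ s, 0 ≤ c i) (χ : ι → Chr V) :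
    (fun σ => exp (∑ i ∈ s, c i * sg (χ i σ))) ∈ cone V := by
  have : (fun σ => exp (∑ i ∈ s, c i * sg (χ i σ))) = ∏ i ∈ s, fun σ => exp (c i * sg (χ i σ)) := by
    ext σ; simp [exp_sum]
  rw [this]
  exact (cone V).prod_mem fun i hi => exp_mem_cone (hc i hi) (χ i)

lemma pf_add (K : V × V → ℝ) (f g : (V → ℤˣ) → ℝ) : pf K (f + g) = pf K f + pf K g := by
  simp [pf, add_mul, Finset.sum_add_distrib]

lemma pf_const_mul (K : V × V → ℝ) (c : ℝ) (f : (V → ℤˣ) → ℝ) :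
    pf K (fun σ => c * f σ) = c * pf K f := by
  simp [pf, mul_assoc, Finset.mul_sum]

lemma pf_sum (K : V × V → ℝ) {ι : Type*} (s : Finset ι) (f : ι → (V → ℤˣ) → ℝ) :
    pf K (fun σ => ∑ i ∈ s, f i σ) = ∑ i ∈ s, pf K (f i) := by
  simp only [pf, Finset.sum_mul]
  exact Finset.sum_comm

lemma pf_zero (K : V × V → ℝ) : pf K 0 = 0 := by simp [pf]

lemma pf_mono (K : V × V → ℝ) {f g : (V → ℤˣ) → ℝ} (h : ∀ σ, f σ ≤ g σ) : pf K f ≤ pf K g :=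
  Finset.sum_le_sum fun σ _ => mul_le_mul_of_nonneg_right (h σ) (wt_pos K σ).le

lemma pf_nonneg {K : V × V → ℝ} (hK : 0 ≤ K) {f : (V → ℤˣ) → ℝ} (hf : f ∈ cone V) :
    0 ≤ pf K f := by
  refine AddSubmonoid.closure_induction ?_ ?_ ?_ hf
  · rintro _ ⟨c, χ, hc, rfl⟩
    rw [pf_const_mul]
    exact mul_nonneg hc (gks_one hK χ)
  · exact (pf_zero K).ge
  · intro f g _ _ h1 h2
    rw [pf_add]; exact add_nonneg h1 h2

lemma pf_mul_pf_le {K : V × V → ℝ} (hK : 0 ≤ K) {f g : (V → ℤˣ) → ℝ} (hf : f ∈ cone V)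
    (hg : g ∈ cone V) : pf K f * pf K g ≤ pc K 1 * pf K (f * g) := by
  refine AddSubmonoid.closure_induction ?_ ?_ ?_ hf
  · rintro _ ⟨c, χ, hc, rfl⟩
    refine AddSubmonoid.closure_induction ?_ ?_ ?_ hg
    · rintro _ ⟨d, ψ, hd, rfl⟩
      have h := mul_le_mul_of_nonneg_left (gks_two hK χ ψ) (mul_nonneg hc hd)
      have h2 : ((fun σ => c * sg (χ σ)) * fun σ => d * sg (ψ σ)) =
          fun σ => c * d * sg ((χ * ψ) σ) := by
        ext σ; simp only [Pi.mul_apply, MonoidHom.mul_apply, sg_mul]; ring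
      rw [h2, pf_const_mul, pf_const_mul, pf_const_mul]
      change c * pc K χ * (d * pc K ψ) ≤ pc K 1 * (c * d * pc K (χ * ψ))
      linarith
    · simp [pf_zero]
    · intro f g _ _ h1 h2
      rw [mul_add, pf_add, pf_add, mul_add, mul_add]; exact add_le_add h1 h2
  · simp [pf_zero]
  · intro f g _ _ h1 h2
    rw [add_mul, pf_add, pf_add, mul_add, add_mul]; exact add_le_add h1 h2

/-- Expectation. -/
def ex (K : V × V → ℝ) (F : (V → ℤˣ) → ℝ) : ℝ := pf K F / pc K 1

/-- Two-point function. -/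
def corr (K : V × V → ℝ) (x y : V) : ℝ := ex K fun σ => sg (σ x) * sg (σ y)

lemma corr_eq (K : V × V → ℝ) (x y : V) : corr K x y = pc K (site x * site y) / pc K 1 := by
  simp [corr, ex, pc]

lemma corr_nonneg {K : V × V → ℝ} (hK : 0 ≤ K) (x y : V) : 0 ≤ corr K x y := by
  rw [corr_eq]; exact div_nonneg (gks_one hK _) (pf_one_pos K).le

lemma corr_comm (K : V × V → ℝ) (x y : V) : corr K x y = corr K y x := by
  simp only [corr, mul_comm]

lemma pc_le_one (K : V × V → ℝ) (χ : Chr V) : pc K χ ≤ pc K 1 := by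
  simp only [pc]; exact pf_mono K fun σ => by simpa using sg_le_one _

lemma corr_le_one (K : V × V → ℝ) (x y : V) : corr K x y ≤ 1 := by
  rw [corr_eq]; exact (div_le_one (pf_one_pos K)).2 (pc_le_one K _)

lemma wt_add (K L : V × V → ℝ) (σ : V → ℤˣ) :
    wt (K + L) σ = exp (∑ e, L e * sg (bond e σ)) * wt K σ := by
  rw [wt, wt, ← exp_add]
  simp [add_mul, Finset.sum_add_distrib, add_comm]

lemma ex_mono {K L : V × V → ℝ} (hK : 0 ≤ K) (hL : K ≤ L) {f : (V → ℤˣ) → ℝ} (hf : f ∈ cone V) :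
    ex K f ≤ ex L f := by
  have hg := exp_sum_mem_cone (V := V) Finset.univ (c := L - K) (fun e _ => sub_nonneg.2 (hL e)) bond
  have h := pf_mul_pf_le hK hf hg
  have hw : ∀ F, pf L F = pf K (F * fun σ => exp (∑ e, (L - K) e * sg (bond e σ))) := by
    intro F
    simp only [pf]
    refine Finset.sum_congr rfl fun σ _ => ?_
    conv_lhs => rw [← add_sub_cancel K L, wt_add]
    simp [mul_assoc]
  have h1 : pc L 1 = pf K (fun σ => exp (∑ e, (L - K) e * sg (bond e σ))) := by
    rw [pc, hw]; congr 1; ext σ; simp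
  rw [ex, ex, div_le_div_iff₀ (pf_one_pos K) (pf_one_pos L), h1, hw f]
  linarith

lemma corr_mono {K L : V × V → ℝ} (hK : 0 ≤ K) (hL : K ≤ L) (x y : V) : corr K x y ≤ corr L x y := by
  have := ex_mono hK hL (chr_mem_cone (site x * site y))
  simpa [corr] using this

/-- A spin in an external perturbation responds at most linearly. -/
lemma linear_response {K : V × V → ℝ} (hK : 0 ≤ K) (S : Set V)
    (hS : ∀ e, K e ≠ 0 → (e.1 ∈ S ↔ e.2 ∈ S)) (o : V) (ho : o ∈ S) (θ : Chr V)
    (hθ : ∀ u : V → ℤˣ, (∀ v ∉ S, u v = 1) → θ u = 1)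
    {ι : Type*} [DecidableEq ι] (I : Finset ι) (x : ι → V) (η : ι → Chr V)
    (hη : ∀ i ∈ I, ∀ u : V → ℤˣ, (∀ v ∉ S, u v = 1) → η i u = 1)
    (a : ι → ℝ) (ha : ∀ i ∈ I, 0 ≤ a i) :
    pf K (fun σ => sg ((site o * θ) σ) * exp (∑ i ∈ I, a i * sg ((site (x i) * η i) σ))) * pc K 1 ≤
      ∑ i ∈ I, a i * pc K (site o * site (x i)) *
        pf K (fun σ => sg ((η i * θ) σ) * exp (∑ i ∈ I, a i * sg ((site (x i) * η i) σ))) := by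
  have expand : ∀ (J : Finset ι) (ψ : Chr V),
      pf K (fun σ => sg (ψ σ) * exp (∑ i ∈ J, a i * sg ((site (x i) * η i) σ))) =
      ∑ B ∈ J.powerset, ((∏ i ∈ B, sinh (a i)) * ∏ i ∈ J \ B, cosh (a i)) *
        pc K (ψ * ∏ i ∈ B, (site (x i) * η i)) := by
    intro J ψ
    simp only [pc, ← pf_const_mul]
    rw [← pf_sum]
    congr 1
    ext σ
    rw [exp_sum]
    simp only [exp_mul_sg]
    rw [Finset.prod_add, Finset.mul_sum]
    refine Finset.sum_congr rfl fun B _ => ?_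
    rw [Finset.prod_mul_distrib, MonoidHom.mul_apply, sg_mul, MonoidHom.finsetProd_apply, sg_prod]
    ring
  set w : Finset ι → ℝ := fun B => (∏ i ∈ B, sinh (a i)) * ∏ i ∈ I \ B, cosh (a i) with hw
  have hw0 : ∀ B ∈ I.powerset, 0 ≤ w B := fun B hB => mul_nonneg
    (Finset.prod_nonneg fun i hi => sinh_nonneg_iff.2 (ha i (Finset.mem_powerset.1 hB hi)))
    (Finset.prod_nonneg fun i _ => (cosh_pos _).le)
  have step1 : pf K (fun σ => sg ((site o * θ) σ) *
        exp (∑ i ∈ I, a i * sg ((site (x i) * η i) σ))) * pc K 1 ≤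
      ∑ B ∈ I.powerset, ∑ i ∈ B, w B * (pc K (site o * site (x i)) *
        pc K (θ * (∏ j ∈ B, η j) * ∏ j ∈ B.erase i, site (x j))) := by
    rw [expand, Finset.sum_mul]
    refine Finset.sum_le_sum fun B hB => ?_
    rw [← Finset.mul_sum, mul_assoc]
    refine mul_le_mul_of_nonneg_left ?_ (hw0 B hB)
    have h := newman hK S hS o ho (θ * ∏ j ∈ B, η j) (fun u hu => by
      rw [MonoidHom.mul_apply, hθ u hu, MonoidHom.finsetProd_apply,
        Finset.prod_eq_one fun i hi => hη i (Finset.mem_powerset.1 hB hi) u hu, mul_one]) B x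
    rwa [show site o * (θ * ∏ j ∈ B, η j) * ∏ i ∈ B, site (x i) =
      site o * θ * ∏ i ∈ B, (site (x i) * η i) by
        rw [Finset.prod_mul_distrib]
        ac_rfl] at h
  have step2 : ∑ B ∈ I.powerset, ∑ i ∈ B, w B * (pc K (site o * site (x i)) *
        pc K (θ * (∏ j ∈ B, η j) * ∏ j ∈ B.erase i, site (x j))) =
      ∑ i ∈ I, ∑ B ∈ I.powerset, if i ∈ B then w B * (pc K (site o * site (x i)) *
        pc K (θ * (∏ j ∈ B, η j) * ∏ j ∈ B.erase i, site (x j))) else 0 := by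
    rw [Finset.sum_comm]
    refine Finset.sum_congr rfl fun B hB => ?_
    rw [← Finset.sum_filter]
    congr 1
    ext i
    simp only [Finset.mem_filter]
    exact ⟨fun h => ⟨Finset.mem_powerset.1 hB h, h⟩, fun h => h.2⟩
  refine step1.trans (step2.trans_le (Finset.sum_le_sum fun i hi => ?_))
  obtain ⟨I', hiI', rfl⟩ : ∃ I', i ∉ I' ∧ I = insert i I' :=
    ⟨I.erase i, Finset.notMem_erase i I, (Finset.insert_erase hi).symm⟩
  have ha' : ∀ j ∈ I', 0 ≤ a j := fun j hj => ha j (Finset.mem_insert_of_mem hj)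
  have hai := ha i (Finset.mem_insert_self i I')
  rw [Finset.sum_powerset_insert hiI']
  have z1 : ∑ B ∈ I'.powerset, (if i ∈ B then w B * (pc K (site o * site (x i)) *
        pc K (θ * (∏ j ∈ B, η j) * ∏ j ∈ B.erase i, site (x j))) else 0) = 0 :=
    Finset.sum_eq_zero fun B hB => if_neg fun h => hiI' (Finset.mem_powerset.1 hB h)
  have z2 : ∑ B ∈ I'.powerset, (if i ∈ insert i B then w (insert i B) * (pc K (site o * site (x i)) *
        pc K (θ * (∏ j ∈ insert i B, η j) * ∏ j ∈ (insert i B).erase i, site (x j))) else 0) =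
      sinh (a i) * pc K (site o * site (x i)) *
        pf K (fun σ => sg ((η i * θ) σ) * exp (∑ i ∈ I', a i * sg ((site (x i) * η i) σ))) := by
    rw [expand, Finset.mul_sum]
    refine Finset.sum_congr rfl fun B hB => ?_
    have hiB : i ∉ B := fun h => hiI' (Finset.mem_powerset.1 hB h)
    rw [if_pos (Finset.mem_insert_self i B), Finset.erase_insert hiB]
    simp only [hw]
    rw [Finset.prod_insert hiB, Finset.prod_insert hiB, Finset.insert_sdiff_insert,
      Finset.sdiff_insert_of_notMem hiI', Finset.prod_mul_distrib]
    rw [show θ * (η i * ∏ j ∈ B, η j) * ∏ j ∈ B, site (x j) =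
      η i * θ * ((∏ j ∈ B, site (x j)) * ∏ j ∈ B, η j) by
        ac_rfl]
    ring
  rw [z1, z2, zero_add]
  have hP' := exp_sum_mem_cone I' ha' (fun j => site (x j) * η j)
  have hc := pf_nonneg hK ((cone V).mul_mem (chr_mem_cone (η i * θ)) hP')
  have hc2 := pf_nonneg hK ((cone V).mul_mem (chr_mem_cone (site (x i) * θ)) hP')
  have hsplit : pf K (fun σ => sg ((η i * θ) σ) *
        exp (∑ i ∈ insert i I', a i * sg ((site (x i) * η i) σ))) =
      cosh (a i) * pf K ((fun σ => sg ((η i * θ) σ)) *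
        fun σ => exp (∑ j ∈ I', a j * sg ((site (x j) * η j) σ))) +
      sinh (a i) * pf K ((fun σ => sg ((site (x i) * θ) σ)) *
        fun σ => exp (∑ j ∈ I', a j * sg ((site (x j) * η j) σ))) := by
    rw [← pf_const_mul, ← pf_const_mul, ← pf_add]
    congr 1
    ext σ
    rw [Finset.sum_insert hiI', exp_add, exp_mul_sg]
    simp only [Pi.mul_apply, Pi.add_apply, MonoidHom.mul_apply, sg_mul]
    linear_combination (sinh (a i) * sg (site (x i) σ) * sg (θ σ) *
      exp (∑ j ∈ I', a j * (sg (site (x j) σ) * sg (η j σ)))) * sg_mul_self (η i σ)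
  rw [hsplit]
  have hcc := gks_one hK (site o * site (x i))
  have hs := sinh_nonneg_iff.2 hai
  have e1 : pf K (fun σ => sg ((η i * θ) σ) * exp (∑ j ∈ I', a j * sg ((site (x j) * η j) σ))) =
    pf K ((fun σ => sg ((η i * θ) σ)) *
        fun σ => exp (∑ j ∈ I', a j * sg ((site (x j) * η j) σ))) := rfl
  rw [e1]
  have e2 := mul_le_mul_of_nonneg_right (mul_le_mul_of_nonneg_right (sinh_le_mul_cosh hai) hcc) hc
  have e3 := mul_nonneg (mul_nonneg hai hcc) (mul_nonneg hs hc2)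
  linarith

end Ising

namespace Ising

/-- Pull back a coupling. -/
def pull {V W : Type*} (f : V → W) (K : W × W → ℝ) : V × V → ℝ := fun e => K (f e.1, f e.2)

variable {V : Type*} [Fintype V] [DecidableEq V]

lemma hasDerivAt_pf_exp (K : V × V → ℝ) (F G : (V → ℤˣ) → ℝ) (t : ℝ) :
    HasDerivAt (fun t => pf K fun σ => G σ * exp (t * F σ)) (pf K fun σ => F σ * (G σ * exp (t * F σ))) t := by
  simp only [pf]
  refine HasDerivAt.fun_sum fun σ _ => ?_
  have := ((((hasDerivAt_id t).mul_const (F σ)).exp).const_mul (G σ)).mul_const (wt K σ)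
  refine this.congr_deriv ?_
  simp only [id]
  ring

lemma pf_spin_exp_le {K : V × V → ℝ} (hK : 0 ≤ K) (a : V → ℝ) (ha : ∀ v, 0 ≤ a v) (o : V) :
    pf K (fun σ => sg (σ o) * exp (∑ v, a v * sg (σ v))) ≤
      (∑ v, a v * corr K o v) * pf K (fun σ => exp (∑ v, a v * sg (σ v))) := by
  have h := linear_response hK Set.univ (by simp) o trivial 1 (by simp) Finset.univ id (fun _ => 1)
    (by simp) a (fun v _ => ha v)
  have hZ := pf_one_pos K
  simp only [mul_one, site_apply, id, MonoidHom.one_apply, sg_one, one_mul, ← Finset.sum_mul] at h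
  rw [← mul_le_mul_iff_of_pos_right hZ]
  refine h.trans_eq ?_
  rw [mul_right_comm]
  congr 1
  rw [Finset.sum_mul]
  refine Finset.sum_congr rfl fun v _ => ?_
  rw [corr_eq, mul_assoc, div_mul_cancel₀ _ hZ.ne']

/-- Gaussian domination of the exponential moments. -/
lemma ex_exp_le {K : V × V → ℝ} (hK : 0 ≤ K) (a : V → ℝ) (ha : ∀ v, 0 ≤ a v) :
    ex K (fun σ => exp (∑ v, a v * sg (σ v))) ≤ exp ((∑ v, ∑ w, a v * a w * corr K v w) / 2) := by
  set Q := ∑ v, ∑ w, a v * a w * corr K v w with hQ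
  set F : (V → ℤˣ) → ℝ := fun σ => ∑ v, a v * sg (σ v) with hF
  have hZ := pf_one_pos K
  set g : ℝ → ℝ := fun t => pf K fun σ => 1 * exp (t * F σ) with hg
  have hd : ∀ t, HasDerivAt g (pf K fun σ => F σ * (1 * exp (t * F σ))) t :=
    hasDerivAt_pf_exp K F fun _ => 1
  have hbound : ∀ t, 0 ≤ t → (pf K fun σ => F σ * (1 * exp (t * F σ))) ≤ t * Q * g t := by
    intro t ht
    have e1 : (fun σ : V → ℤˣ => F σ * (1 * exp (t * F σ))) =
        fun σ => ∑ o, a o * (sg (σ o) * exp (∑ v, (t * a v) * sg (σ v))) := by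
      ext σ
      simp only [hF, Finset.sum_mul, Finset.mul_sum, one_mul, mul_assoc]
    have e2 : g t = pf K fun σ => exp (∑ v, (t * a v) * sg (σ v)) := by
      simp only [hg, hF, Finset.mul_sum, one_mul, mul_assoc]
    rw [e1, pf_sum, e2, hQ, Finset.mul_sum, Finset.sum_mul]
    refine Finset.sum_le_sum fun o _ => ?_
    rw [pf_const_mul]
    refine (mul_le_mul_of_nonneg_left (pf_spin_exp_le hK (fun v => t * a v)
      (fun v => mul_nonneg ht (ha v)) o) (ha o)).trans_eq ?_
    rw [← mul_assoc]
    congr 1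
    rw [Finset.mul_sum, Finset.mul_sum]
    refine Finset.sum_congr rfl fun v _ => ?_
    ring
  have hanti : AntitoneOn (fun t => g t * exp (-(t ^ 2 * Q / 2))) (Set.Icc 0 1) := by
    have hder : ∀ t, HasDerivAt (fun t => g t * exp (-(t ^ 2 * Q / 2)))
        (((pf K fun σ => F σ * (1 * exp (t * F σ))) - t * Q * g t) * exp (-(t ^ 2 * Q / 2))) t := by
      intro t
      have := (hd t).mul (((((hasDerivAt_pow 2 t).mul_const Q).div_const 2).neg).exp)
      refine this.congr_deriv ?_
      simp
      ring
    refine antitoneOn_of_hasDerivWithinAt_nonpos (convex_Icc 0 1)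
      (fun t _ => (hder t).continuousAt.continuousWithinAt) (fun t _ => (hder t).hasDerivWithinAt)
      fun t ht => ?_
    rw [interior_Icc] at ht
    exact mul_nonpos_of_nonpos_of_nonneg (sub_nonpos.2 (hbound t ht.1.le)) (exp_pos _).le
  have h := hanti (Set.left_mem_Icc.2 zero_le_one) (Set.right_mem_Icc.2 zero_le_one) zero_le_one
  have g0 : g 0 = pc K 1 := by simp [hg, pc]
  have g1 : g 1 = pf K fun σ => exp (F σ) := by simp [hg]
  simp only [g0, g1] at h
  rw [ex, div_le_iff₀ hZ]
  rw [exp_neg, mul_inv_le_iff₀ (exp_pos _)] at h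
  norm_num at h
  linarith

lemma prod_exp_expand (K : V × V → ℝ) (a : V → ℝ) :
    pf K (fun σ => exp (∑ v, a v * sg (σ v))) =
      ∑ B : Finset V, ((∏ v ∈ B, sinh (a v)) * ∏ v ∈ Bᶜ, cosh (a v)) * pc K (∏ v ∈ B, site v) := by
  simp only [pc, ← pf_const_mul]
  rw [← pf_sum]
  congr 1
  ext σ
  rw [exp_sum]
  simp only [exp_mul_sg]
  rw [Fintype.prod_add]
  refine Finset.sum_congr rfl fun B _ => ?_
  rw [Finset.prod_mul_distrib, MonoidHom.finsetProd_apply, sg_prod]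
  simp only [site_apply]
  ring

lemma ex_exp_le_abs {K : V × V → ℝ} (hK : 0 ≤ K) (a : V → ℝ) :
    ex K (fun σ => exp (∑ v, a v * sg (σ v))) ≤ ex K (fun σ => exp (∑ v, |a v| * sg (σ v))) := by
  refine div_le_div_of_nonneg_right ?_ (pf_one_pos K).le
  rw [prod_exp_expand, prod_exp_expand]
  refine Finset.sum_le_sum fun B _ => mul_le_mul_of_nonneg_right ?_ (gks_one hK _)
  simp only [cosh_abs]
  refine mul_le_mul_of_nonneg_right ?_ (Finset.prod_nonneg fun v _ => (cosh_pos _).le)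
  refine (le_abs_self _).trans ?_
  rw [Finset.abs_prod]
  simp only [abs_sinh, le_refl]

lemma pc_site (K : V × V → ℝ) (v : V) : pc K (site v) = 0 := by
  have : pc K (site v) = -pc K (site v) := by
    conv_lhs => rw [pc, pf]
    rw [pc, pf, ← Finset.sum_neg_distrib]
    refine Fintype.sum_equiv (Equiv.neg _) _ _ fun σ => ?_
    simp [wt]
  linarith

lemma one_le_ex_exp (K : V × V → ℝ) (a : V → ℝ) :
    1 ≤ ex K (fun σ => exp (∑ v, a v * sg (σ v))) := by
  rw [ex, one_le_div (pf_one_pos K)]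
  have h : pc K 1 = pf K fun σ => (∑ v, a v * sg (site v σ)) + 1 := by
    have := pf_add K (fun σ => ∑ v, a v * sg (site v σ)) fun _ => 1
    rw [pf_sum] at this
    simp only [pf_const_mul] at this
    rw [Finset.sum_eq_zero fun v _ => by
      show a v * pc K (site v) = 0
      rw [pc_site, mul_zero]] at this
    simpa [pc, Pi.add_def] using this.symm
  rw [h]
  exact pf_mono K fun σ => add_one_le_exp _

lemma ex_sq_eq (K : V × V → ℝ) (d : V → ℝ) :
    ex K (fun σ => (∑ v, d v * sg (σ v)) ^ 2) = ∑ v, ∑ w, d v * d w * corr K v w := by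
  have : (fun σ : V → ℤˣ => (∑ v, d v * sg (σ v)) ^ 2) =
      fun σ => ∑ v, ∑ w, d v * d w * (sg (σ v) * sg (σ w)) := by
    ext σ
    rw [sq, Finset.sum_mul_sum]
    refine Finset.sum_congr rfl fun v _ => Finset.sum_congr rfl fun w _ => by ring
  rw [ex, this, pf_sum, Finset.sum_div]
  refine Finset.sum_congr rfl fun v _ => ?_
  rw [pf_sum, Finset.sum_div]
  refine Finset.sum_congr rfl fun w _ => ?_
  rw [pf_const_mul, mul_div_assoc]; rfl

lemma quad_le {K : V × V → ℝ} (hK : 0 ≤ K) {X : ℝ} (hX : ∀ v, ∑ w, corr K v w ≤ X) (d : V → ℝ) :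
    ∑ v, ∑ w, d v * d w * corr K v w ≤ X * ∑ v, d v ^ 2 := by
  have h1 : ∑ v, ∑ w, d v * d w * corr K v w ≤
      ∑ v, ∑ w, (d v ^ 2 / 2 * corr K v w + d w ^ 2 / 2 * corr K w v) := by
    refine Finset.sum_le_sum fun v _ => Finset.sum_le_sum fun w _ => ?_
    rw [corr_comm K w v, ← add_mul]
    refine mul_le_mul_of_nonneg_right ?_ (corr_nonneg hK v w)
    nlinarith [sq_nonneg (d v - d w)]
  refine h1.trans ?_
  simp only [Finset.sum_add_distrib]
  rw [Finset.sum_comm (f := fun v w => d w ^ 2 / 2 * corr K w v)]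
  simp only [← Finset.mul_sum]
  rw [← Finset.sum_add_distrib, Finset.mul_sum]
  refine Finset.sum_le_sum fun v _ => ?_
  nlinarith [sq_nonneg (d v), hX v]

variable {W : Type*} [Fintype W] [DecidableEq W]

/-- Integrate out the spins in the image of an embedding. -/
lemma sum_mul_embedding {f : V → W} (hf : Function.Injective f) (A : (V → ℤˣ) → ℝ)
    (B : (W → ℤˣ) → ℝ) (hB : ∀ σ τ, (∀ w, w ∉ Set.range f → σ w = τ w) → B σ = B τ) :
    Fintype.card (V → ℤˣ) * ∑ σ, A (σ ∘ f) * B σ = (∑ τ, A τ) * ∑ σ, B σ := by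
  have h1 : ∀ τ : V → ℤˣ, ∑ σ, A (σ ∘ f) * B σ = ∑ σ : W → ℤˣ, A (σ ∘ f * τ) * B σ := by
    intro τ
    refine Fintype.sum_equiv (Equiv.mulRight (Function.extend f τ 1)) _ _ fun σ => ?_
    have e1 : (Equiv.mulRight (Function.extend f τ 1) σ) ∘ f * τ = σ ∘ f := by
      ext v; simp [hf.extend_apply, mul_assoc]
    rw [e1]
    congr 1
    refine hB _ _ fun w hw => ?_
    have : Function.extend f τ 1 w = 1 := Function.extend_apply' _ _ _ fun ⟨v, hv⟩ => hw ⟨v, hv⟩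
    simp [this]
  calc Fintype.card (V → ℤˣ) * ∑ σ, A (σ ∘ f) * B σ
      = ∑ τ : V → ℤˣ, ∑ σ, A (σ ∘ f) * B σ := by simp
    _ = ∑ τ, ∑ σ : W → ℤˣ, A (σ ∘ f * τ) * B σ := Finset.sum_congr rfl fun τ _ => h1 τ
    _ = ∑ σ : W → ℤˣ, ∑ τ, A (σ ∘ f * τ) * B σ := Finset.sum_comm
    _ = ∑ σ : W → ℤˣ, (∑ τ, A τ) * B σ := by
        refine Finset.sum_congr rfl fun σ _ => ?_
        rw [← Finset.sum_mul]
        congr 1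
        exact Fintype.sum_equiv (Equiv.mulLeft (σ ∘ f)) _ _ fun τ => rfl
    _ = _ := by rw [Finset.mul_sum]

lemma sum_range_embedding {f : V → W} (hf : Function.Injective f) (g : W × W → ℝ) :
    ∑ e : V × V, g (f e.1, f e.2) =
      ∑ e ∈ Finset.univ.filter fun e : W × W => e.1 ∈ Set.range f ∧ e.2 ∈ Set.range f, g e := by
  classical
  refine Finset.sum_bij (fun e _ => (f e.1, f e.2)) ?_ ?_ ?_ ?_
  · intro e _; simp
  · rintro ⟨a, b⟩ _ ⟨c, d⟩ _ h
    simp only [Prod.mk.injEq] at h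
    rw [hf h.1, hf h.2]
  · rintro ⟨_, _⟩ h
    simp only [Finset.mem_filter, Finset.mem_univ, true_and] at h
    obtain ⟨⟨a, rfl⟩, ⟨b, rfl⟩⟩ := h
    exact ⟨(a, b), Finset.mem_univ _, rfl⟩
  · intro e _; rfl

lemma corr_pull {f : V → W} (hf : Function.Injective f) {K : W × W → ℝ}
    (hK : ∀ e, K e ≠ 0 → (e.1 ∈ Set.range f ↔ e.2 ∈ Set.range f)) (x y : V) :
    corr (pull f K) x y = corr K (f x) (f y) := by
  classical
  set R := Finset.univ.filter fun e : W × W => e.1 ∈ Set.range f ∧ e.2 ∈ Set.range f with hR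
  set B : (W → ℤˣ) → ℝ := fun σ => exp (∑ e ∈ Rᶜ, K e * sg (bond e σ)) with hB
  have hw : ∀ σ : W → ℤˣ, wt K σ = wt (pull f K) (σ ∘ f) * B σ := by
    intro σ
    rw [wt, wt, hB, ← exp_add, ← Finset.sum_add_sum_compl R]
    have := sum_range_embedding hf fun e => K e * sg (bond e σ)
    rw [hR, ← this]
    rfl
  have hB' : ∀ σ τ : W → ℤˣ, (∀ w, w ∉ Set.range f → σ w = τ w) → B σ = B τ := by
    intro σ τ h
    simp only [hB]
    congr 1
    refine Finset.sum_congr rfl fun e he => ?_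
    by_cases h0 : K e = 0
    · simp [h0]
    · have := hK e h0
      simp only [hR, Finset.mem_compl, Finset.mem_filter, Finset.mem_univ, true_and] at he
      have h1 : e.1 ∉ Set.range f := fun h1 => he ⟨h1, this.1 h1⟩
      have h2 : e.2 ∉ Set.range f := fun h2 => h1 (this.2 h2)
      rw [bond_apply, bond_apply, h _ h1, h _ h2]
  have key : ∀ F : (V → ℤˣ) → ℝ, Fintype.card (V → ℤˣ) * pf K (fun σ => F (σ ∘ f)) =
      pf (pull f K) F * ∑ σ, B σ := by
    intro F
    have := sum_mul_embedding hf (fun τ => F τ * wt (pull f K) τ) B hB'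
    rw [pf, pf, ← this]
    congr 1
    exact Finset.sum_congr rfl fun σ _ => by rw [hw]; ring
  have hBpos : 0 < ∑ σ, B σ := Finset.sum_pos (fun σ _ => exp_pos _) Finset.univ_nonempty
  have hc : (0 : ℝ) < Fintype.card (V → ℤˣ) := by exact_mod_cast Fintype.card_pos
  have k1 := key fun τ => sg (τ x) * sg (τ y)
  have k2 := key fun τ => sg ((1 : Chr V) τ)
  rw [corr, corr, ex, ex, div_eq_div_iff (pf_one_pos _).ne' (pf_one_pos _).ne']
  have k3 : pc K 1 = pf K fun σ => sg ((1 : Chr V) (σ ∘ f)) := by simp [pc]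
  rw [k3]
  rw [pc]
  refine mul_right_cancel₀ (mul_pos hBpos hc).ne' ?_
  simp only [Function.comp_apply] at k1
  linear_combination (pf (pull f K) (fun σ => sg (σ x) * sg (σ y)) * ∑ σ, B σ) * k2 -
    (pf (pull f K) (fun σ => sg ((1 : Chr V) σ)) * ∑ σ, B σ) * k1

lemma corr_embedding_le {f : V → W} (hf : Function.Injective f) {K : V × V → ℝ} {L : W × W → ℝ}
    (hK : 0 ≤ K) (hL : 0 ≤ L) (h : ∀ e : V × V, K e ≤ L (f e.1, f e.2)) (x y : V) :
    corr K x y ≤ corr L (f x) (f y) := by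
  classical
  set L' : W × W → ℝ := fun e => if e.1 ∈ Set.range f ∧ e.2 ∈ Set.range f then L e else 0 with hL'
  have h0 : 0 ≤ L' := fun e => by
    simp only [hL']; split_ifs
    exacts [hL e, le_rfl]
  have h1 : L' ≤ L := fun e => by
    simp only [hL']; split_ifs
    exacts [le_rfl, hL e]
  refine (corr_mono hK (L := pull f L') (fun e => ?_) x y).trans ?_
  · simpa [pull, hL'] using h e
  rw [corr_pull hf]
  · exact corr_mono h0 h1 _ _
  · intro e he
    simp only [hL', ne_eq, ite_eq_right_iff, not_forall] at he
    exact iff_of_true he.1.1 he.1.2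

/-- The coupling restricted to the vertices in `S`. -/
abbrev res (K : V × V → ℝ) (S : Finset V) : S × S → ℝ := pull Subtype.val K

lemma sum_boundary (S : Finset V) (g : V × V → ℝ) :
    ∑ e ∈ Finset.univ.filter (fun e : V × V => ¬(e.1 ∈ S ↔ e.2 ∈ S)), g e =
      ∑ s : S, ∑ y ∈ Sᶜ, (g (s, y) + g (y, s)) := by
  rw [Finset.sum_coe_sort S (fun s => ∑ y ∈ Sᶜ, (g (s, y) + g (y, s)))]
  simp only [Finset.sum_add_distrib]
  rw [Finset.sum_comm (f := fun s y => g (y, s)), ← Finset.sum_product', ← Finset.sum_product',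
    ← Finset.sum_union]
  · refine Finset.sum_congr ?_ fun _ _ => rfl
    ext e
    simp only [Finset.mem_filter, Finset.mem_univ, true_and, Finset.mem_union, Finset.mem_product,
      Finset.mem_compl]
    tauto
  · rw [Finset.disjoint_left]
    intro e
    simp only [Finset.mem_product, Finset.mem_compl]
    tauto

/-- The Simon–Lieb inequality. -/
lemma simon_lieb {K : V × V → ℝ} (hK : 0 ≤ K) (S : Finset V) (x : S) {z : V} (hz : z ∉ S) :
    corr K x z ≤ ∑ s : S, ∑ y ∈ Sᶜ, (K (s, y) + K (y, s)) * corr (res K S) x s * corr K y z := by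
  set I := Finset.univ.filter (fun e : V × V => ¬(e.1 ∈ S ↔ e.2 ∈ S)) with hI
  set K0 : V × V → ℝ := fun e => if e.1 ∈ S ↔ e.2 ∈ S then K e else 0 with hK0
  set inn : V × V → V := fun e => if e.1 ∈ S then e.1 else e.2 with hinn
  set out : V × V → V := fun e => if e.1 ∈ S then e.2 else e.1 with hout
  have hbond : ∀ e, site (inn e) * site (out e) = bond e := by
    intro e
    simp only [hinn, hout]
    split_ifs
    exacts [rfl, mul_comm _ _]
  have hK0n : 0 ≤ K0 := fun e => by
    simp only [hK0]; split_ifs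
    exacts [hK e, le_rfl]
  have hK0S : ∀ e, K0 e ≠ 0 → (e.1 ∈ S ↔ e.2 ∈ S) := fun e he => by
    by_contra hc
    exact he (if_neg hc)
  have hw : ∀ σ, exp (∑ e ∈ I, K e * sg (bond e σ)) * wt K0 σ = wt K σ := by
    intro σ
    rw [wt, wt, ← exp_add, ← Finset.sum_add_sum_compl I fun e => K e * sg (bond e σ)]
    congr 2
    rw [← Finset.sum_add_sum_compl I, Finset.sum_eq_zero, zero_add]
    · refine Finset.sum_congr rfl fun e he => ?_
      simp only [hI, Finset.mem_compl, Finset.mem_filter, Finset.mem_univ, true_and, not_not] at he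
      simp only [hK0, if_pos he]
    · intro e he
      simp only [hI, Finset.mem_filter, Finset.mem_univ, true_and] at he
      simp only [hK0, if_neg he, zero_mul]
  have hpf : ∀ χ : Chr V, pf K0 (fun σ => sg (χ σ) * exp (∑ e ∈ I, K e * sg (bond e σ))) = pc K χ := by
    intro χ
    simp only [pc, pf, mul_assoc, hw]
  have h := linear_response hK0n (S : Set V) hK0S x x.2 (site z) (fun u hu => hu z hz) I inn
    (fun e => site (out e)) (fun e he u hu => hu _ ?_) K fun e _ => hK e
  swap
  · simp only [hI, Finset.mem_filter, Finset.mem_univ, true_and] at he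
    simp only [hout, Finset.mem_coe]
    split_ifs <;> tauto
  simp only [hbond, hpf] at h
  have hZ := pf_one_pos K
  have hZ0 := pf_one_pos K0
  have hcorr : ∀ s : S, corr (res K S) x s = corr K0 x s := by
    intro s
    rw [← corr_pull (f := (Subtype.val : S → V)) Subtype.val_injective (by simpa using hK0S)]
    congr 1
    ext e
    simp [pull, hK0]
  have h2 : corr K x z ≤ ∑ e ∈ I, K e * corr K0 x (inn e) * corr K (out e) z := by
    rw [corr_eq, div_le_iff₀ hZ, ← mul_le_mul_iff_of_pos_right hZ0]
    refine h.trans_eq ?_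
    rw [Finset.sum_mul, Finset.sum_mul]
    refine Finset.sum_congr rfl fun e _ => ?_
    rw [corr_eq, corr_eq]
    field_simp
  refine h2.trans_eq ?_
  rw [hI, sum_boundary]
  refine Finset.sum_congr rfl fun s _ => Finset.sum_congr rfl fun y hy => ?_
  have hy' : y ∉ S := Finset.mem_compl.1 hy
  simp only [hinn, hout, s.2, hy', if_true, if_false, hcorr]
  ring

end Ising

namespace Ising

variable {V : Type*} [Fintype V] [DecidableEq V]

/-- If the boundary term of one finite set containing the origin is below one, then the
susceptibility is bounded uniformly over all finite subsystems. -/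
lemma susceptibility_le {κ : ℤ × ℤ → ℝ} (hκ : 0 ≤ κ)
    (htr : ∀ a m n : ℤ, κ (m + a, n + a) = κ (m, n)) (S : Finset ℤ) (h0 : (0 : ℤ) ∈ S) (T : ℤ → ℝ)
    (hT : ∀ s ∈ S, ∀ Y : Finset ℤ, Disjoint Y S → ∑ y ∈ Y, (κ (s, y) + κ (y, s)) ≤ T s)
    {φ : ℝ} (hφ : ∑ s : S, corr (pull (Subtype.val : S → ℤ) κ) ⟨0, h0⟩ s * T s ≤ φ) (hφ1 : φ < 1)
    {p : V → ℤ} (hp : Function.Injective p) (x : V) :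
    ∑ z, corr (pull p κ) x z ≤ S.card / (1 - φ) := by
  set K := pull p κ with hKdef
  have hK : 0 ≤ K := fun e => hκ _
  obtain ⟨x₀, -, hx₀⟩ := Finset.exists_max_image Finset.univ (fun x => ∑ z, corr K x z) ⟨x, Finset.mem_univ x⟩
  refine (hx₀ x (Finset.mem_univ _)).trans ?_
  set M := ∑ z, corr K x₀ z with hM
  have hM0 : 0 ≤ M := Finset.sum_nonneg fun z _ => corr_nonneg hK _ _
  set R : Finset V := Finset.univ.filter fun v => p v - p x₀ ∈ S with hR
  have hxR : x₀ ∈ R := by simp [hR, h0]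
  have hmR : ∀ v, v ∈ R ↔ p v - p x₀ ∈ S := fun v => by simp [hR]
  have hinj : Function.Injective fun v => p v - p x₀ := fun v w h => hp (by simpa using h)
  have hcard : (R.card : ℝ) ≤ S.card := by
    exact_mod_cast Finset.card_le_card_of_injOn (fun v => p v - p x₀)
      (fun v hv => (hmR v).1 hv) hinj.injOn
  let j : R → S := fun v => ⟨p v - p x₀, (hmR v).1 v.2⟩
  have hj : Function.Injective j := fun v w h => Subtype.ext (hinj (congrArg Subtype.val h))
  have hT0 : ∀ s ∈ S, 0 ≤ T s := fun s hs => by simpa using hT s hs ∅ (Finset.disjoint_empty_left _)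
  have hKS : 0 ≤ pull (Subtype.val : S → ℤ) κ := fun e => hκ _
  have hKR : 0 ≤ res K R := fun e => hK _
  have hcj : ∀ s : R, corr (res K R) ⟨x₀, hxR⟩ s ≤
      corr (pull (Subtype.val : S → ℤ) κ) ⟨0, h0⟩ (j s) := by
    intro s
    have := corr_embedding_le hj (K := res K R) (L := pull (Subtype.val : S → ℤ) κ)
      (fun e => hκ _) (fun e => hκ _) (fun e => by
        simp only [pull, hKdef, j, sub_eq_add_neg]
        rw [htr]) ⟨x₀, hxR⟩ s
    have h2 : j ⟨x₀, hxR⟩ = ⟨0, h0⟩ := by simp [j]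
    rwa [h2] at this
  have hbd : ∑ s : R, ∑ y ∈ Rᶜ, (K (s, y) + K (y, s)) * corr (res K R) ⟨x₀, hxR⟩ s ≤ φ := by
    refine le_trans ?_ hφ
    calc ∑ s : R, ∑ y ∈ Rᶜ, (K (s, y) + K (y, s)) * corr (res K R) ⟨x₀, hxR⟩ s
        ≤ ∑ s : R, corr (pull (Subtype.val : S → ℤ) κ) ⟨0, h0⟩ (j s) * T (j s) := by
          refine Finset.sum_le_sum fun s _ => ?_
          rw [← Finset.sum_mul, mul_comm]
          refine mul_le_mul (hcj s) ?_ (Finset.sum_nonneg fun y _ => add_nonneg (hK _) (hK _))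
            (corr_nonneg hKS _ _)
          have h1 := hT (j s) (j s).2 (Rᶜ.image fun v => p v - p x₀) (by
            rw [Finset.disjoint_left]
            intro y hy hyS
            obtain ⟨v, hv, rfl⟩ := Finset.mem_image.1 hy
            exact Finset.mem_compl.1 hv ((hmR v).2 hyS))
          rw [Finset.sum_image hinj.injOn] at h1
          refine le_trans (Finset.sum_le_sum fun y _ => ?_) h1
          simp only [hKdef, pull, j, sub_eq_add_neg]
          rw [htr, htr]
      _ ≤ ∑ s : S, corr (pull (Subtype.val : S → ℤ) κ) ⟨0, h0⟩ s * T s := by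
          rw [← Finset.sum_image (s := Finset.univ) (g := j)
            (f := fun s => corr (pull (Subtype.val : S → ℤ) κ) ⟨0, h0⟩ s * T s) hj.injOn]
          exact Finset.sum_le_sum_of_subset_of_nonneg (Finset.subset_univ _) fun s _ _ =>
            mul_nonneg (corr_nonneg hKS _ _) (hT0 s s.2)
  have hmain : M ≤ S.card + φ * M := by
    refine (Finset.sum_add_sum_compl R _).symm.trans_le (add_le_add ?_ ?_)
    · refine (Finset.sum_le_sum fun z _ => corr_le_one K x₀ z).trans ?_
      simpa using hcard
    · calc ∑ z ∈ Rᶜ, corr K x₀ z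
          ≤ ∑ z ∈ Rᶜ, ∑ s : R, ∑ y ∈ Rᶜ, (K (s, y) + K (y, s)) *
              corr (res K R) ⟨x₀, hxR⟩ s * corr K y z :=
            Finset.sum_le_sum fun z hz => simon_lieb hK R ⟨x₀, hxR⟩ (Finset.mem_compl.1 hz)
        _ ≤ ∑ s : R, ∑ y ∈ Rᶜ, (K (s, y) + K (y, s)) * corr (res K R) ⟨x₀, hxR⟩ s * M := by
            rw [Finset.sum_comm]
            refine Finset.sum_le_sum fun s _ => ?_
            rw [Finset.sum_comm]
            refine Finset.sum_le_sum fun y _ => ?_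
            rw [← Finset.mul_sum]
            refine mul_le_mul_of_nonneg_left ?_ (mul_nonneg (add_nonneg (hK _) (hK _))
              (corr_nonneg hKR _ _))
            exact (Finset.sum_le_sum_of_subset_of_nonneg (Finset.subset_univ _) fun z _ _ =>
              corr_nonneg hK _ _).trans (hx₀ y (Finset.mem_univ _))
        _ ≤ φ * M := by
            simp only [← Finset.sum_mul]
            simp only [← Finset.sum_mul] at hbd
            exact mul_le_mul_of_nonneg_right hbd hM0
  rw [le_div_iff₀ (by linarith)]
  linarith

end Ising

namespace Ising

lemma sum_inter_mul_prod {E : Type*} [Fintype E] [DecidableEq E] (A : Finset E)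
    (p : Finset E → ℝ) (u v : E → ℝ) :
    ∑ G : Finset E, p (G ∩ A) * ((∏ e ∈ G, u e) * ∏ e ∈ Gᶜ, v e) =
      (∑ H ∈ A.powerset, p H * ((∏ e ∈ H, u e) * ∏ e ∈ A \ H, v e)) * ∏ e ∈ Aᶜ, (u e + v e) := by
  rw [Finset.prod_add, Finset.sum_mul_sum, ← Finset.sum_product']
  refine Finset.sum_bij' (fun G _ => (G ∩ A, G \ A)) (fun q _ => q.1 ∪ q.2) ?_ ?_ ?_ ?_ ?_
  · intro G _
    simp only [Finset.mem_product, Finset.mem_powerset]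
    exact ⟨Finset.inter_subset_right, fun e he => by simp_all⟩
  · intro q _; exact Finset.mem_univ _
  · intro G _; ext e; simp only [Finset.mem_union, Finset.mem_inter, Finset.mem_sdiff]; tauto
  · rintro ⟨H, T⟩ hq
    simp only [Finset.mem_product, Finset.mem_powerset, Finset.subset_iff, Finset.mem_compl] at hq
    have h1 := hq.1
    have h2 := hq.2
    refine Prod.ext (Finset.ext fun e => ?_) (Finset.ext fun e => ?_)
    · have := @h1 e
      have := @h2 e
      simp only [Finset.mem_union, Finset.mem_inter]; tauto
    · have := @h1 e
      have := @h2 e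
      simp only [Finset.mem_union, Finset.mem_sdiff]; tauto
  · intro G _
    have h1 : ∏ e ∈ G, u e = (∏ e ∈ G ∩ A, u e) * ∏ e ∈ G \ A, u e :=
      (Finset.prod_inter_mul_prod_sdiff G A u).symm
    have h2 : ∏ e ∈ Gᶜ, v e = (∏ e ∈ A \ (G ∩ A), v e) * ∏ e ∈ Aᶜ \ (G \ A), v e := by
      rw [← Finset.prod_inter_mul_prod_sdiff Gᶜ A v]
      congr 1 <;> refine Finset.prod_congr (Finset.ext fun e => ?_) fun _ _ => rfl
      · simp only [Finset.mem_inter, Finset.mem_compl, Finset.mem_sdiff]; tauto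
      · simp only [Finset.mem_compl, Finset.mem_sdiff]; tauto
    rw [h1, h2]; ring

variable {V : Type*} [Fintype V] [DecidableEq V]

/-- The random cluster edge weight. -/
def gw (K : V × V → ℝ) (G : Finset (V × V)) : ℝ := (∏ e ∈ G, 2 * sinh (K e)) * ∏ e ∈ Gᶜ, exp (-K e)

lemma gw_nonneg {K : V × V → ℝ} (hK : 0 ≤ K) (G : Finset (V × V)) : 0 ≤ gw K G :=
  mul_nonneg (Finset.prod_nonneg fun e _ => mul_nonneg two_pos.le (sinh_nonneg_iff.2 (hK e)))
    (Finset.prod_nonneg fun _ _ => (exp_pos _).le)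

lemma gw_mul (K : V × V → ℝ) (G H : Finset (V × V)) :
    gw K G * gw K H = gw K (G ⊓ H) * gw K (G ⊔ H) := by
  have h : ∀ G, gw K G = ∏ e, if e ∈ G then 2 * sinh (K e) else exp (-K e) := by
    intro G
    rw [gw, Finset.prod_ite]
    congr 1 <;> refine Finset.prod_congr (by ext; simp) fun _ _ => rfl
  simp only [h, ← Finset.prod_mul_distrib]
  refine Finset.prod_congr rfl fun e _ => ?_
  by_cases h1 : e ∈ G <;> by_cases h2 : e ∈ H <;> simp [h1, h2, mul_comm]

lemma exp_mul_sg_eq (a : ℝ) (x : ℤˣ) :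
    exp (a * sg x) = 2 * sinh a * (if x = 1 then 1 else 0) + exp (-a) := by
  rcases Int.units_eq_one_or x with h | h <;> simp [h]
  rw [← cosh_add_sinh, ← cosh_sub_sinh]; ring

lemma prod_mul_ind (K : V × V → ℝ) (G : Finset (V × V)) (σ : V → ℤˣ) :
    (∏ e ∈ G, 2 * sinh (K e) * (if bond e σ = 1 then 1 else 0)) * ∏ e ∈ Gᶜ, exp (-K e) =
      gw K G * if σ ∈ comp G then 1 else 0 := by
  rw [Finset.prod_mul_distrib, prod_ind_comp, gw]; ring

lemma pf_eq_sum (K : V × V → ℝ) (F : (V → ℤˣ) → ℝ) :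
    pf K F = ∑ G, gw K G * ∑ σ ∈ comp G, F σ := by
  have : ∀ σ, wt K σ = ∑ G, gw K G * if σ ∈ comp G then 1 else 0 := by
    intro σ
    simp only [wt, exp_sum, exp_mul_sg_eq, Fintype.prod_add, prod_mul_ind]
  simp only [pf, this, Finset.mul_sum]
  rw [Finset.sum_comm]
  refine Finset.sum_congr rfl fun G _ => ?_
  rw [← Finset.sum_filter_add_sum_filter_not Finset.univ (fun σ => σ ∈ comp G), Finset.filter_univ_mem,
    add_eq_left.2]
  · refine Finset.sum_congr rfl fun σ hσ => ?_
    rw [if_pos hσ]; ring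
  · refine Finset.sum_eq_zero fun σ hσ => ?_
    rw [if_neg (Finset.mem_filter.1 hσ).2]; ring

/-- Two sites are connected when compatible configurations agree there. -/
def Conn (G : Finset (V × V)) (v w : V) : Prop := ∀ σ ∈ comp G, σ v = σ w

lemma comp_anti {G H : Finset (V × V)} (h : G ⊆ H) : comp H ⊆ comp G := fun _ hσ =>
  mem_comp.2 fun e he => mem_comp.1 hσ e (h he)

lemma Conn.mono {G H : Finset (V × V)} (h : G ⊆ H) {v w : V} (hc : Conn G v w) : Conn H v w :=
  fun σ hσ => hc σ (comp_anti h hσ)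

/-- The number of compatible configurations. -/
def nc (G : Finset (V × V)) : ℝ := (comp G).card

lemma nc_pos (G : Finset (V × V)) : 0 < nc G := by
  rw [nc, Nat.cast_pos, Finset.card_pos]
  exact ⟨1, mem_comp.2 fun e _ => map_one _⟩

lemma nc_mul_le (G H : Finset (V × V)) : nc G * nc H ≤ nc (G ∩ H) * nc (G ∪ H) := by
  have key : ((comp G) ×ˢ (comp H)).card ≤ (comp (G ∪ H)).card * (comp (G ∩ H)).card := by
    refine Finset.card_le_mul_card_image_of_maps_to (f := fun q => q.1 * q.2) ?_ _ ?_
    · rintro ⟨σ, τ⟩ h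
      rw [Finset.mem_product] at h
      exact mul_mem_comp (comp_anti Finset.inter_subset_left h.1)
        (comp_anti Finset.inter_subset_right h.2)
    · intro ρ _
      by_cases hne : ∃ q ∈ (comp G) ×ˢ (comp H), q.1 * q.2 = ρ
      · obtain ⟨⟨σ₀, τ₀⟩, hq, rfl⟩ := hne
        rw [Finset.mem_product] at hq
        refine Finset.card_le_card_of_injOn (fun q => σ₀ * q.1) ?_ ?_
        · rintro ⟨σ, τ⟩ h
          simp only [Finset.coe_filter, Finset.mem_product, Set.mem_ofPred_eq] at h
          have e1 : σ₀ * σ = τ₀ * τ := by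
            have := congrArg (fun ρ => σ₀ * ρ * τ) h.2
            rw [show σ₀ * (σ * τ) * τ = σ₀ * σ * (τ * τ) by ac_rfl,
              show σ₀ * (σ₀ * τ₀) * τ = σ₀ * σ₀ * (τ₀ * τ) by ac_rfl] at this
            simpa [config_mul_self] using this
          have m1 := mul_mem_comp hq.1 h.1.1
          have m2 : σ₀ * σ ∈ comp H := e1 ▸ mul_mem_comp hq.2 h.1.2
          refine mem_comp.2 fun e he => ?_
          rcases Finset.mem_union.1 he with he | he
          exacts [mem_comp.1 m1 e he, mem_comp.1 m2 e he]
        · rintro ⟨σ, τ⟩ h ⟨σ', τ'⟩ h' heq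
          simp only [Finset.coe_filter, Finset.mem_product, Set.mem_ofPred_eq] at h h'
          obtain rfl : σ = σ' := mul_left_cancel heq
          have := h.2.trans h'.2.symm
          rw [mul_left_cancel this]
      · push Not at hne
        rw [Finset.card_eq_zero.2 (Finset.filter_eq_empty_iff.2 fun q hq => hne q hq)]
        exact Nat.zero_le _
  rw [Finset.card_product] at key
  rw [mul_comm (nc (G ∩ H))]
  simp only [nc]
  exact_mod_cast key

/-- The conditional probability that an edge is satisfied. -/
def qr (e : V × V) (G : Finset (V × V)) : ℝ := nc (insert e G) / nc G

lemma qr_mono (e : V × V) : Monotone (qr e : Finset (V × V) → ℝ) := by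
  intro G H h
  rw [qr, qr, div_le_div_iff₀ (nc_pos _) (nc_pos _)]
  by_cases he : e ∈ H
  · rw [Finset.insert_eq_of_mem he, mul_comm]
    refine mul_le_mul_of_nonneg_left ?_ (nc_pos _).le
    simp only [nc]
    exact_mod_cast Finset.card_le_card (comp_anti (Finset.subset_insert e G))
  · have := nc_mul_le (insert e G) H
    rwa [Finset.insert_inter_of_notMem he, Finset.inter_eq_left.2 h, Finset.insert_union,
      Finset.union_eq_right.2 h, mul_comm (nc G)] at this

lemma comp_insert (e : V × V) (G : Finset (V × V)) :
    comp (insert e G) = (comp G).filter fun σ => bond e σ = 1 := by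
  ext σ
  simp only [mem_comp, Finset.mem_filter, Finset.forall_mem_insert, and_comm]

lemma ind_bond (e : V × V) (σ : V → ℤˣ) :
    sg (bond e σ) = 2 * (if bond e σ = 1 then 1 else 0) - 1 := by
  rcases Int.units_eq_one_or (bond e σ) with h | h <;> rw [h] <;> norm_num

lemma half_le_qr (e : V × V) (G : Finset (V × V)) : 1 / 2 ≤ qr e G := by
  have h := sum_chr_comp_nonneg G (bond e)
  simp only [ind_bond, Finset.sum_sub_distrib, ← Finset.mul_sum] at h
  rw [Finset.sum_ite, ← comp_insert] at h
  rw [qr, le_div_iff₀ (nc_pos G)]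
  simp [nc] at h ⊢
  linarith

open Classical in
/-- Connection indicator. -/
def ci (a g : V) (G : Finset (V × V)) : ℝ := if Conn G a g then 1 else 0

lemma ci_mono (a g : V) : Monotone (ci a g : Finset (V × V) → ℝ) := by
  intro G H h
  by_cases hc : Conn G a g
  · simp [ci, hc, hc.mono h]
  · rw [ci, if_neg hc, ci]; split_ifs <;> norm_num

lemma ci_nonneg (a g : V) (G : Finset (V × V)) : 0 ≤ ci a g G := by
  rw [ci]; split_ifs <;> norm_num

lemma sum_comp_pair (a g : V) (G : Finset (V × V)) :
    ∑ σ ∈ comp G, sg ((site a * site g) σ) = nc G * ci a g G := by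
  have hiff : Conn G a g ↔ ∀ σ ∈ comp G, (site a * site g) σ = 1 :=
    forall₂_congr fun _ _ => (bond_eq_one (e := (a, g))).symm
  by_cases h : Conn G a g
  · rw [ci, if_pos h, mul_one, Finset.sum_congr rfl fun σ hσ => by rw [hiff.1 h σ hσ]]
    simp [nc]
  · rw [ci, if_neg h, mul_zero]
    exact (sum_chr_comp G _).resolve_left fun h' => h (hiff.2 h')

/-- Pivotality bound for the covariance of a spin pair with an edge. -/
lemma covariance_ge {K : V × V → ℝ} (hK : 0 ≤ K) (a g : V) (e : V × V) :
    pc K 1 * ∑ G, gw K G * nc G * (ci a g (insert e G) - ci a g G) ≤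
      pc K (site a * site g * bond e) * pc K 1 - pc K (site a * site g) * pc K (bond e) := by
  set μ : Finset (V × V) → ℝ := fun G => gw K G * nc G with hμ
  have hμ0 : 0 ≤ μ := fun G => mul_nonneg (gw_nonneg hK G) (nc_pos G).le
  have hμq : ∀ G, gw K G * nc (insert e G) = μ G * qr e G := by
    intro G
    rw [hμ, qr]
    have := (nc_pos G).ne'
    field_simp
  have hZ : pc K 1 = ∑ G, μ G := by
    simp [pc, pf_eq_sum, hμ, nc]
  have hA : pc K (site a * site g) = ∑ G, μ G * ci a g G := by
    rw [pc, pf_eq_sum]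
    simp only [sum_comp_pair, hμ, mul_assoc]
  have hi : ∀ F : (V → ℤˣ) → ℝ, pf K (fun σ => F σ * sg (bond e σ)) =
      2 * (∑ G, gw K G * ∑ σ ∈ comp (insert e G), F σ) - pf K F := by
    intro F
    rw [pf_eq_sum, pf_eq_sum, Finset.mul_sum, ← Finset.sum_sub_distrib]
    refine Finset.sum_congr rfl fun G _ => ?_
    rw [comp_insert, Finset.sum_filter]
    simp only [ind_bond, mul_sub, Finset.sum_sub_distrib, Finset.mul_sum, mul_one]
    congr 1
    refine Finset.sum_congr rfl fun σ _ => ?_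
    split_ifs <;> ring
  have hE : pc K (bond e) = 2 * (∑ G, μ G * qr e G) - ∑ G, μ G := by
    have := hi fun _ => 1
    simp only [one_mul, Finset.sum_const, nsmul_eq_mul, mul_one] at this
    rw [pc, this, ← hZ]
    congr 1
    · congr 1
      exact Finset.sum_congr rfl fun G _ => hμq G
    · simp [pc]
  have hAE : pc K (site a * site g * bond e) =
      2 * (∑ G, μ G * qr e G * ci a g (insert e G)) - ∑ G, μ G * ci a g G := by
    have := hi fun σ => sg ((site a * site g) σ)
    rw [← hA, pc, pc]
    simp only [MonoidHom.mul_apply (site a * site g) (bond e), sg_mul (((site a * site g) _))]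
    rw [this]
    congr 2
    refine Finset.sum_congr rfl fun G _ => ?_
    rw [sum_comp_pair, ← hμq]; ring
  have hfkg : (∑ G, μ G * ci a g G) * ∑ G, μ G * qr e G ≤
      (∑ G, μ G) * ∑ G, μ G * (ci a g G * qr e G) :=
    fkg (hμ₀ := hμ0) (hf₀ := fun G => ci_nonneg a g G)
      (hg₀ := fun G => (div_pos (nc_pos _) (nc_pos _)).le)
      (hf := ci_mono a g) (hg := qr_mono e) (hμ := fun G H => by
        change gw K G * nc G * (gw K H * nc H) ≤ gw K (G ⊓ H) * nc (G ⊓ H) * (gw K (G ⊔ H) * nc (G ⊔ H))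
        rw [mul_mul_mul_comm, mul_mul_mul_comm _ _ (gw K (G ⊔ H)), gw_mul]
        exact mul_le_mul_of_nonneg_left (nc_mul_le G H)
          (mul_nonneg (gw_nonneg hK _) (gw_nonneg hK _)))
  have hpiv : ∑ G, μ G * (ci a g (insert e G) - ci a g G) ≤
      2 * (∑ G, μ G * qr e G * ci a g (insert e G)) - 2 * ∑ G, μ G * (ci a g G * qr e G) := by
    rw [Finset.mul_sum, Finset.mul_sum, ← Finset.sum_sub_distrib]
    refine Finset.sum_le_sum fun G _ => ?_
    have h1 := half_le_qr e G
    have h2 : ci a g G ≤ ci a g (insert e G) := ci_mono a g (Finset.subset_insert e G)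
    have h3 := hμ0 G
    simp only [Pi.zero_apply] at h3
    have h4 := mul_nonneg (mul_nonneg h3 (sub_nonneg.2 h1)) (sub_nonneg.2 h2)
    linarith
  have hZ0 := pf_one_pos K
  have h5 := mul_le_mul_of_nonneg_left hpiv hZ0.le
  rw [hAE, hA, hE]
  rw [hZ] at h5 ⊢
  linarith

open Classical in
/-- The complement of the cluster of `g`. -/
def off (g : V) (G : Finset (V × V)) : Finset V := Finset.univ.filter fun v => ¬Conn G v g

lemma mem_off {g v : V} {G : Finset (V × V)} : v ∈ off g G ↔ ¬Conn G v g := by simp [off]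

lemma off_eq_iff {g : V} {S : Finset V} (hg : g ∉ S) (G : Finset (V × V)) :
    off g G = S ↔ (∀ e ∈ G, e.1 ∈ S ↔ e.2 ∈ S) ∧
      ∀ v ∉ S, Conn (G ∩ Finset.univ.filter fun e : V × V => e.1 ∉ S ∧ e.2 ∉ S) v g := by
  constructor
  · rintro rfl
    have hb : ∀ e ∈ G, e.1 ∈ off g G ↔ e.2 ∈ off g G := by
      intro e he
      rw [mem_off, mem_off, not_iff_not]
      exact forall₂_congr fun σ hσ => by rw [bond_eq_one.1 (mem_comp.1 hσ e he)]
    refine ⟨hb, fun v hv σ hσ => ?_⟩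
    have h1 : (fun w => if w ∈ off g G then 1 else σ w) ∈ comp G := by
      refine mem_comp.2 fun e he => bond_eq_one.2 ?_
      by_cases h : e.1 ∈ off g G
      · rw [if_pos h, if_pos ((hb e he).1 h)]
      · have h' : e.2 ∉ off g G := fun h2 => h ((hb e he).2 h2)
        rw [if_neg h, if_neg h']
        exact bond_eq_one.1 (mem_comp.1 hσ e (by simp [he, h, h']))
    have h2 := (not_not.1 fun h => hv (mem_off.2 h)) _ h1
    simpa only [if_neg hv, if_neg hg] using h2
  · rintro ⟨hb, hc⟩
    ext v
    rw [mem_off]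
    constructor
    · intro h
      by_contra hv
      exact h ((hc v hv).mono Finset.inter_subset_left)
    · intro hv h
      have h1 : (fun w => if w ∈ S then (-1 : ℤˣ) else 1) ∈ comp G :=
        mem_comp.2 fun e he => bond_eq_one.2 (by simp only [hb e he])
      have h2 := h _ h1
      simp [hv, hg] at h2

open Classical in
/-- Conditionally on the cluster of `g`, the remaining spins form an Ising system. -/
lemma cluster_factor (K : V × V → ℝ) {g : V} {S : Finset V} (hg : g ∉ S) :
    ∃ D : ℝ, ∀ F : (S → ℤˣ) → ℝ,
      ∑ G with off g G = S, gw K G * ∑ σ ∈ comp G, F (fun v => σ v) = D * pf (res K S) F := by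
  set A := Finset.univ.filter fun e : V × V => e.1 ∉ S ∧ e.2 ∉ S with hA
  set p : Finset (V × V) → ℝ := fun H => if ∀ v ∉ S, Conn H v g then 1 else 0 with hp
  set u : (V → ℤˣ) → V × V → ℝ := fun σ e => if e.1 ∈ S ↔ e.2 ∈ S then
    2 * sinh (K e) * (if bond e σ = 1 then 1 else 0) else 0 with hu
  set B : (V → ℤˣ) → ℝ := fun σ => (∑ H ∈ A.powerset, p H * ((∏ e ∈ H, u σ e) *
    ∏ e ∈ A \ H, exp (-K e))) *
      ∏ e ∈ Aᶜ with ¬(e.1 ∈ S ∧ e.2 ∈ S), exp (-K e) with hB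
  have hR : ∀ σ, ∑ G with off g G = S, gw K G * (if σ ∈ comp G then 1 else 0) =
      wt (res K S) (fun v => σ v) * B σ := by
    intro σ
    have e1 : ∑ G with off g G = S, gw K G * (if σ ∈ comp G then 1 else 0) =
        ∑ G : Finset (V × V), p (G ∩ A) * ((∏ e ∈ G, u σ e) * ∏ e ∈ Gᶜ, exp (-K e)) := by
      rw [Finset.sum_filter]
      refine Finset.sum_congr rfl fun G _ => ?_
      by_cases hb : ∀ e ∈ G, e.1 ∈ S ↔ e.2 ∈ S
      · rw [← prod_mul_ind]
        have : ∏ e ∈ G, u σ e = ∏ e ∈ G, 2 * sinh (K e) * (if bond e σ = 1 then 1 else 0) :=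
          Finset.prod_congr rfl fun e he => if_pos (hb e he)
        rw [this]
        simp only [off_eq_iff hg, hp]
        rw [← hA]
        by_cases hc : ∀ v ∉ S, Conn (G ∩ A) v g
        · rw [if_pos ⟨hb, hc⟩, if_pos hc, one_mul]
        · rw [if_neg fun h => hc h.2, if_neg hc, zero_mul]
      · rw [if_neg fun h => hb ((off_eq_iff hg G).1 h).1]
        push Not at hb
        obtain ⟨e, he, hne⟩ := hb
        rw [Finset.prod_eq_zero he (if_neg (by tauto))]
        ring
    rw [e1, sum_inter_mul_prod, hB, mul_left_comm]
    congr 1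
    rw [← Finset.prod_filter_mul_prod_filter_not Aᶜ fun e => e.1 ∈ S ∧ e.2 ∈ S]
    congr 1
    · rw [wt, exp_sum]
      have := Finset.prod_bij (s := (Finset.univ : Finset (S × S)))
        (t := Finset.filter (fun e : V × V => e.1 ∈ S ∧ e.2 ∈ S) Aᶜ)
        (f := fun e => exp (res K S e * sg (bond e fun v : S => σ v)))
        (g := fun e => u σ e + exp (-K e)) (fun e _ => ((e.1 : V), (e.2 : V))) ?_ ?_ ?_ ?_
      · exact this.symm
      · intro e _; simp [hA]
      · rintro ⟨a, b⟩ _ ⟨c, d⟩ _ h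
        simp only [Prod.mk.injEq] at h
        rw [Subtype.ext h.1, Subtype.ext h.2]
      · rintro ⟨a, b⟩ h
        simp only [Finset.mem_filter] at h
        exact ⟨(⟨a, h.2.1⟩, ⟨b, h.2.2⟩), Finset.mem_univ _, rfl⟩
      · rintro ⟨a, b⟩ _
        simp only [hu, a.2, b.2, if_true]
        rw [exp_mul_sg_eq]
        rfl
    · refine Finset.prod_congr rfl fun e he => ?_
      simp only [hA, Finset.mem_filter, Finset.mem_compl, Finset.mem_univ, true_and] at he
      simp only [hu]
      rw [if_neg (by tauto), zero_add]
  have hBS : ∀ σ τ : V → ℤˣ, (∀ w, w ∉ Set.range (Subtype.val : S → V) → σ w = τ w) → B σ = B τ := by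
    intro σ τ h
    have h' : ∀ w, w ∉ S → σ w = τ w := fun w hw => h w (by simpa using hw)
    simp only [hB]
    congr 1
    refine Finset.sum_congr rfl fun H hH => ?_
    congr 2
    refine Finset.prod_congr rfl fun e he => ?_
    have := Finset.mem_powerset.1 hH he
    simp only [hA, Finset.mem_filter, Finset.mem_univ, true_and] at this
    simp only [hu, bond_apply, h' _ this.1, h' _ this.2]
    congr
  have hc : (Fintype.card (S → ℤˣ) : ℝ) ≠ 0 := by exact_mod_cast Fintype.card_ne_zero
  refine ⟨(∑ σ, B σ) / Fintype.card (S → ℤˣ), fun F => ?_⟩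
  have h1 := sum_mul_embedding (f := (Subtype.val : S → V)) Subtype.val_injective
    (fun τ => F τ * wt (res K S) τ) B hBS
  have h2 : ∑ G with off g G = S, gw K G * ∑ σ ∈ comp G, F (fun v => σ v) =
      ∑ σ : V → ℤˣ, F (fun v => σ v) * (wt (res K S) (fun v => σ v) * B σ) := by
    simp only [← hR, Finset.mul_sum]
    rw [Finset.sum_comm]
    refine Finset.sum_congr rfl fun G _ => ?_
    rw [← Finset.sum_filter_add_sum_filter_not Finset.univ (fun σ => σ ∈ comp G),
      Finset.filter_univ_mem, add_eq_left.2]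
    · refine Finset.sum_congr rfl fun σ hσ => ?_
      rw [if_pos hσ]; ring
    · refine Finset.sum_eq_zero fun σ hσ => ?_
      rw [if_neg (Finset.mem_filter.1 hσ).2]; ring
  rw [h2, div_mul_eq_mul_div, eq_div_iff hc, mul_comm (∑ σ, B σ), mul_comm _ (Fintype.card _ : ℝ)]
  refine Eq.trans ?_ h1
  congr 1
  exact Finset.sum_congr rfl fun σ _ => (mul_assoc _ _ _).symm

end Ising

namespace Ising

variable {V : Type*} [Fintype V] [DecidableEq V]

lemma pivotal_ge {k : V × V → ℝ} (hk : 0 ≤ k) {a g : V} (G : Finset (V × V)) :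
    ∑ s ∈ off g G, ∑ y ∈ (off g G)ᶜ, (k (s, y) + k (y, s)) * (if a ∈ off g G then ci a s G else 0) ≤
      ∑ e, k e * (ci a g (insert e G) - ci a g G) := by
  have hmono : ∀ e, 0 ≤ ci a g (insert e G) - ci a g G := fun e =>
    sub_nonneg.2 (ci_mono a g (Finset.subset_insert e G))
  have h1 : ∑ e ∈ Finset.univ.filter (fun e : V × V => ¬(e.1 ∈ off g G ↔ e.2 ∈ off g G)),
      k e * (ci a g (insert e G) - ci a g G) ≤ ∑ e, k e * (ci a g (insert e G) - ci a g G) :=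
    Finset.sum_le_sum_of_subset_of_nonneg (Finset.subset_univ _) fun e _ _ =>
      mul_nonneg (hk e) (hmono e)
  refine le_trans ?_ h1
  rw [sum_boundary, Finset.sum_coe_sort (off g G) (fun s => ∑ y ∈ (off g G)ᶜ,
    (k (s, y) * (ci a g (insert (s, y) G) - ci a g G) +
      k (y, s) * (ci a g (insert (y, s) G) - ci a g G)))]
  refine Finset.sum_le_sum fun s _ => Finset.sum_le_sum fun y hy => ?_
  by_cases ha : a ∈ off g G
  swap
  · rw [if_neg ha, mul_zero]
    exact add_nonneg (mul_nonneg (hk _) (hmono _)) (mul_nonneg (hk _) (hmono _))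
  rw [if_pos ha]
  by_cases hs : Conn G a s
  swap
  · rw [ci, if_neg hs, mul_zero]
    exact add_nonneg (mul_nonneg (hk _) (hmono _)) (mul_nonneg (hk _) (hmono _))
  have hy' : Conn G y g := by
    have := Finset.mem_compl.1 hy
    rwa [mem_off, not_not] at this
  have hc : ∀ e : V × V, e = (s, y) ∨ e = (y, s) → Conn (insert e G) a g := by
    intro e he σ hσ
    have hG := comp_anti (Finset.subset_insert e G) hσ
    have hb := bond_eq_one.1 (mem_comp.1 hσ e (Finset.mem_insert_self e G))
    have hsy : σ s = σ y := by
      rcases he with rfl | rfl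
      exacts [hb, hb.symm]
    exact (hs σ hG).trans (hsy.trans (hy' σ hG))
  have h0 : ci a g G = 0 := if_neg (mem_off.1 ha)
  rw [ci, if_pos hs, h0, ci, if_pos (hc _ (Or.inl rfl)), ci, if_pos (hc _ (Or.inr rfl))]
  linarith

/-- Differential inequality for the two-point function with a ghost, in covariance form. -/
lemma one_sub_corr_le {K k : V × V → ℝ} (hK : 0 ≤ K) (hk : 0 ≤ k) (a g : V) {I : ℝ}
    (hI : ∀ (S : Finset V) (ha : a ∈ S), g ∉ S →
      I ≤ ∑ s : S, ∑ y ∈ Sᶜ, (k (s, y) + k (y, s)) * corr (res K S) ⟨a, ha⟩ s) :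
    I * (1 - corr K a g) * pc K 1 ^ 2 ≤ ∑ e, k e *
      (pc K (site a * site g * bond e) * pc K 1 - pc K (site a * site g) * pc K (bond e)) := by
  classical
  have hZ := pf_one_pos K
  have h1 : pc K 1 * ∑ G, gw K G * nc G * ∑ e, k e * (ci a g (insert e G) - ci a g G) ≤
      ∑ e, k e *
      (pc K (site a * site g * bond e) * pc K 1 - pc K (site a * site g) * pc K (bond e)) := by
    have : pc K 1 * ∑ G, gw K G * nc G * ∑ e, k e * (ci a g (insert e G) - ci a g G) =
        ∑ e, k e * (pc K 1 * ∑ G, gw K G * nc G * (ci a g (insert e G) - ci a g G)) := by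
      simp only [Finset.mul_sum]
      rw [Finset.sum_comm]
      refine Finset.sum_congr rfl fun e _ => Finset.sum_congr rfl fun G _ => by ring
    rw [this]
    exact Finset.sum_le_sum fun e _ => mul_le_mul_of_nonneg_left (covariance_ge hK a g e) (hk e)
  refine le_trans ?_ h1
  have h2 : I * (1 - corr K a g) * pc K 1 ^ 2 =
      pc K 1 * (I * ∑ G, gw K G * nc G * (1 - ci a g G)) := by
    have e1 : ∑ G, gw K G * nc G * (1 - ci a g G) = pc K 1 - pc K (site a * site g) := by
      simp only [mul_sub, mul_one, Finset.sum_sub_distrib]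
      rw [pc, pf_eq_sum, pc, pf_eq_sum]
      congr 1
      · simp [nc]
      · simp only [sum_comp_pair, mul_assoc]
    rw [e1, corr_eq]
    field_simp
  rw [h2]
  refine mul_le_mul_of_nonneg_left ?_ hZ.le
  have h3 : ∀ G, gw K G * nc G * ∑ s ∈ off g G, ∑ y ∈ (off g G)ᶜ, (k (s, y) + k (y, s)) *
      (if a ∈ off g G then ci a s G else 0) ≤
      gw K G * nc G * ∑ e, k e * (ci a g (insert e G) - ci a g G) := fun G =>
    mul_le_mul_of_nonneg_left (pivotal_ge hk G) (mul_nonneg (gw_nonneg hK G) (nc_pos G).le)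
  refine le_trans ?_ (Finset.sum_le_sum fun G _ => h3 G)
  rw [← Finset.sum_fiberwise Finset.univ (off g) fun G => gw K G * nc G * (1 - ci a g G),
    ← Finset.sum_fiberwise Finset.univ (off g), Finset.mul_sum]
  refine Finset.sum_le_sum fun S _ => ?_
  by_cases haS : a ∈ S
  swap
  · refine le_of_eq (Eq.trans ?_ (Eq.symm ?_) (b := 0))
    · rw [Finset.sum_eq_zero, mul_zero]
      intro G hG
      have hG' := (Finset.mem_filter.1 hG).2
      rw [← hG', mem_off, not_not] at haS
      rw [ci, if_pos haS, sub_self, mul_zero]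
    · refine Finset.sum_eq_zero fun G hG => ?_
      have hG' := (Finset.mem_filter.1 hG).2
      rw [hG']
      simp [haS]
  by_cases hgS : g ∈ S
  · have hempty : Finset.univ.filter (fun G => off g G = S) = ∅ := by
      refine Finset.filter_eq_empty_iff.2 fun G _ hG => ?_
      rw [← hG, mem_off] at hgS
      exact hgS fun _ _ => rfl
    rw [hempty]; simp
  obtain ⟨D, hD⟩ := cluster_factor K hgS
  have hDZ : ∑ G with off g G = S, gw K G * nc G * (1 - ci a g G) = D * pc (res K S) 1 := by
    rw [pc, ← hD]
    refine Finset.sum_congr rfl fun G hG => ?_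
    have hG' := (Finset.mem_filter.1 hG).2
    rw [← hG', mem_off] at haS
    rw [ci, if_neg haS]
    simp [nc]
  have hD0 : 0 ≤ D * pc (res K S) 1 := by
    rw [← hDZ]
    refine Finset.sum_nonneg fun G _ => mul_nonneg (mul_nonneg (gw_nonneg hK G) (nc_pos G).le) ?_
    rw [ci]; split_ifs <;> norm_num
  have hsum : ∑ G with off g G = S, gw K G * nc G * ∑ s ∈ off g G, ∑ y ∈ (off g G)ᶜ,
      (k (s, y) + k (y, s)) * (if a ∈ off g G then ci a s G else 0) =
      ∑ s : S, ∑ y ∈ Sᶜ, (k (s, y) + k (y, s)) *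
        (D * pf (res K S) fun σ => sg (σ ⟨a, haS⟩) * sg (σ s)) := by
    rw [Finset.sum_congr rfl (g := fun G => gw K G * nc G *
      ∑ s ∈ S, ∑ y ∈ Sᶜ, (k (s, y) + k (y, s)) * ci a s G) fun G hG => by
        rw [(Finset.mem_filter.1 hG).2]; simp only [if_pos haS]]
    simp only [Finset.mul_sum]
    rw [Finset.sum_comm, ← Finset.sum_coe_sort S]
    refine Finset.sum_congr rfl fun s _ => ?_
    rw [Finset.sum_comm]
    refine Finset.sum_congr rfl fun y _ => ?_
    rw [← hD, Finset.mul_sum]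
    refine Finset.sum_congr rfl fun G _ => ?_
    have := sum_comp_pair a (s : V) G
    simp only [MonoidHom.mul_apply, site_apply, sg_mul] at this
    rw [this]; ring
  rw [hDZ, hsum]
  refine (mul_le_mul_of_nonneg_right (hI S haS hgS) hD0).trans_eq ?_
  rw [Finset.sum_mul]
  refine Finset.sum_congr rfl fun s _ => ?_
  rw [Finset.sum_mul]
  refine Finset.sum_congr rfl fun y _ => ?_
  have := (pf_one_pos (res K S)).ne'
  rw [corr, ex]
  field_simp

lemma hasDerivAt_pf (k : V × V → ℝ) (F : (V → ℤˣ) → ℝ) (t : ℝ) :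
    HasDerivAt (fun t : ℝ => pf (t • k) F) (∑ e, k e * pf (t • k) fun σ => F σ * sg (bond e σ)) t := by
  have h : ∀ t : ℝ, ∀ F, pf (t • k) F = ∑ σ, F σ * exp (t * ∑ e, k e * sg (bond e σ)) := by
    intro t F
    simp only [pf, wt, Pi.smul_apply, smul_eq_mul, Finset.mul_sum, mul_assoc]
  have h2 : HasDerivAt (fun t => ∑ σ, F σ * exp (t * ∑ e, k e * sg (bond e σ)))
      (∑ σ, F σ * (exp (t * ∑ e, k e * sg (bond e σ)) * ∑ e, k e * sg (bond e σ))) t := by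
    refine HasDerivAt.fun_sum fun σ _ => ?_
    have := ((((hasDerivAt_id t).mul_const (∑ e, k e * sg (bond e σ))).exp).const_mul (F σ))
    refine this.congr_deriv ?_
    simp only [id, one_mul]
  simp only [h]
  refine h2.congr_deriv ?_
  simp only [Finset.mul_sum]
  rw [Finset.sum_comm]
  refine Finset.sum_congr rfl fun e _ => Finset.sum_congr rfl fun σ _ => by ring

/-- If the boundary terms are bounded below at `b₀`, the ghost correlation is bounded below
beyond `b₀`, uniformly in the system. -/
lemma one_sub_corr_le_exp {k : V × V → ℝ} (hk : 0 ≤ k) (a g : V) {I b₀ b : ℝ} (hb₀ : 0 ≤ b₀)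
    (hb : b₀ ≤ b)
    (hI : ∀ (S : Finset V) (ha : a ∈ S), g ∉ S →
      I ≤ ∑ s : S, ∑ y ∈ Sᶜ, (k (s, y) + k (y, s)) * corr (res (b₀ • k) S) ⟨a, ha⟩ s) :
    1 - corr (b • k) a g ≤ exp (-(I * (b - b₀))) := by
  have hd : ∀ t, HasDerivAt (fun t : ℝ => corr (t • k) a g)
      ((∑ e, k e * (pc (t • k) (site a * site g * bond e) * pc (t • k) 1 -
        pc (t • k) (site a * site g) * pc (t • k) (bond e))) / pc (t • k) 1 ^ 2) t := by
    intro t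
    have h1 := (hasDerivAt_pf k (fun σ => sg ((site a * site g) σ)) t).div
      (hasDerivAt_pf k (fun σ => sg ((1 : Chr V) σ)) t) (pf_one_pos _).ne'
    have h2 : (fun t : ℝ => corr (t • k) a g) = (fun t => pf (t • k) fun σ => sg ((site a * site g) σ)) /
        (fun t => pf (t • k) fun σ => sg ((1 : Chr V) σ)) := by
      ext t; rw [corr_eq]; rfl
    rw [h2]
    refine h1.congr_deriv ?_
    change _ / pc (t • k) 1 ^ 2 = _
    congr 1
    rw [Finset.sum_mul, Finset.mul_sum, ← Finset.sum_sub_distrib]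
    refine Finset.sum_congr rfl fun e _ => ?_
    simp only [pc, MonoidHom.mul_apply, sg_mul, MonoidHom.one_apply, sg_one, one_mul]
    ring
  have hder : ∀ t, HasDerivAt (fun t : ℝ => (1 - corr (t • k) a g) * exp (I * t))
      ((I * (1 - corr (t • k) a g) - ((∑ e, k e * (pc (t • k) (site a * site g * bond e) * pc (t • k) 1 -
        pc (t • k) (site a * site g) * pc (t • k) (bond e))) / pc (t • k) 1 ^ 2)) * exp (I * t)) t := by
    intro t
    have := ((hd t).const_sub 1).mul (((hasDerivAt_id t).const_mul I).exp)
    refine this.congr_deriv ?_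
    simp only [id]
    ring
  have hanti : AntitoneOn (fun t : ℝ => (1 - corr (t • k) a g) * exp (I * t)) (Set.Ici b₀) := by
    refine antitoneOn_of_hasDerivWithinAt_nonpos (convex_Ici b₀)
      (fun t _ => (hder t).continuousAt.continuousWithinAt) (fun t _ => (hder t).hasDerivWithinAt)
      fun t ht => ?_
    rw [interior_Ici] at ht
    have ht' : b₀ < t := ht
    have hkt : 0 ≤ t • k := smul_nonneg (hb₀.trans ht'.le) hk
    refine mul_nonpos_of_nonpos_of_nonneg (sub_nonpos.2 ?_) (exp_pos _).le
    rw [le_div_iff₀ (pow_pos (pf_one_pos _) 2)]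
    refine one_sub_corr_le hkt hk a g fun S ha hg => (hI S ha hg).trans ?_
    refine Finset.sum_le_sum fun s _ => Finset.sum_le_sum fun y _ =>
      mul_le_mul_of_nonneg_left ?_ (add_nonneg (hk _) (hk _))
    exact corr_mono (fun e => mul_nonneg hb₀ (hk _))
      (fun e => mul_le_mul_of_nonneg_right ht'.le (hk _)) _ _
  have h := hanti Set.self_mem_Ici (Set.mem_Ici.2 hb) hb
  simp only at h
  have h0 : 1 - corr (b₀ • k) a g ≤ 1 := by
    have := corr_nonneg (smul_nonneg hb₀ hk) a g
    linarith
  have h1 : exp (-(I * (b - b₀))) = exp (I * b₀) / exp (I * b) := by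
    rw [← exp_sub]; ring_nf
  rw [h1, le_div_iff₀ (exp_pos _)]
  refine h.trans ?_
  nlinarith [exp_pos (I * b₀)]

end Ising

namespace Ising

lemma abs_spin (b : Bool) : |spin b| = 1 := by cases b <;> simp [spin]

lemma spin_not (b : Bool) : spin (!b) = -spin b := by cases b <;> simp [spin]

lemma continuous_spin : Continuous spin := continuous_of_discreteTopology

/-- A symmetric, diagonal-free, absolutely summable pair coupling. -/
structure Coupling (K : ℤ → ℤ → ℝ) : Prop where
  symm : ∀ i j, K i j = K j i
  diag : ∀ i, K i i = 0
  nonneg : ∀ i j, 0 ≤ K i j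
  summable : ∀ i, Summable (K i)

/-- The interaction term of a pair. -/
def pairTerm (K : ℤ → ℤ → ℝ) (ω : Config) (i j : ℤ) : ℝ := K i j * spin (ω i) * spin (ω j)

section
variable {K : ℤ → ℤ → ℝ} (hK : Coupling K)
include hK

lemma Coupling.norm_pairTerm (ω : Config) (i j : ℤ) : ‖pairTerm K ω i j‖ = K i j := by
  rw [pairTerm, norm_mul, norm_mul, Real.norm_eq_abs, Real.norm_eq_abs, Real.norm_eq_abs,
    abs_spin, abs_spin, abs_of_nonneg (hK.nonneg i j), mul_one, mul_one]

lemma Coupling.summable_pairTerm (ω : Config) (i : ℤ) : Summable (pairTerm K ω i) :=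
  Summable.of_norm_bounded (hK.summable i) fun j => (hK.norm_pairTerm ω i j).le

lemma Coupling.pairTerm_symm (ω : Config) (i j : ℤ) : pairTerm K ω i j = pairTerm K ω j i := by
  rw [pairTerm, pairTerm, hK.symm]; ring

lemma Coupling.pairTerm_diag (ω : Config) (i : ℤ) : pairTerm K ω i i = 0 := by
  rw [pairTerm, hK.diag]; ring

lemma Coupling.hasSum_fst (Λ : Finset ℤ) (ω : Config) :
    HasSum (fun p : ℤ × ℤ => if p.1 ∈ Λ then pairTerm K ω p.1 p.2 else 0)
      (∑ i ∈ Λ, ∑' j, pairTerm K ω i j) := by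
  have h : ∀ i ∈ Λ, HasSum (fun p : ℤ × ℤ => if p.1 = i then pairTerm K ω p.1 p.2 else 0)
      (∑' j, pairTerm K ω i j) := by
    intro i _
    have hinj : Function.Injective fun j : ℤ => (i, j) := fun a b h => (Prod.ext_iff.1 h).2
    rw [← hinj.hasSum_iff]
    · simpa [Function.comp_def] using (hK.summable_pairTerm ω i).hasSum
    · rintro ⟨a, b⟩ hp
      refine if_neg ?_
      rintro rfl
      exact hp ⟨b, rfl⟩
  convert hasSum_sum h using 1
  funext p
  simp

lemma Coupling.hasSum_touching (Λ : Finset ℤ) (ω : Config) :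
    HasSum (fun p : ℤ × ℤ => if p.1 ∈ Λ ∨ p.2 ∈ Λ then pairTerm K ω p.1 p.2 else 0)
      (2 * ∑ i ∈ Λ, ∑' j, pairTerm K ω i j - ∑ i ∈ Λ, ∑ j ∈ Λ, pairTerm K ω i j) := by
  have h1 := hK.hasSum_fst Λ ω
  have h2 : HasSum (fun p : ℤ × ℤ => if p.2 ∈ Λ then pairTerm K ω p.1 p.2 else 0)
      (∑ i ∈ Λ, ∑' j, pairTerm K ω i j) := by
    rw [← (Equiv.prodComm ℤ ℤ).hasSum_iff]
    convert h1 using 2 with p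
    simp [hK.pairTerm_symm ω p.2 p.1]
  have h3 : HasSum (fun p : ℤ × ℤ => if p.1 ∈ Λ ∧ p.2 ∈ Λ then pairTerm K ω p.1 p.2 else 0)
      (∑ i ∈ Λ, ∑ j ∈ Λ, pairTerm K ω i j) := by
    rw [← Finset.sum_product' Λ Λ]
    have h := hasSum_sum_of_ne_finset_zero (s := Λ ×ˢ Λ)
      (f := fun p : ℤ × ℤ => if p.1 ∈ Λ ∧ p.2 ∈ Λ then pairTerm K ω p.1 p.2 else 0)
      (fun p hp => if_neg fun h => hp (Finset.mem_product.2 h)) (L := SummationFilter.unconditional _)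
    convert h using 1
    refine Finset.sum_congr rfl fun p hp => (if_pos (Finset.mem_product.1 hp)).symm
  convert (h1.add h2).sub h3 using 1
  · rfl
  · funext p
    by_cases h1 : p.1 ∈ Λ <;> by_cases h2 : p.2 ∈ Λ <;> simp [h1, h2]
  · ring

lemma Coupling.summable_hamiltonian (Λ : Finset ℤ) (ω : Config) :
    Summable fun p : ℤ × ℤ =>
      if p.1 < p.2 ∧ (p.1 ∈ Λ ∨ p.2 ∈ Λ) then K p.1 p.2 * spin (ω p.1) * spin (ω p.2) else 0 := by
  refine Summable.of_norm_bounded (hK.hasSum_touching Λ ω).summable.norm fun p => ?_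
  by_cases h1 : p.1 < p.2 <;> by_cases h2 : p.1 ∈ Λ ∨ p.2 ∈ Λ <;> simp only [h1, h2, pairTerm, true_and,
    false_and, if_true, if_false, norm_zero, le_refl, norm_nonneg]

lemma Coupling.neg_hamiltonian_eq (β : ℝ) (Λ : Finset ℤ) (ω : Config) :
    -hamiltonian K β Λ ω = β * (∑ i ∈ Λ, ∑' j, pairTerm K ω i j -
      (∑ i ∈ Λ, ∑ j ∈ Λ, pairTerm K ω i j) / 2) := by
  have hs := hK.summable_hamiltonian Λ ω
  have hs' := hs
  rw [← (Equiv.prodComm ℤ ℤ).summable_iff] at hs'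
  have h := (hs.hasSum.add hs'.hasSum).unique (by
    convert hK.hasSum_touching Λ ω using 1
    ext p
    have := hK.pairTerm_symm ω p.1 p.2
    rcases lt_trichotomy p.1 p.2 with h | h | h
    · by_cases h2 : p.1 ∈ Λ ∨ p.2 ∈ Λ <;> simp [h, h.le, h2, pairTerm]
    · simp [h, hK.pairTerm_diag]
    · rw [this]
      by_cases h2 : p.1 ∈ Λ ∨ p.2 ∈ Λ
      · simp [h, h.le, h2, h2.symm, pairTerm]
      · have h3 : ¬ (p.2 ∈ Λ ∨ p.1 ∈ Λ) := fun h => h2 h.symm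
        simp [h2, h3])
  have e := (Equiv.prodComm ℤ ℤ).tsum_eq fun p : ℤ × ℤ =>
      if p.1 < p.2 ∧ (p.1 ∈ Λ ∨ p.2 ∈ Λ) then K p.1 p.2 * spin (ω p.1) * spin (ω p.2) else 0
  have e2 : ∑' p : ℤ × ℤ, ((fun p : ℤ × ℤ =>
      if p.1 < p.2 ∧ (p.1 ∈ Λ ∨ p.2 ∈ Λ) then K p.1 p.2 * spin (ω p.1) * spin (ω p.2) else 0) ∘
        (Equiv.prodComm ℤ ℤ)) p = ∑' p : ℤ × ℤ,
      if p.1 < p.2 ∧ (p.1 ∈ Λ ∨ p.2 ∈ Λ) then K p.1 p.2 * spin (ω p.1) * spin (ω p.2) else 0 := e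
  rw [e2] at h
  rw [hamiltonian, neg_mul, neg_neg]
  congr 1
  linarith

lemma Coupling.continuous_hamiltonian (β : ℝ) (Λ : Finset ℤ) : Continuous (hamiltonian K β Λ) := by
  have h : hamiltonian K β Λ = fun ω => -(β * (∑ i ∈ Λ, ∑' j, pairTerm K ω i j -
      (∑ i ∈ Λ, ∑ j ∈ Λ, pairTerm K ω i j) / 2)) := by
    ext ω; rw [← hK.neg_hamiltonian_eq, neg_neg]
  have hc : ∀ i j, Continuous fun ω => pairTerm K ω i j := fun i j =>
    (continuous_const.mul (continuous_spin.comp (continuous_apply i))).mul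
      (continuous_spin.comp (continuous_apply j))
  have ht : ∀ i, Continuous fun ω => ∑' j, pairTerm K ω i j := fun i =>
    continuous_tsum (hc i) (hK.summable i) fun j ω => (hK.norm_pairTerm ω i j).le
  rw [h]
  fun_prop

lemma Coupling.hamiltonian_sub (β : ℝ) {Δ Λ : Finset ℤ} (hΔ : Δ ⊆ Λ) {ω ω' : Config}
    (h : ∀ j ∉ Δ, ω j = ω' j) : hamiltonian K β Λ ω - hamiltonian K β Λ ω' =
      hamiltonian K β Δ ω - hamiltonian K β Δ ω' := by
  simp only [hamiltonian, ← mul_sub]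
  congr 1
  rw [← (hK.summable_hamiltonian Λ ω).tsum_sub (hK.summable_hamiltonian Λ ω'),
    ← (hK.summable_hamiltonian Δ ω).tsum_sub (hK.summable_hamiltonian Δ ω')]
  refine tsum_congr fun p => ?_
  by_cases h2 : p.1 ∈ Δ ∨ p.2 ∈ Δ
  · have h3 : p.1 ∈ Λ ∨ p.2 ∈ Λ := h2.imp (@hΔ _) (@hΔ _)
    simp [h2, h3]
  · have h4 := not_or.1 h2
    simp [h2, h _ h4.1, h _ h4.2]

lemma Coupling.neg_hamiltonian_const (β : ℝ) (Λ : Finset ℤ) (a : Λ → Bool) (b : Bool) :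
    -hamiltonian K β Λ (concat Λ a fun _ => b) =
      β * ((∑ i : Λ, ∑ j : Λ, K i j * spin (a i) * spin (a j)) / 2 +
        ∑ i : Λ, spin (a i) * spin b * ∑' j, if j ∈ Λ then 0 else K i j) := by
  set ω := concat Λ a fun _ => b with hω
  have hin : ∀ i : Λ, ω i = a i := fun i => by simp [hω, concat]
  have hout : ∀ j ∉ Λ, ω j = b := fun j hj => by simp [hω, concat, hj]
  have hdb : ∑ i ∈ Λ, ∑ j ∈ Λ, pairTerm K ω i j =
      ∑ i : Λ, ∑ j : Λ, K i j * spin (a i) * spin (a j) := by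
    rw [← Finset.sum_coe_sort Λ]
    refine Finset.sum_congr rfl fun i _ => ?_
    rw [← Finset.sum_coe_sort Λ]
    refine Finset.sum_congr rfl fun j _ => ?_
    rw [pairTerm, hin, hin]
  have hrow : ∑ i ∈ Λ, ∑' j, pairTerm K ω i j = ∑ i ∈ Λ, ∑ j ∈ Λ, pairTerm K ω i j +
      ∑ i : Λ, spin (a i) * spin b * ∑' j, if j ∈ Λ then 0 else K i j := by
    rw [← Finset.sum_coe_sort Λ, ← Finset.sum_coe_sort Λ, ← Finset.sum_add_distrib]
    refine Finset.sum_congr rfl fun i _ => ?_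
    have h1 : HasSum (fun j => if j ∈ Λ then pairTerm K ω i j else 0)
        (∑ j ∈ Λ, pairTerm K ω i j) := by
      have h := hasSum_sum_of_ne_finset_zero (s := Λ)
        (f := fun j => if j ∈ Λ then pairTerm K ω i j else 0)
        (fun p hp => if_neg hp) (L := SummationFilter.unconditional _)
      convert h using 1
      exact Finset.sum_congr rfl fun j hj => (if_pos hj).symm
    have h2s : Summable fun j => if j ∈ Λ then 0 else K i j :=
      Summable.of_norm_bounded (hK.summable i) fun j => by
        split_ifs
        · simpa using hK.nonneg i j
        · exact (Real.norm_of_nonneg (hK.nonneg i j)).le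
    refine HasSum.tsum_eq ?_
    convert h1.add (h2s.hasSum.mul_left (spin (a i) * spin b)) using 1
    ext j
    by_cases hj : j ∈ Λ
    · simp [hj]
    · simp only [hj, if_false, zero_add, pairTerm, hin, hout j hj]
      ring
  rw [hK.neg_hamiltonian_eq, hrow, hdb]
  ring

end

lemma hamiltonian_not (K : ℤ → ℤ → ℝ) (β : ℝ) (Λ : Finset ℤ) (ω : Config) :
    hamiltonian K β Λ (fun j => !ω j) = hamiltonian K β Λ ω := by
  simp [hamiltonian, spin_not]

end Ising

namespace Ising

/-- Overwrite a configuration on `Λ` by one on `Δ`. -/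
def overwrite {Λ Δ : Finset ℤ} (b : Λ → Bool) (c : Δ → Bool) : Λ → Bool :=
  fun i => if h : i.1 ∈ Δ then c ⟨i, h⟩ else b i

/-- Restrict a configuration from `Λ` to `Δ`. -/
def restr {Λ Δ : Finset ℤ} (h : Δ ⊆ Λ) (b : Λ → Bool) : Δ → Bool := fun i => b ⟨i, h i.2⟩

lemma restr_overwrite {Λ Δ : Finset ℤ} (h : Δ ⊆ Λ) (b : Λ → Bool) (c : Δ → Bool) :
    restr h (overwrite b c) = c := by
  ext i; simp [restr, overwrite]

lemma overwrite_overwrite {Λ Δ : Finset ℤ} (b : Λ → Bool) (c d : Δ → Bool) :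
    overwrite (overwrite b c) d = overwrite b d := by
  ext i; by_cases hi : i.1 ∈ Δ <;> simp [overwrite, hi]

lemma overwrite_restr {Λ Δ : Finset ℤ} (h : Δ ⊆ Λ) (b : Λ → Bool) :
    overwrite b (restr h b) = b := by
  ext i; by_cases hi : i.1 ∈ Δ <;> simp [overwrite, restr, hi]

lemma concat_concat {Λ Δ : Finset ℤ} (h : Δ ⊆ Λ) (b : Λ → Bool) (c : Δ → Bool) (η : Config) :
    concat Δ c (concat Λ b η) = concat Λ (overwrite b c) η := by
  ext j
  by_cases hj : j ∈ Δ
  · simp [concat, overwrite, hj, h hj]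
  · by_cases hj2 : j ∈ Λ <;> simp [concat, overwrite, hj, hj2]

lemma concat_mem_cylinderEvent {Λ Δ : Finset ℤ} (h : Δ ⊆ Λ) (b : Λ → Bool) (a : Δ → Bool)
    (η : Config) : concat Λ b η ∈ cylinderEvent Δ a ↔ restr h b = a := by
  rw [cylinderEvent, Set.mem_ofPred_eq, funext_iff]
  refine forall_congr' fun i => ?_
  simp [concat, restr, h i.2]

lemma continuous_concat (Λ : Finset ℤ) (a : Λ → Bool) : Continuous (concat Λ a) := by
  refine continuous_pi fun j => ?_
  by_cases hj : j ∈ Λ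
  · simp only [concat, hj, dite_true]; exact continuous_const
  · simp only [concat, hj, dite_false]; exact continuous_apply j

lemma isClopen_cylinderEvent (Λ : Finset ℤ) (a : Λ → Bool) : IsClopen (cylinderEvent Λ a) := by
  have : cylinderEvent Λ a = ⋂ i : Λ, {ω | ω i.1 = a i} := by
    ext ω; simp [cylinderEvent]
  rw [this]
  exact isClopen_iInter_of_finite fun i =>
    (isClopen_discrete {a i}).preimage (continuous_apply (i : ℤ))

lemma gibbsKernel_pos (K : ℤ → ℤ → ℝ) (β : ℝ) (Λ : Finset ℤ) (a : Λ → Bool) (ω : Config) :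
    0 < gibbsKernel K β Λ a ω :=
  div_pos (exp_pos _) (Finset.sum_pos (fun _ _ => exp_pos _) Finset.univ_nonempty)

lemma sum_gibbsKernel (K : ℤ → ℤ → ℝ) (β : ℝ) (Λ : Finset ℤ) (ω : Config) :
    ∑ a, gibbsKernel K β Λ a ω = 1 := by
  simp only [gibbsKernel]
  rw [← Finset.sum_div, div_self]
  exact (Finset.sum_pos (fun _ _ => exp_pos _) Finset.univ_nonempty).ne'

lemma Coupling.continuous_gibbsKernel {K : ℤ → ℤ → ℝ} (hK : Coupling K) (β : ℝ) (Λ : Finset ℤ)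
    (a : Λ → Bool) : Continuous (gibbsKernel K β Λ a) := by
  have h : ∀ b : Λ → Bool, Continuous fun ω => exp (-(hamiltonian K β Λ (concat Λ b ω))) :=
    fun b => continuous_exp.comp
      ((hK.continuous_hamiltonian β Λ).comp (continuous_concat Λ b)).neg
  refine (h a).div (continuous_finsetSum _ fun b _ => h b) fun ω => ?_
  exact (Finset.sum_pos (fun _ _ => exp_pos _) Finset.univ_nonempty).ne'

/-- The finite-volume expectation with boundary condition `η`. -/
def boxMean (K : ℤ → ℤ → ℝ) (β : ℝ) (Λ : Finset ℤ) (η : Config) (f : Config → ℝ) : ℝ :=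
  ∑ a, gibbsKernel K β Λ a η * f (concat Λ a η)

/-- The finite-volume Gibbs measure with boundary condition `η`. -/
def boxMeasure (K : ℤ → ℤ → ℝ) (β : ℝ) (Λ : Finset ℤ) (η : Config) : Measure Config :=
  ∑ a, ENNReal.ofReal (gibbsKernel K β Λ a η) • Measure.dirac (concat Λ a η)

lemma isProbabilityMeasure_boxMeasure (K : ℤ → ℤ → ℝ) (β : ℝ) (Λ : Finset ℤ) (η : Config) :
    IsProbabilityMeasure (boxMeasure K β Λ η) := by
  refine ⟨?_⟩
  rw [boxMeasure, Measure.finsetSum_apply]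
  simp only [Measure.smul_apply, measure_univ, smul_eq_mul, mul_one]
  rw [← ENNReal.ofReal_sum_of_nonneg fun a _ => (gibbsKernel_pos K β Λ a η).le, sum_gibbsKernel,
    ENNReal.ofReal_one]

lemma integral_boxMeasure (K : ℤ → ℤ → ℝ) (β : ℝ) (Λ : Finset ℤ) (η : Config) {f : Config → ℝ}
    (hf : Continuous f) : ∫ ω, f ω ∂boxMeasure K β Λ η = boxMean K β Λ η f := by
  have hi : ∀ ω : Config, Integrable f (Measure.dirac ω) := fun ω =>
    hf.integrable_of_hasCompactSupport (HasCompactSupport.of_compactSpace f)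
  rw [boxMeasure, integral_finsetSum_measure
    fun a _ => (hi _).smul_measure ENNReal.ofReal_ne_top]
  refine Finset.sum_congr rfl fun a _ => ?_
  rw [integral_smul_measure, integral_dirac, ENNReal.toReal_ofReal (gibbsKernel_pos K β Λ a η).le,
    smul_eq_mul]

lemma Coupling.boxMean_cylinder {K : ℤ → ℤ → ℝ} (hK : Coupling K) (β : ℝ) {Δ Λ : Finset ℤ}
    (hΔ : Δ ⊆ Λ) (η : Config) (a : Δ → Bool) {F : Config → ℝ}
    (hF : ∀ c ω, F (concat Δ c ω) = F ω) :
    boxMean K β Λ η ((cylinderEvent Δ a).indicator F) =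
      boxMean K β Λ η fun ω => gibbsKernel K β Δ a ω * F ω := by
  classical
  set w : (Λ → Bool) → ℝ := fun b => exp (-(hamiltonian K β Λ (concat Λ b η))) with hw
  have hw0 : ∀ b, 0 < w b := fun b => exp_pos _
  set Z := ∑ b, w b with hZ
  set S : (Λ → Bool) → ℝ := fun b => ∑ c : Δ → Bool, w (overwrite b c) with hS
  have hS0 : ∀ b, 0 < S b := fun b =>
    Finset.sum_pos (fun _ _ => hw0 _) Finset.univ_nonempty
  have hker : ∀ b, gibbsKernel K β Λ b η = w b / Z := fun b => rfl
  have hker2 : ∀ b, gibbsKernel K β Δ a (concat Λ b η) = w (overwrite b a) / S b := by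
    intro b
    have hr : ∀ c : Δ → Bool, exp (-(hamiltonian K β Δ (concat Δ c (concat Λ b η)))) =
        exp (hamiltonian K β Λ (concat Λ b η) - hamiltonian K β Δ (concat Λ b η)) *
          w (overwrite b c) := by
      intro c
      have h := hK.hamiltonian_sub β hΔ (ω := concat Δ c (concat Λ b η)) (ω' := concat Λ b η)
        fun j hj => by simp [concat, hj]
      rw [concat_concat hΔ] at h ⊢
      rw [hw, ← exp_add]
      congr 1
      linarith
    rw [gibbsKernel, Finset.sum_congr rfl fun c _ => hr c, hr a, ← Finset.mul_sum]
    rw [mul_div_mul_left _ _ (exp_pos _).ne']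
  set f : (Λ → Bool) → ℝ := fun b => F (concat Λ b η) with hf
  have hfo : ∀ b (c : Δ → Bool), f (overwrite b c) = f b := by
    intro b c
    rw [hf]
    change F _ = F _
    rw [← concat_concat hΔ, hF]
  have hSo : ∀ b (c : Δ → Bool), S (overwrite b c) = S b := by
    intro b c
    simp only [hS, overwrite_overwrite]
  have hinv : ∑ p : (Λ → Bool) × (Δ → Bool), (if restr hΔ p.1 = a then
        w p.1 * w (overwrite p.1 p.2) / S p.1 * f p.1 else 0) =
      ∑ p : (Λ → Bool) × (Δ → Bool), (if p.2 = a then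
        w p.1 * w (overwrite p.1 p.2) / S p.1 * f p.1 else 0) := by
    refine Finset.sum_bij' (fun p _ => (overwrite p.1 p.2, restr hΔ p.1))
      (fun p _ => (overwrite p.1 p.2, restr hΔ p.1)) (by simp) (by simp) ?_ ?_ ?_
    · rintro ⟨b, c⟩ _
      simp [overwrite_overwrite, overwrite_restr, restr_overwrite]
    · rintro ⟨b, c⟩ _
      simp [overwrite_overwrite, overwrite_restr, restr_overwrite]
    · rintro ⟨b, c⟩ _
      simp only [overwrite_overwrite, overwrite_restr, hSo, hfo, mul_comm (w b)]
  rw [Fintype.sum_prod_type, Fintype.sum_prod_type] at hinv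
  have hl : boxMean K β Λ η ((cylinderEvent Δ a).indicator F) =
      (∑ b : Λ → Bool, ∑ c : Δ → Bool, if restr hΔ b = a then
        w b * w (overwrite b c) / S b * f b else 0) / Z := by
    rw [boxMean, Finset.sum_div]
    refine Finset.sum_congr rfl fun b _ => ?_
    rw [hker, Set.indicator_apply]
    simp only [concat_mem_cylinderEvent hΔ]
    by_cases h : restr hΔ b = a
    · simp only [h, if_true]
      rw [← Finset.sum_mul, ← Finset.sum_div, ← Finset.mul_sum]
      change _ = w b * S b / S b * F _ / Z
      rw [mul_div_cancel_right₀ _ (hS0 b).ne']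
      ring
    · simp [h]
  have hr : boxMean K β Λ η (fun ω => gibbsKernel K β Δ a ω * F ω) =
      (∑ b : Λ → Bool, ∑ c : Δ → Bool, if c = a then
        w b * w (overwrite b c) / S b * f b else 0) / Z := by
    rw [boxMean, Finset.sum_div]
    refine Finset.sum_congr rfl fun b _ => ?_
    rw [hker, hker2, Finset.sum_ite_eq' Finset.univ a, if_pos (Finset.mem_univ _)]
    change _ = _ * F _ / Z
    ring
  rw [hl, hr, hinv]

end Ising

namespace Ising

/-- The symmetric boxes exhausting `ℤ`. -/
def box (N : ℕ) : Finset ℤ := Finset.Icc (-(N : ℤ)) N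

lemma eventually_subset_box (Δ : Finset ℤ) : ∀ᶠ N in Filter.atTop, Δ ⊆ box N := by
  filter_upwards [Filter.eventually_ge_atTop (∑ i ∈ Δ, i.natAbs)] with N hN i hi
  have := (Finset.single_le_sum (f := fun i : ℤ => i.natAbs) (fun _ _ => Nat.zero_le _) hi).trans hN
  simp only [box, Finset.mem_Icc]
  omega

lemma Coupling.isGibbs_of_integral {K : ℤ → ℤ → ℝ} (hK : Coupling K) (β : ℝ) (μ : Measure Config)
    [IsProbabilityMeasure μ]
    (h : ∀ (Δ : Finset ℤ) (a : Δ → Bool) (F : Config → ℝ), Continuous F →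
      (∀ c ω, F (concat Δ c ω) = F ω) → ∫ ω, (cylinderEvent Δ a).indicator F ω ∂μ =
        ∫ ω, gibbsKernel K β Δ a ω * F ω ∂μ) : IsGibbs K β μ := by
  refine ⟨inferInstance, fun Δ a B hB => ?_⟩
  obtain ⟨B', hB', rfl⟩ := hB
  set r : Config → ({j : ℤ // j ∉ Δ} → Bool) := fun ω j => ω j.1 with hr
  have hrc : Continuous r := continuous_pi fun j => continuous_apply (j : ℤ)
  have hrm : Measurable r := hrc.measurable
  have hcyl : MeasurableSet (cylinderEvent Δ a) := (isClopen_cylinderEvent Δ a).isOpen.measurableSet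
  have hgc := hK.continuous_gibbsKernel β Δ a
  have hgi : Integrable (gibbsKernel K β Δ a) μ :=
    hgc.integrable_of_hasCompactSupport (HasCompactSupport.of_compactSpace _)
  have hfin : IsFiniteMeasure (μ.withDensity fun ω => ENNReal.ofReal (gibbsKernel K β Δ a ω)) :=
    isFiniteMeasure_withDensity_ofReal hgi.2
  have key : (μ.restrict (cylinderEvent Δ a)).map r =
      (μ.withDensity fun ω => ENNReal.ofReal (gibbsKernel K β Δ a ω)).map r := by
    refine ext_of_forall_integral_eq_of_IsFiniteMeasure fun f => ?_
    rw [integral_map hrm.aemeasurable f.continuous.aestronglyMeasurable,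
      integral_map hrm.aemeasurable f.continuous.aestronglyMeasurable,
      integral_withDensity_eq_integral_toReal_smul (by fun_prop)
        (Filter.Eventually.of_forall fun _ => ENNReal.ofReal_lt_top),
      ← integral_indicator hcyl]
    have := h Δ a (fun ω => f (r ω)) (f.continuous.comp hrc) fun c ω => by
      congr 1
      ext j
      simp [hr, concat, j.2]
    rw [this]
    refine integral_congr_ae (Filter.Eventually.of_forall fun ω => ?_)
    simp only [smul_eq_mul]
    rw [ENNReal.toReal_ofReal (gibbsKernel_pos K β Δ a ω).le]
  have hk := congrArg (fun m => (m B').toReal) key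
  rw [Measure.map_apply hrm hB', Measure.map_apply hrm hB', Measure.restrict_apply (hrm hB'),
    Set.inter_comm, withDensity_apply _ (hrm hB')] at hk
  rw [hk, integral_eq_lintegral_of_nonneg_ae
    (Filter.Eventually.of_forall fun ω => (gibbsKernel_pos K β Δ a ω).le)
    hgc.aestronglyMeasurable]

lemma Coupling.exists_isGibbs {K : ℤ → ℤ → ℝ} (hK : Coupling K) (β : ℝ) (η : Config)
    {g : Config → ℝ} (hg : Continuous g) {c : ℝ} (hc : ∀ N, c ≤ boxMean K β (box N) η g) :
    ∃ μ, IsGibbs K β μ ∧ c ≤ ∫ ω, g ω ∂μ := by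
  set m : ℕ → ProbabilityMeasure Config := fun N =>
    ⟨boxMeasure K β (box N) η, isProbabilityMeasure_boxMeasure K β (box N) η⟩ with hm
  set U : Ultrafilter ℕ := Filter.hyperfilter ℕ
  have hU : (U : Filter ℕ) ≤ Filter.atTop := Nat.hyperfilter_le_atTop
  obtain ⟨μ, -, hμ⟩ := isCompact_univ.ultrafilter_le_nhds (U.map m) (by simp)
  have hlim : ∀ f : Config → ℝ, Continuous f →
      Filter.Tendsto (fun N => boxMean K β (box N) η f) U (nhds (∫ ω, f ω ∂(μ : Measure Config))) := by
    intro f hf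
    have := ProbabilityMeasure.tendsto_iff_forall_integral_tendsto.1
      (show Filter.Tendsto m U (nhds μ) from hμ) (BoundedContinuousFunction.mkOfCompact ⟨f, hf⟩)
    refine this.congr fun N => ?_
    exact integral_boxMeasure K β (box N) η hf
  refine ⟨μ, hK.isGibbs_of_integral β μ fun Δ a F hF hFc => ?_, ?_⟩
  · refine tendsto_nhds_unique_of_eventuallyEq
      (hlim _ ((isClopen_cylinderEvent Δ a).continuous_indicator hF))
      (hlim _ ((hK.continuous_gibbsKernel β Δ a).mul hF)) ?_
    exact hU ((eventually_subset_box Δ).mono fun N hN => hK.boxMean_cylinder β hN η a hFc)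
  · exact ge_of_tendsto (hlim g hg) (Filter.Eventually.of_forall hc)

end Ising

namespace Ising

/-- The sign attached to a Boolean spin. -/
def toSign (b : Bool) : ℤˣ := if b then 1 else -1

lemma sg_toSign (b : Bool) : sg (toSign b) = spin b := by cases b <;> simp [toSign, spin]

lemma toSign_bijective : Function.Bijective toSign := by
  constructor
  · intro a b h
    cases a <;> cases b <;> simp_all [toSign]
  · intro x
    rcases Int.units_eq_one_or x with rfl | rfl
    exacts [⟨true, rfl⟩, ⟨false, rfl⟩]

/-- The total coupling between the site `i` and the complement of `Λ`. -/
def outer (K : ℤ → ℤ → ℝ) (Λ : Finset ℤ) (i : ℤ) : ℝ := ∑' j, if j ∈ Λ then 0 else K i j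

/-- The pair coupling on `Λ` together with a ghost site representing the complement of `Λ`. -/
def ghost (K : ℤ → ℤ → ℝ) (Λ : Finset ℤ) : Option Λ × Option Λ → ℝ
  | (some x, some y) => K x y / 2
  | (some x, none) => outer K Λ x
  | (none, _) => 0

lemma Coupling.outer_nonneg {K : ℤ → ℤ → ℝ} (hK : Coupling K) (Λ : Finset ℤ) (i : ℤ) :
    0 ≤ outer K Λ i :=
  tsum_nonneg fun j => by split_ifs; exacts [le_rfl, hK.nonneg i j]

lemma Coupling.ghost_nonneg {K : ℤ → ℤ → ℝ} (hK : Coupling K) (Λ : Finset ℤ) : 0 ≤ ghost K Λ := by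
  rintro ⟨_ | x, _ | y⟩
  · exact le_rfl
  · exact le_rfl
  · exact hK.outer_nonneg Λ x
  · exact div_nonneg (hK.nonneg _ _) two_pos.le

lemma Coupling.wt_ghost {K : ℤ → ℤ → ℝ} (hK : Coupling K) (β : ℝ) (Λ : Finset ℤ) (b : Bool)
    (a : Λ → Bool) : wt (β • ghost K Λ) (fun o => toSign (o.elim b a)) =
      exp (-hamiltonian K β Λ (concat Λ a fun _ => b)) := by
  rw [hK.neg_hamiltonian_const, wt, Fintype.sum_prod_type, Fintype.sum_option]
  congr 1
  simp only [Fintype.sum_option, Pi.smul_apply, smul_eq_mul, ghost, mul_zero, zero_mul,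
    Finset.sum_const_zero, zero_add, bond_apply, sg_mul, sg_toSign, Option.elim]
  rw [Finset.sum_add_distrib, mul_add, Finset.mul_sum, add_comm, Finset.sum_div, Finset.mul_sum]
  congr 1
  · refine Finset.sum_congr rfl fun x _ => ?_
    rw [Finset.sum_div, Finset.mul_sum]
    exact Finset.sum_congr rfl fun y _ => by ring
  · refine Finset.sum_congr rfl fun x _ => ?_
    rw [outer]; ring

lemma Coupling.pf_ghost {K : ℤ → ℤ → ℝ} (hK : Coupling K) (β : ℝ) (Λ : Finset ℤ)
    (F : (Option Λ → ℤˣ) → ℝ) : pf (β • ghost K Λ) F =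
      ∑ b : Bool, ∑ a : Λ → Bool, F (fun o => toSign (o.elim b a)) *
        exp (-hamiltonian K β Λ (concat Λ a fun _ => b)) := by
  rw [pf, ← Fintype.sum_prod_type']
  symm
  refine Fintype.sum_bijective (fun p : Bool × (Λ → Bool) =>
    (fun o : Option Λ => toSign (o.elim p.1 p.2))) ⟨?_, ?_⟩ _ _ fun p => ?_
  · rintro ⟨b, a⟩ ⟨b', a'⟩ h
    refine Prod.ext (toSign_bijective.1 (congrFun h none)) ?_
    exact funext fun i => toSign_bijective.1 (congrFun h (some i))
  · intro σ
    obtain ⟨f, hf⟩ := toSign_bijective.2.hasRightInverse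
    refine ⟨(f (σ none), fun i => f (σ (some i))), ?_⟩
    ext o
    cases o <;> simp [hf _]
  · rw [hK.wt_ghost]

lemma sum_flip (K : ℤ → ℤ → ℝ) (β : ℝ) (Λ : Finset ℤ) (G : (Λ → Bool) → ℝ) (b : Bool) :
    ∑ a : Λ → Bool, G a * exp (-hamiltonian K β Λ (concat Λ a fun _ => !b)) =
      ∑ a : Λ → Bool, G (fun i => !a i) * exp (-hamiltonian K β Λ (concat Λ a fun _ => b)) := by
  refine Fintype.sum_bijective (fun (a : Λ → Bool) i => !a i)
    (Function.Involutive.bijective fun a => by simp) _ _ fun a => ?_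
  rw [← hamiltonian_not K β Λ (concat Λ a _)]
  congr 4
  · simp
  · ext j
    by_cases hj : j ∈ Λ <;> simp [concat, hj]

lemma Coupling.corr_ghost {K : ℤ → ℤ → ℝ} (hK : Coupling K) (β : ℝ) (Λ : Finset ℤ) (i : Λ)
    (b : Bool) : corr (β • ghost K Λ) (some i) none =
      boxMean K β Λ (fun _ => b) fun ω => spin b * spin (ω i) := by
  set Z : Bool → ℝ := fun b => ∑ a : Λ → Bool,
    exp (-hamiltonian K β Λ (concat Λ a fun _ => b)) with hZ
  set A : Bool → ℝ := fun b => ∑ a : Λ → Bool, spin (a i) * spin b *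
    exp (-hamiltonian K β Λ (concat Λ a fun _ => b)) with hA
  have hZ0 : ∀ b, 0 < Z b := fun b => Finset.sum_pos (fun _ _ => exp_pos _) Finset.univ_nonempty
  have hZn : Z (!b) = Z b := by
    have := sum_flip K β Λ (fun _ => 1) b
    simpa [hZ] using this
  have hAn : A (!b) = A b := by
    have := sum_flip K β Λ (fun a => spin (a i) * spin (!b)) b
    simp only [hA, this, spin_not, neg_mul_neg]
  have h1 : pf (β • ghost K Λ) (fun σ => sg (σ (some i)) * sg (σ none)) = 2 * A b := by
    rw [hK.pf_ghost]
    simp only [sg_toSign, Option.elim]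
    rw [Fintype.sum_bool]
    change A true + A false = _
    cases b <;> simp at hAn <;> rw [hAn] <;> ring
  have h2 : pc (β • ghost K Λ) 1 = 2 * Z b := by
    rw [pc, hK.pf_ghost]
    simp only [MonoidHom.one_apply, sg_one, one_mul]
    rw [Fintype.sum_bool]
    change Z true + Z false = _
    cases b <;> simp at hZn <;> rw [hZn] <;> ring
  rw [corr, ex, h1, h2, mul_div_mul_left _ _ two_ne_zero, boxMean, hA]
  simp only [Finset.sum_div]
  refine Finset.sum_congr rfl fun a _ => ?_
  rw [gibbsKernel]
  have : concat Λ a (fun _ => b) i = a i := by simp [concat]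
  rw [this]
  change _ / Z b = _ / Z b * _
  ring

end Ising

namespace Ising

/-- The pair coupling `β K / 2` as a function of ordered pairs. -/
def halfPair (K : ℤ → ℤ → ℝ) (β : ℝ) : ℤ × ℤ → ℝ := fun e => β * (K e.1 e.2 / 2)

lemma Coupling.halfPair_nonneg {K : ℤ → ℤ → ℝ} (hK : Coupling K) {β : ℝ} (hβ : 0 ≤ β) :
    0 ≤ halfPair K β := fun _ => mul_nonneg hβ (div_nonneg (hK.nonneg _ _) two_pos.le)

section
variable {K : ℤ → ℤ → ℝ} (hK : Coupling K)
include hK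

lemma Coupling.summable_outer (Λ : Finset ℤ) (i : ℤ) :
    Summable fun j => if j ∈ Λ then 0 else K i j :=
  Summable.of_norm_bounded (hK.summable i) fun j => by
    split_ifs
    · simpa using hK.nonneg i j
    · exact (Real.norm_of_nonneg (hK.nonneg i j)).le

lemma Coupling.outer_eq_add {S Λ : Finset ℤ} (hS : S ⊆ Λ) (i : ℤ) :
    outer K S i = outer K Λ i + ∑ j : Λ, if (j : ℤ) ∈ S then 0 else K i j := by
  rw [Finset.sum_coe_sort Λ fun j => if j ∈ S then 0 else K i j]
  have h := hasSum_sum_of_ne_finset_zero (s := Λ)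
    (f := fun j => if j ∈ Λ then if j ∈ S then 0 else K i j else 0)
    (fun p hp => if_neg hp) (L := SummationFilter.unconditional _)
  rw [Finset.sum_congr rfl (g := fun j => if j ∈ S then 0 else K i j)
    fun j hj => if_pos hj] at h
  refine HasSum.tsum_eq ?_
  convert (hK.summable_outer Λ i).hasSum.add h using 1
  funext j
  by_cases hj : j ∈ Λ
  · simp [hj]
  · have : j ∉ S := fun h => hj (hS h)
    simp [hj, this]
  · rfl

lemma Coupling.ghost_boundary {β : ℝ} (hβ : 0 < β) {Λ : Finset ℤ} (h0 : (0 : ℤ) ∈ Λ)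
    (hS : ∀ (S : Finset ℤ) (h : (0 : ℤ) ∈ S), 1 ≤ ∑ s : S,
      corr (pull (Subtype.val : S → ℤ) (halfPair K β)) ⟨0, h⟩ s * (β * outer K S s))
    (S : Finset (Option Λ)) (ha : some ⟨0, h0⟩ ∈ S) (hg : none ∉ S) :
    1 / β ≤ ∑ s : S, ∑ y ∈ Sᶜ, (ghost K Λ (s, y) + ghost K Λ (y, s)) *
      corr (res (β • ghost K Λ) S) ⟨some ⟨0, h0⟩, ha⟩ s := by
  classical
  set R : Finset ℤ := S.eraseNone.map (Function.Embedding.subtype _) with hR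
  have hmem : ∀ z, z ∈ R ↔ ∃ h : z ∈ Λ, some ⟨z, h⟩ ∈ S := by
    intro z; simp [hR]
  have hRΛ : R ⊆ Λ := fun z hz => ((hmem z).1 hz).1
  have h0R : (0 : ℤ) ∈ R := (hmem 0).2 ⟨h0, ha⟩
  set e : R → S := fun s => ⟨some ⟨s, hRΛ s.2⟩, ((hmem s).1 s.2).2⟩ with he
  have hinj : Function.Injective e := by
    intro s t h
    have h1 : (some (⟨s, hRΛ s.2⟩ : Λ)) = some ⟨t, hRΛ t.2⟩ := congrArg Subtype.val h
    have h2 := congrArg Subtype.val (Option.some.inj h1)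
    exact Subtype.ext h2
  have hbij : Function.Bijective e := by
    refine ⟨hinj, ?_⟩
    rintro ⟨_ | ⟨z, hz⟩, hzS⟩
    · exact absurd hzS hg
    · exact ⟨⟨z, (hmem z).2 ⟨hz, hzS⟩⟩, rfl⟩
  have hk0 := hK.ghost_nonneg Λ
  have hbk0 : 0 ≤ β • ghost K Λ := smul_nonneg hβ.le hk0
  have hout : ∀ s : R, ∑ y ∈ Sᶜ, (ghost K Λ (e s, y) + ghost K Λ (y, e s)) = outer K R s := by
    intro s
    have h1 : Sᶜ = Finset.univ.filter (fun y => y ∉ S) := by ext; simp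
    rw [h1, Finset.sum_filter, Fintype.sum_option, if_pos hg, hK.outer_eq_add hRΛ]
    simp only [he, ghost, add_zero]
    congr 1
    refine Finset.sum_congr rfl fun y _ => ?_
    have : (y : ℤ) ∈ R ↔ some y ∈ S := by rw [hmem]; simp
    rw [hK.symm y s, add_halves]
    by_cases h : some y ∈ S <;> simp [this, h]
  have hcorr : ∀ s : R, corr (pull (Subtype.val : R → ℤ) (halfPair K β)) ⟨0, h0R⟩ s ≤
      corr (res (β • ghost K Λ) S) ⟨some ⟨0, h0⟩, ha⟩ (e s) := fun s =>
    corr_embedding_le hinj (fun e => hK.halfPair_nonneg hβ.le _) (fun e => hbk0 _)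
      (fun _ => le_rfl) ⟨0, h0R⟩ s
  have := hS R h0R
  rw [div_le_iff₀ hβ, ← Fintype.sum_bijective e hbij (fun s : R =>
    ∑ y ∈ Sᶜ, (ghost K Λ (e s, y) + ghost K Λ (y, e s)) *
      corr (res (β • ghost K Λ) S) ⟨some ⟨0, h0⟩, ha⟩ (e s)) _ fun s => rfl, Finset.sum_mul]
  refine this.trans (Finset.sum_le_sum fun s _ => ?_)
  rw [← Finset.sum_mul, hout]
  calc _ ≤ corr (res (β • ghost K Λ) S) ⟨some ⟨0, h0⟩, ha⟩ (e s) * (β * outer K R s) :=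
        mul_le_mul_of_nonneg_right (hcorr s) (mul_nonneg hβ.le (hK.outer_nonneg R s))
    _ = _ := by ring

lemma Coupling.exists_boundary_lt {β β' : ℝ} (hβ : 0 ≤ β) (hβ' : β < β')
    (hu : ∃! μ : Measure Config, IsGibbs K β' μ) : ∃ (S : Finset ℤ) (h : (0 : ℤ) ∈ S), ∑ s : S,
      corr (pull (Subtype.val : S → ℤ) (halfPair K β)) ⟨0, h⟩ s * (β * outer K S s) < 1 := by
  by_contra! hS
  have hpos : 0 < β := by
    refine lt_of_le_of_ne hβ ?_
    rintro rfl
    have := hS {0} (Finset.mem_singleton_self 0)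
    simp only [zero_mul, mul_zero, Finset.sum_const_zero] at this
    linarith
  have h0 : ∀ N, (0 : ℤ) ∈ box N := fun N => by simp [box]
  set c : ℝ := 1 - exp (-(1 / β * (β' - β))) with hc
  have hc0 : 0 < c := by
    have : 0 < 1 / β * (β' - β) := mul_pos (by positivity) (by linarith)
    have : exp (-(1 / β * (β' - β))) < 1 := by
      rw [exp_lt_one_iff]; linarith
    linarith
  have hm : ∀ N b, c ≤ boxMean K β' (box N) (fun _ => b) fun ω => spin b * spin (ω 0) := by
    intro N b
    have h1 := one_sub_corr_le_exp (hK.ghost_nonneg (box N)) (some ⟨0, h0 N⟩) none hβ hβ'.le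
      fun S ha hg => hK.ghost_boundary hpos (h0 N) hS S ha hg
    have h2 := hK.corr_ghost β' (box N) ⟨0, h0 N⟩ b
    simp only at h2
    rw [← h2]
    linarith
  have hex : ∀ b, ∃ μ, IsGibbs K β' μ ∧ c ≤ spin b * ∫ ω, spin (ω 0) ∂μ := by
    intro b
    obtain ⟨μ, h1, h2⟩ := hK.exists_isGibbs β' (fun _ => b)
      (continuous_const.mul (continuous_spin.comp (continuous_apply (0 : ℤ)))) fun N => hm N b
    refine ⟨μ, h1, ?_⟩
    rwa [← integral_const_mul]
  obtain ⟨μ, h1, h2⟩ := hex true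
  obtain ⟨μ', h1', h2'⟩ := hex false
  rw [hu.unique h1' h1] at h2'
  simp only [spin, if_true] at h2 h2'
  norm_num at h2 h2'
  linarith

lemma Coupling.exists_susceptibility_bound (htr : ∀ a m n, K (m + a) (n + a) = K m n) {β : ℝ}
    (hβ : 0 ≤ β) (hβc : β < betaC K) : ∃ X : ℝ, 0 ≤ X ∧ ∀ (n : ℕ) (p : Fin n → ℤ),
      Function.Injective p → ∀ x, ∑ z, corr (pull p (halfPair K β)) x z ≤ X := by
  have hne : {β : ℝ | 0 ≤ β ∧ ∃! μ : Measure Config, IsGibbs K β μ}.Nonempty := by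
    by_contra h
    rw [Set.not_nonempty_iff_eq_empty] at h
    rw [betaC, h, Real.sSup_empty] at hβc
    linarith
  obtain ⟨β', ⟨-, hu⟩, hβ'⟩ := exists_lt_of_lt_csSup hne hβc
  obtain ⟨S, h0, hS⟩ := hK.exists_boundary_lt hβ hβ' hu
  refine ⟨_, div_nonneg (Nat.cast_nonneg S.card) (sub_nonneg.2 hS.le), fun n p hp x => ?_⟩
  refine susceptibility_le (hK.halfPair_nonneg hβ) (fun a m n => ?_) S h0
    (fun s => β * outer K S s) (fun s _ Y hY => ?_) le_rfl hS hp x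
  · simp only [halfPair, htr]
  · have h1 : ∀ y, halfPair K β (s, y) + halfPair K β (y, s) = β * K s y := by
      intro y
      simp only [halfPair]
      rw [hK.symm y s]; ring
    simp only [h1]
    rw [← Finset.mul_sum]
    refine mul_le_mul_of_nonneg_left ?_ hβ
    have h2 : ∑ y ∈ Y, K s y = ∑ y ∈ Y, if y ∈ S then 0 else K s y :=
      Finset.sum_congr rfl fun y hy => (if_neg (Finset.disjoint_left.1 hY hy)).symm
    rw [h2]
    refine (hK.summable_outer S s).sum_le_tsum Y fun y _ => ?_
    split_ifs
    exacts [le_rfl, hK.nonneg _ _]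

end

lemma coupling_dysonK {J : ℕ → ℝ} (hJpos : ∀ k : ℕ, 1 ≤ k → 0 ≤ J k)
    (hJsum : Summable fun k : ℕ => J (k + 1)) : Coupling (dysonK J) where
  symm i j := by
    simp only [dysonK, eq_comm (a := i), ← Int.natAbs_neg (i - j), neg_sub]
  diag i := by simp [dysonK]
  nonneg i j := by
    rw [dysonK]; split_ifs with h
    exacts [le_rfl, hJpos _ (by omega)]
  summable i := by
    have hg : Summable fun n : ℤ => if n = 0 then 0 else J n.natAbs := by
      have h : Summable fun n : ℕ => if (n : ℤ) = 0 then 0 else J (n : ℤ).natAbs := by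
        rw [← summable_nat_add_iff 1]
        refine hJsum.congr fun n => ?_
        rw [if_neg (by omega)]; rfl
      refine Summable.of_nat_of_neg h ?_
      refine h.congr fun n => ?_
      simp
    have := (Equiv.subLeft i).summable_iff.2 hg
    refine this.congr fun j => ?_
    simp only [Function.comp, Equiv.subLeft_apply, dysonK, sub_eq_zero]

lemma dysonK_add (J : ℕ → ℝ) (a m n : ℤ) : dysonK J (m + a) (n + a) = dysonK J m n := by
  simp only [dysonK, add_left_inj, add_sub_add_right_eq_sub]

end Ising

namespace Ising

/-- The field exerted by the half-line configuration `x` on the site at distance `i + 1`. -/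
def field (J : ℕ → ℝ) (x : ConfigP) (i : ℕ) : ℝ := ∑' m, J (i + 1 + m) * spin (x m)

/-- The tail `∑_{k > i} J k`. -/
def tail (J : ℕ → ℝ) (i : ℕ) : ℝ := ∑' k, J (i + 1 + k)

/-- The coupling of the first `n` sites. -/
def chain (J : ℕ → ℝ) (β : ℝ) (n : ℕ) : Fin n × Fin n → ℝ :=
  pull (fun i : Fin n => ((i : ℕ) : ℤ)) (halfPair (dysonK J) β)

section
variable {J : ℕ → ℝ} (hJpos : ∀ k : ℕ, 1 ≤ k → 0 ≤ J k) (hJsum : Summable fun k : ℕ => J (k + 1))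
include hJpos hJsum

omit hJpos in
lemma summable_shift (i : ℕ) : Summable fun m => J (i + 1 + m) := by
  refine ((summable_nat_add_iff i).2 hJsum).congr fun m => ?_
  congr 1; ring

lemma norm_field_term (x : ConfigP) (i m : ℕ) : ‖J (i + 1 + m) * spin (x m)‖ = J (i + 1 + m) := by
  rw [norm_mul, Real.norm_eq_abs, Real.norm_eq_abs, abs_spin, mul_one,
    abs_of_nonneg (hJpos _ (by omega))]

lemma summable_field (x : ConfigP) (i : ℕ) : Summable fun m => J (i + 1 + m) * spin (x m) :=
  Summable.of_norm_bounded (summable_shift hJsum i) fun m => (norm_field_term hJpos hJsum x i m).le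

lemma abs_field_le (x : ConfigP) (i : ℕ) : |field J x i| ≤ tail J i :=
  tsum_of_norm_bounded (summable_shift hJsum i).hasSum
    fun m => (norm_field_term hJpos hJsum x i m).le

lemma field_consP (b : Bool) (x : ConfigP) (i : ℕ) :
    field J (consP b x) i = J (i + 1) * spin b + field J x (i + 1) := by
  rw [field, (summable_field hJpos hJsum (consP b x) i).tsum_eq_zero_add, field]
  congr 1
  refine tsum_congr fun m => ?_
  congr 2; ring

omit hJpos hJsum in
lemma potential_consP (b : Bool) (x : ConfigP) :
    potential J (consP b x) = spin b * field J x 0 := by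
  rw [potential, field, ← tsum_mul_left]
  refine tsum_congr fun m => ?_
  simp only [consP, zero_add, add_comm 1 m]
  ring

lemma continuous_field (i : ℕ) : Continuous fun x => field J x i :=
  continuous_tsum (fun m => continuous_const.mul (continuous_spin.comp (continuous_apply m)))
    (summable_shift hJsum i) fun m x => (norm_field_term hJpos hJsum x i m).le

omit hJpos hJsum in
lemma continuous_consP (b : Bool) : Continuous (consP b) := by
  refine continuous_pi fun n => ?_
  cases n with
  | zero => exact continuous_const
  | succ m => exact continuous_apply m

lemma continuous_transfer (β : ℝ) {f : ConfigP → ℝ} (hf : Continuous f) :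
    Continuous (transfer J β f) := by
  refine continuous_finsetSum _ fun b _ => ?_
  have h1 := continuous_field hJpos hJsum 0
  have h2 := hf.comp (continuous_consP b)
  simp only [potential_consP]
  exact (continuous_exp.comp (continuous_const.mul (continuous_const.mul h1))).mul h2

lemma field_sub_le {x y : ConfigP} {N : ℕ} (h : ∀ m < N, x m = y m) (i : ℕ) :
    |field J x i - field J y i| ≤ 2 * tail J (i + N) := by
  rw [field, field, ← (summable_field hJpos hJsum x i).tsum_sub (summable_field hJpos hJsum y i)]
  have hs := (summable_field hJpos hJsum x i).sub (summable_field hJpos hJsum y i)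
  rw [← hs.sum_add_tsum_nat_add N, Finset.sum_eq_zero fun m hm => by
    rw [h m (Finset.mem_range.1 hm), sub_self], zero_add, tail, ← tsum_mul_left,
    ← Real.norm_eq_abs]
  refine tsum_of_norm_bounded ((summable_shift hJsum (i + N)).mul_left 2).hasSum fun m => ?_
  refine (norm_sub_le _ _).trans ?_
  rw [norm_field_term hJpos hJsum, norm_field_term hJpos hJsum, ← two_mul,
    show i + 1 + (m + N) = i + N + 1 + m by ring]

lemma iterate_transfer (β : ℝ) (n : ℕ) (x : ConfigP) :
    (transfer J β)^[n] (fun _ => 1) x =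
      pf (chain J β n) fun σ => exp (∑ i : Fin n, β * field J x i * sg (σ i)) := by
  induction n generalizing x with
  | zero => simp [pf, wt]
  | succ n ih =>
    rw [Function.iterate_succ_apply', transfer, pf,
      ← (Fin.consEquiv fun _ : Fin (n + 1) => ℤˣ).sum_comp, Fintype.sum_prod_type,
      ← toSign_bijective.sum_comp]
    refine Finset.sum_congr rfl fun b _ => ?_
    rw [ih, pf, Finset.mul_sum]
    refine Finset.sum_congr rfl fun σ _ => ?_
    rw [wt, wt, ← exp_add, ← exp_add, ← exp_add]
    congr 1
    rw [Fintype.sum_prod_type, Fintype.sum_prod_type]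
    have hd : dysonK J 0 0 = 0 := by simp [dysonK]
    have h1 : ∀ i : Fin n, dysonK J 0 ((i : ℕ) + 1) = J (i + 1) := fun i => by
      rw [dysonK, if_neg (by omega)]; congr 1
    have h2 : ∀ i : Fin n, dysonK J ((i : ℕ) + 1) 0 = J (i + 1) := fun i => by
      rw [dysonK, if_neg (by omega)]; rfl
    simp only [Fin.sum_univ_succ, Fin.consEquiv_apply, Fin.cons_zero, Fin.cons_succ, chain, pull,
      halfPair, Fin.val_zero, Fin.val_succ, Nat.cast_zero, Nat.cast_add, Nat.cast_one, dysonK_add,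
      bond_apply, hd, h1, h2, field_consP hJpos hJsum, potential_consP, sg_mul, sg_toSign,
      Finset.sum_add_distrib]
    have h3 : ∑ i : Fin n, β * (J (i + 1) * spin b + field J x (i + 1)) * sg (σ i) =
        ∑ i : Fin n, β * (J (i + 1) / 2) * (spin b * sg (σ i)) +
        ∑ i : Fin n, β * (J (i + 1) / 2) * (sg (σ i) * spin b) +
        ∑ i : Fin n, β * field J x (i + 1) * sg (σ i) := by
      rw [← Finset.sum_add_distrib, ← Finset.sum_add_distrib]
      exact Finset.sum_congr rfl fun i _ => by ring
    rw [h3]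
    ring

end

end Ising

namespace Ising

section
variable {V : Type*} [Fintype V] [DecidableEq V]

lemma ex_add (K : V × V → ℝ) (f g : (V → ℤˣ) → ℝ) : ex K (f + g) = ex K f + ex K g := by
  rw [ex, pf_add, add_div]; rfl

lemma ex_const_mul (K : V × V → ℝ) (c : ℝ) (f : (V → ℤˣ) → ℝ) :
    ex K (fun σ => c * f σ) = c * ex K f := by
  rw [ex, pf_const_mul, mul_div_assoc]; rfl

lemma ex_le_ex (K : V × V → ℝ) {f g : (V → ℤˣ) → ℝ} (h : ∀ σ, f σ ≤ g σ) : ex K f ≤ ex K g :=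
  div_le_div_of_nonneg_right (pf_mono K h) (pf_one_pos K).le

lemma ex_exp_le_sq {K : V × V → ℝ} (hK : 0 ≤ K) {X : ℝ} (hX : ∀ v, ∑ w, corr K v w ≤ X)
    (a : V → ℝ) : ex K (fun σ => exp (∑ v, a v * sg (σ v))) ≤ exp (X * (∑ v, a v ^ 2) / 2) := by
  refine (ex_exp_le_abs hK a).trans ((ex_exp_le hK (fun v => |a v|) fun v => abs_nonneg _).trans ?_)
  have h := quad_le hK hX fun v => |a v|
  simp only [sq_abs] at h
  exact exp_le_exp.2 (by linarith)

lemma exp_sub_exp_le {a b c : ℝ} (hc : 0 < c) :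
    exp a - exp b ≤ c * (a - b) ^ 2 + exp (2 * a) / (2 * c) := by
  have h1 : exp a - exp b ≤ (a - b) * exp a := by
    have h := add_one_le_exp (b - a)
    have h2 := mul_le_mul_of_nonneg_right h (exp_pos a).le
    rw [← exp_add, sub_add_cancel] at h2
    linarith
  have h2 : exp (2 * a) = exp a ^ 2 := by rw [two_mul, exp_add, sq]
  refine h1.trans ?_
  rw [h2, ← sub_nonneg]
  have : c * (a - b) ^ 2 + exp a ^ 2 / (2 * c) - (a - b) * exp a =
      (c * (a - b) - exp a / 2) ^ 2 / c + exp a ^ 2 / (4 * c) := by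
    field_simp; ring
  rw [this]
  positivity

lemma ex_exp_sub_le {K : V × V → ℝ} (hK : 0 ≤ K) {X : ℝ} (hX : ∀ v, ∑ w, corr K v w ≤ X)
    (a b : V → ℝ) {c : ℝ} (hc : 0 < c) :
    ex K (fun σ => exp (∑ v, a v * sg (σ v))) - ex K (fun σ => exp (∑ v, b v * sg (σ v))) ≤
      c * (X * ∑ v, (a v - b v) ^ 2) + exp (2 * X * ∑ v, a v ^ 2) / (2 * c) := by
  have h1 : ex K (fun σ => exp (∑ v, a v * sg (σ v))) ≤
      ex K ((fun σ => exp (∑ v, b v * sg (σ v))) +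
        ((fun σ => c * (∑ v, (a v - b v) * sg (σ v)) ^ 2) +
          fun σ => 1 / (2 * c) * exp (∑ v, 2 * a v * sg (σ v)))) := by
    refine ex_le_ex K fun σ => ?_
    have h := exp_sub_exp_le (a := ∑ v, a v * sg (σ v)) (b := ∑ v, b v * sg (σ v)) hc
    simp only [Pi.add_apply, sub_mul, Finset.sum_sub_distrib, mul_assoc, ← Finset.mul_sum]
    rw [one_div_mul_eq_div]
    linarith
  rw [ex_add, ex_add, ex_const_mul, ex_const_mul, ex_sq_eq] at h1
  have h2 := mul_le_mul_of_nonneg_left (quad_le hK hX fun v => a v - b v) hc.le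
  have h3 := ex_exp_le_sq hK hX fun v => 2 * a v
  have h4 : X * (∑ v, (2 * a v) ^ 2) / 2 = 2 * X * ∑ v, a v ^ 2 := by
    simp only [mul_pow, ← Finset.mul_sum]; ring
  rw [h4] at h3
  have h5 := mul_le_mul_of_nonneg_left h3 (by positivity : 0 ≤ 1 / (2 * c))
  rw [one_div_mul_eq_div, one_div_mul_eq_div] at h5
  rw [one_div_mul_eq_div] at h1
  linarith

end

/-- The normalised iterate of the constant function `1`. -/
def normIter (J : ℕ → ℝ) (β : ℝ) (n : ℕ) (x : ConfigP) : ℝ :=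
  ex (chain J β n) fun σ => exp (∑ i : Fin n, β * field J x i * sg (σ i))

section
variable {J : ℕ → ℝ} (hJpos : ∀ k : ℕ, 1 ≤ k → 0 ≤ J k) (hJsum : Summable fun k : ℕ => J (k + 1))
  (hJ2 : Summable fun i : ℕ => tail J i ^ 2) {β X : ℝ} (hβ : 0 ≤ β) (hX0 : 0 ≤ X)
  (hX : ∀ n v, ∑ w, corr (chain J β n) v w ≤ X)
include hJpos hJsum hJ2 hβ hX0 hX

omit hJpos hJsum hJ2 hβ hX0 hX in
lemma one_le_normIter (n : ℕ) (x : ConfigP) : 1 ≤ normIter J β n x :=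
  one_le_ex_exp (chain J β n) fun i => β * field J x i

omit hJ2 hX0 hX in
lemma chain_nonneg (n : ℕ) : 0 ≤ chain J β n := fun _ =>
  (coupling_dysonK hJpos hJsum).halfPair_nonneg hβ _

omit hX0 hX in
lemma sum_field_sq_le (n : ℕ) (x : ConfigP) :
    ∑ i : Fin n, (β * field J x i) ^ 2 ≤ β ^ 2 * ∑' i, tail J i ^ 2 := by
  simp only [mul_pow, ← Finset.mul_sum]
  refine mul_le_mul_of_nonneg_left ?_ (sq_nonneg β)
  rw [Fin.sum_univ_eq_sum_range fun i => field J x i ^ 2]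
  refine (Finset.sum_le_sum fun i _ => ?_).trans
    (hJ2.sum_le_tsum (Finset.range n) fun i _ => sq_nonneg _)
  exact sq_le_sq.2 ((abs_field_le hJpos hJsum x i).trans (le_abs_self _))

lemma normIter_le (n : ℕ) (x : ConfigP) :
    normIter J β n x ≤ exp (2 * X * (β ^ 2 * ∑' i, tail J i ^ 2)) := by
  refine (ex_exp_le_sq (chain_nonneg hJpos hJsum hβ n) (hX n) fun i : Fin n =>
    β * field J x i).trans (exp_le_exp.2 ?_)
  have h := mul_le_mul_of_nonneg_left (sum_field_sq_le hJpos hJsum hJ2 hβ n x) hX0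
  have h0 : 0 ≤ X * (β ^ 2 * ∑' i, tail J i ^ 2) :=
    mul_nonneg hX0 (mul_nonneg (sq_nonneg _) (tsum_nonneg fun _ => sq_nonneg _))
  linarith

lemma normIter_sub_le {x y : ConfigP} {N : ℕ} (h : ∀ m < N, x m = y m) (n : ℕ) {c : ℝ}
    (hc : 0 < c) : normIter J β n x - normIter J β n y ≤
      c * (X * (4 * β ^ 2 * ∑' i, tail J (i + N) ^ 2)) +
        exp (2 * X * (β ^ 2 * ∑' i, tail J i ^ 2)) / (2 * c) := by
  refine (ex_exp_sub_le (chain_nonneg hJpos hJsum hβ n) (hX n) (fun i : Fin n => β * field J x i)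
    (fun i : Fin n => β * field J y i) hc).trans ?_
  have h1 : ∑ i : Fin n, (β * field J x i - β * field J y i) ^ 2 ≤
      4 * β ^ 2 * ∑' i, tail J (i + N) ^ 2 := by
    have hN := (summable_nat_add_iff N).2 hJ2
    rw [Fin.sum_univ_eq_sum_range fun i => (β * field J x i - β * field J y i) ^ 2]
    refine le_trans ?_ (mul_le_mul_of_nonneg_left
      (hN.sum_le_tsum (Finset.range n) fun i _ => sq_nonneg _) (by positivity))
    rw [Finset.mul_sum]
    refine Finset.sum_le_sum fun i _ => ?_
    have := field_sub_le hJpos hJsum h i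
    have h2 := sq_le_sq.2 (this.trans (le_abs_self _))
    have h3 := mul_le_mul_of_nonneg_left h2 (sq_nonneg β)
    linarith
  have h2 := sum_field_sq_le hJpos hJsum hJ2 hβ n x
  gcongr

lemma exists_modulus {ε : ℝ} (hε : 0 < ε) : ∃ N : ℕ, ∀ x y : ConfigP, (∀ m < N, x m = y m) →
    ∀ n, |normIter J β n x - normIter J β n y| ≤ ε := by
  set M := exp (2 * X * (β ^ 2 * ∑' i, tail J i ^ 2)) with hM
  have hM0 : 0 < M := exp_pos _
  set c := M / ε with hc
  have hc0 : 0 < c := div_pos hM0 hε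
  have ht : Filter.Tendsto (fun N => c * (X * (4 * β ^ 2 * ∑' i, tail J (i + N) ^ 2)))
      Filter.atTop (nhds (c * (X * (4 * β ^ 2 * 0)))) :=
    (((tendsto_sum_nat_add fun i => tail J i ^ 2).const_mul _).const_mul _).const_mul _
  simp only [mul_zero] at ht
  obtain ⟨N, hN⟩ := (ht.eventually_le_const (half_pos hε)).exists
  have hMc : M / (2 * c) = ε / 2 := by
    rw [hc]; field_simp
  have key : ∀ x y : ConfigP, (∀ m < N, x m = y m) →
      ∀ n, normIter J β n x - normIter J β n y ≤ ε := fun x y h n => by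
    have := normIter_sub_le hJpos hJsum hJ2 hβ hX0 hX h n hc0
    rw [← hM, hMc] at this
    linarith
  refine ⟨N, fun x y h n => abs_sub_le_iff.2 ⟨key x y h n, key y x (fun m hm => (h m hm).symm) n⟩⟩

end

end Ising

namespace Ising

lemma transfer_const_mul (J : ℕ → ℝ) (β c : ℝ) (f : ConfigP → ℝ) (x : ConfigP) :
    transfer J β (fun y => c * f y) x = c * transfer J β f x := by
  rw [transfer, transfer, Finset.mul_sum]
  exact Finset.sum_congr rfl fun a _ => by ring

lemma transfer_sum (J : ℕ → ℝ) (β : ℝ) (s : Finset ℕ) (f : ℕ → ConfigP → ℝ) (x : ConfigP) :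
    transfer J β (fun y => ∑ k ∈ s, f k y) x = ∑ k ∈ s, transfer J β (f k) x := by
  simp only [transfer, Finset.mul_sum]
  exact Finset.sum_comm

/-- A bounded equicontinuous orbit of the normalised transfer operator yields an eigenfunction. -/
lemma exists_eigenfunction {J : ℕ → ℝ} {β lam : ℝ} {h : ℕ → ConfigP → ℝ}
    (hstep : ∀ k x, transfer J β (h k) x = lam * h (k + 1) x) {m M : ℝ} (hm : 0 < m)
    (hlow : ∀ k x, m ≤ h k x) (hupp : ∀ k x, h k x ≤ M)
    (hcont : ∀ ε > 0, ∃ N : ℕ, ∀ x y : ConfigP, (∀ m < N, x m = y m) →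
      ∀ k, |h k x - h k y| ≤ ε) :
    ∃ g : ConfigP → ℝ, Continuous g ∧ (∀ x, 0 < g x) ∧ ∀ x, transfer J β g x = lam * g x := by
  set c : ℕ → ConfigP → ℝ := fun n x => ((n : ℝ) + 1)⁻¹ * ∑ k ∈ Finset.range (n + 1), h k x with hc
  have hn : ∀ n : ℕ, (0 : ℝ) < (n : ℝ) + 1 := fun n => by positivity
  have hclow : ∀ n x, m ≤ c n x := fun n x => by
    have := Finset.card_nsmul_le_sum (Finset.range (n + 1)) (fun k => h k x) m fun k _ => hlow k x
    change m ≤ _⁻¹ * _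
    rw [inv_mul_eq_div, le_div_iff₀ (hn n)]
    simpa [mul_comm] using this
  have hcupp : ∀ n x, c n x ≤ M := fun n x => by
    have := Finset.sum_le_card_nsmul (Finset.range (n + 1)) (fun k => h k x) M fun k _ => hupp k x
    change _⁻¹ * _ ≤ M
    rw [inv_mul_eq_div, div_le_iff₀ (hn n)]
    simpa [mul_comm] using this
  have hcsub : ∀ {ε : ℝ} {x y : ConfigP}, (∀ k, |h k x - h k y| ≤ ε) →
      ∀ n, |c n x - c n y| ≤ ε := fun {ε x y} hxy n => by
    rw [hc]
    change |_ * _ - _ * _| ≤ _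
    rw [← mul_sub, ← Finset.sum_sub_distrib, abs_mul, abs_of_pos (inv_pos.2 (hn n)),
      inv_mul_eq_div, div_le_iff₀ (hn n)]
    refine (Finset.abs_sum_le_sum_abs _ _).trans ?_
    have := Finset.sum_le_card_nsmul (Finset.range (n + 1)) (fun k => |h k x - h k y|) ε
      fun k _ => hxy k
    simpa [mul_comm] using this
  set U : Ultrafilter ℕ := Filter.hyperfilter ℕ
  have hU : (U : Filter ℕ) ≤ Filter.atTop := Nat.hyperfilter_le_atTop
  have hlim : ∀ x, ∃ l, Filter.Tendsto (fun n : ℕ => c n x) U (nhds l) := fun x => by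
    obtain ⟨l, -, hl⟩ := (isCompact_Icc (a := m) (b := M)).ultrafilter_le_nhds
      (U.map fun n : ℕ => c n x) (by
        rw [Filter.le_principal_iff]
        exact Ultrafilter.mem_map.2 (Filter.univ_mem' fun n => ⟨hclow n x, hcupp n x⟩))
    exact ⟨l, hl⟩
  choose g hg using hlim
  refine ⟨g, ?_, fun x => hm.trans_le (ge_of_tendsto (hg x)
    (Filter.Eventually.of_forall fun n => hclow n x)), fun x => ?_⟩
  · rw [continuous_iff_continuousAt]
    intro x
    rw [ContinuousAt, Metric.tendsto_nhds]
    intro ε hε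
    obtain ⟨N, hN⟩ := hcont (ε / 2) (half_pos hε)
    have hopen : ∀ᶠ y in nhds x, ∀ m ∈ Finset.range N, y m = x m := by
      rw [Filter.eventually_all_finset]
      intro i _
      exact (continuous_apply (A := fun _ : ℕ => Bool) i).continuousAt.eventually
        (p := fun b => b = x i) (by rw [nhds_discrete]; exact rfl)
    filter_upwards [hopen] with y hy
    have h1 := hcsub fun k => hN y x (fun i hi => hy i (Finset.mem_range.2 hi)) k
    have h2 := le_of_tendsto ((hg y).sub (hg x)).abs (Filter.Eventually.of_forall h1)
    rw [Real.dist_eq]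
    linarith
  · have ht : ∀ n, transfer J β (c n) x =
        lam * c n x + lam * (((n : ℝ) + 1)⁻¹ * (h (n + 1) x - h 0 x)) := fun n => by
      rw [hc, transfer_const_mul, transfer_sum]
      simp only [hstep]
      rw [← Finset.mul_sum]
      have h1 := Finset.sum_range_succ' (fun k => h k x) (n + 1)
      rw [Finset.sum_range_succ (fun k => h k x) (n + 1)] at h1
      have h2 : ∑ k ∈ Finset.range (n + 1), h (k + 1) x =
          ∑ k ∈ Finset.range (n + 1), h k x + (h (n + 1) x - h 0 x) := by linarith
      rw [h2]; ring
    have hz : Filter.Tendsto (fun n : ℕ => ((n : ℝ) + 1)⁻¹ * (h (n + 1) x - h 0 x)) U (nhds 0) := by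
      refine Filter.Tendsto.mono_left ?_ hU
      refine Filter.Tendsto.zero_mul_isBoundedUnder_le ?_ ⟨M + M, ?_⟩
      · simpa [one_div] using tendsto_one_div_add_atTop_nhds_zero_nat (𝕜 := ℝ)
      · refine Filter.eventually_map.2 (Filter.Eventually.of_forall fun n => ?_)
        simp only [Function.comp, Real.norm_eq_abs]
        have := hlow (n + 1) x
        have := hupp (n + 1) x
        have := hlow 0 x
        have := hupp 0 x
        rw [abs_le]; constructor <;> linarith
    have h1 : Filter.Tendsto (fun n => transfer J β (c n) x) U (nhds (transfer J β g x)) :=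
      tendsto_finsetSum _ fun a _ => (hg (consP a x)).const_mul _
    have h2 := ((hg x).const_mul lam).add (hz.const_mul lam)
    rw [mul_zero, add_zero] at h2
    exact tendsto_nhds_unique h1 (h2.congr fun n => (ht n).symm)

section
variable {J : ℕ → ℝ} (hJpos : ∀ k : ℕ, 1 ≤ k → 0 ≤ J k) (hJsum : Summable fun k : ℕ => J (k + 1))
include hJpos hJsum

lemma continuous_iterate_transfer (β : ℝ) (n : ℕ) :
    Continuous ((transfer J β)^[n] fun _ => 1) := by
  induction n with
  | zero => exact continuous_const
  | succ n ih =>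
    rw [Function.iterate_succ_apply']
    exact continuous_transfer hJpos hJsum β ih

lemma integral_iterate_transfer {β lam : ℝ} {ν : Measure ConfigP} (hν : IsEigenprob J β lam ν)
    (n : ℕ) : ∫ x, (transfer J β)^[n] (fun _ => 1) x ∂ν = lam ^ n := by
  have := hν.1
  induction n with
  | zero => simp
  | succ n ih =>
    rw [Function.iterate_succ_apply', hν.2 _ (continuous_iterate_transfer hJpos hJsum β n), ih,
      pow_succ']

lemma iterate_transfer_eq (β : ℝ) (n : ℕ) (x : ConfigP) :
    (transfer J β)^[n] (fun _ => 1) x = pc (chain J β n) 1 * normIter J β n x := by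
  rw [iterate_transfer hJpos hJsum, normIter, ex, mul_div_cancel₀ _ (pf_one_pos _).ne']

lemma pc_chain_bounds {β lam : ℝ} {ν : Measure ConfigP} (hν : IsEigenprob J β lam ν) {M : ℝ}
    (hM : ∀ n x, normIter J β n x ≤ M) (n : ℕ) :
    pc (chain J β n) 1 ≤ lam ^ n ∧ lam ^ n ≤ pc (chain J β n) 1 * M := by
  have := hν.1
  have hc := continuous_iterate_transfer hJpos hJsum β n
  have hi : Integrable ((transfer J β)^[n] fun _ => 1) ν :=
    hc.integrable_of_hasCompactSupport (HasCompactSupport.of_compactSpace _)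
  have h0 := (pf_one_pos (chain J β n)).le
  rw [← integral_iterate_transfer hJpos hJsum hν n]
  constructor
  · have h := integral_mono (integrable_const (pc (chain J β n) 1)) hi fun x => by
      rw [iterate_transfer_eq hJpos hJsum]
      exact le_mul_of_one_le_right h0 (one_le_normIter n x)
    simpa using h
  · have h := integral_mono hi (integrable_const (pc (chain J β n) 1 * M)) fun x => by
      rw [iterate_transfer_eq hJpos hJsum]
      exact mul_le_mul_of_nonneg_left (hM n x) h0
    simpa using h

end

lemma exists_principal_eigenfunction (J : ℕ → ℝ) (hJpos : ∀ k : ℕ, 1 ≤ k → 0 ≤ J k)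
    (hJsum : Summable fun k : ℕ => J (k + 1))
    (hJ2 : Summable fun i : ℕ => (∑' k : ℕ, J (i + 1 + k)) ^ 2)
    {β : ℝ} (h0 : 0 ≤ β) (hβ : β < betaC (dysonK J))
    {lam : ℝ} (hlam : 0 < lam) {ν : Measure ConfigP} (hν : IsEigenprob J β lam ν) :
    ∃ h : ConfigP → ℝ, Continuous h ∧ (∀ x, 0 < h x) ∧ ∀ x, transfer J β h x = lam * h x := by
  obtain ⟨X, hX0, hX⟩ := (coupling_dysonK hJpos hJsum).exists_susceptibility_bound
    (dysonK_add J) h0 hβ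
  have hX' : ∀ n v, ∑ w, corr (chain J β n) v w ≤ X := fun n v =>
    hX n (fun i => ((i : ℕ) : ℤ)) (fun i j hij => Fin.ext (Int.ofNat.inj hij)) v
  set M := exp (2 * X * (β ^ 2 * ∑' i, tail J i ^ 2))
  have hM : ∀ n x, normIter J β n x ≤ M := normIter_le hJpos hJsum hJ2 h0 hX0 hX'
  have hM0 : 0 < M := exp_pos _
  have hZ := pc_chain_bounds hJpos hJsum hν hM
  set r : ℕ → ℝ := fun n => pc (chain J β n) 1 / lam ^ n with hr
  have hp : ∀ n, 0 < lam ^ n := fun n => pow_pos hlam n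
  have hr1 : ∀ n, r n ≤ 1 := fun n => (div_le_one (hp n)).2 (hZ n).1
  have hrM : ∀ n, M⁻¹ ≤ r n := fun n => by
    rw [hr, le_div_iff₀ (hp n), inv_mul_le_iff₀ hM0, mul_comm]
    exact (hZ n).2
  have hr0 : ∀ n, 0 ≤ r n := fun n => (inv_pos.2 hM0).le.trans (hrM n)
  have hform : ∀ n x, r n * normIter J β n x =
      (lam ^ n)⁻¹ * (transfer J β)^[n] (fun _ => 1) x := fun n x => by
    rw [iterate_transfer_eq hJpos hJsum, hr]; ring
  refine exists_eigenfunction (h := fun n x => r n * normIter J β n x) (m := M⁻¹) (M := M)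
    (fun k x => ?_) (inv_pos.2 hM0) (fun k x => ?_) (fun k x => ?_) fun ε hε => ?_
  · simp only [hform]
    rw [transfer_const_mul, ← Function.iterate_succ_apply' (transfer J β), pow_succ, mul_inv]
    field_simp
  · exact (hrM k).trans (le_mul_of_one_le_right (hr0 k) (one_le_normIter k x))
  · refine (mul_le_of_le_one_left ?_ (hr1 k)).trans (hM k x)
    exact zero_le_one.trans (one_le_normIter k x)
  · obtain ⟨N, hN⟩ := exists_modulus hJpos hJsum hJ2 h0 hX0 hX' hε
    refine ⟨N, fun x y h k => ?_⟩
    rw [← mul_sub, abs_mul, abs_of_nonneg (hr0 k)]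
    exact (mul_le_of_le_one_left (abs_nonneg _) (hr1 k)).trans (hN x y h k)

end Ising

/-- If `∑_{i≥1} (∑_{k≥i} J(k))² < ∞` (which entails `∑ J < ∞`),
then for every `0 ≤ β < β_c(Φ)` the unique eigenprobability `ν` of `L*_{βφ}` (with
eigenvalue `lam > 0`) admits an everywhere positive continuous principal eigenfunction. -/
theorem statement3 (J : ℕ → ℝ) (hJpos : ∀ k : ℕ, 1 ≤ k → 0 ≤ J k)
    (hJsum : Summable fun k : ℕ => J (k + 1))
    (hJ2 : Summable fun i : ℕ => (∑' k : ℕ, J (i + 1 + k)) ^ 2)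
    (β : ℝ) (h0 : 0 ≤ β) (hβ : β < betaC (dysonK J))
    (lam : ℝ) (hlam : 0 < lam) (ν : Measure ConfigP) (hν : IsEigenprob J β lam ν)
    (huniq : ∀ (ν' : Measure ConfigP) (lam' : ℝ), 0 < lam' → IsEigenprob J β lam' ν' →
      ν' = ν) :
    ∃ h : ConfigP → ℝ, Continuous h ∧ (∀ x, 0 < h x) ∧
      ∀ x, transfer J β h x = lam * h x := by
  exact Ising.exists_principal_eigenfunction J hJpos hJsum hJ2 h0 hβ hlam hν

end
end

section
/- Let μ be a probability measure on X and M > 0. Suppose (a) μ satisfies the log-Sobolev inequality with constant D > 0, and (b) for every i ∈ ℤ the pushforward μ^{(i)} of μ under the spin flip at site i is absolutely continuous with respect to μ with ‖dμ^{(i)}/dμ‖_{L^∞(μ)} ≤ M. Then μ satisfies the Gaussian Concentration Bound with constant D·(M + 1)/2. -/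
open MeasureTheory Real

noncomputable section

lemma sq_exp_half_sub_le (a b : ℝ) :
    (exp (a / 2) - exp (b / 2)) ^ 2 ≤ (a - b) ^ 2 / 4 * (exp a + exp b) := by
  wlog h : b ≤ a generalizing a b
  · have := this b a (le_of_not_ge h)
    linarith [sub_sq_comm (exp (a / 2)) (exp (b / 2)),
      show (b - a) ^ 2 / 4 * (exp b + exp a) = (a - b) ^ 2 / 4 * (exp a + exp b) by ring]
  have hb : exp (b / 2) = exp (a / 2) * exp ((b - a) / 2) := by
    rw [← exp_add]; congr 1; ring
  have ha : exp a = exp (a / 2) ^ 2 := by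
    rw [← exp_nat_mul]; congr 1; push_cast; ring
  have hlower : (b - a) / 2 + 1 ≤ exp ((b - a) / 2) := add_one_le_exp _
  have hupper : exp ((b - a) / 2) ≤ 1 := exp_le_one_iff.2 (by linarith)
  have hsq : (1 - exp ((b - a) / 2)) ^ 2 ≤ ((a - b) / 2) ^ 2 :=
    pow_le_pow_left₀ (by linarith) (by linarith) 2
  calc (exp (a / 2) - exp (b / 2)) ^ 2
      = (1 - exp ((b - a) / 2)) ^ 2 * exp a := by rw [hb, ha]; ring
    _ ≤ ((a - b) / 2) ^ 2 * exp a := by gcongr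
    _ ≤ (a - b) ^ 2 / 4 * (exp a + exp b) := by
      nlinarith [mul_nonneg (sq_nonneg (a - b)) (exp_pos b).le]

lemma flipAt_of_ne {i j : ℤ} (h : j ≠ i) (ω : Config) : flipAt i ω j = ω j := if_neg h

@[fun_prop]
lemma continuous_flipAt (i : ℤ) : Continuous (flipAt i) := by
  refine continuous_pi fun j => ?_
  by_cases h : j = i
  · simpa [flipAt, h, Function.comp_def] using
      (continuous_of_discreteTopology (f := not)).comp (continuous_apply i)
  · simpa [flipAt, h] using continuous_apply j

lemma Continuous.integrable_config {μ : Measure Config} [IsFiniteMeasure μ] {F : Config → ℝ}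
    (hF : Continuous F) : Integrable F μ :=
  integrableOn_univ.1 (hF.continuousOn.integrableOn_compact isCompact_univ)

lemma sub_le_osc {F : Config → ℝ} (hF : Continuous F) {k : ℤ} {ξ η : Config}
    (h : ∀ j, j ≠ k → ξ j = η j) : F ξ - F η ≤ osc F k := by
  obtain ⟨A, hA⟩ := (isCompact_range hF).bddAbove
  obtain ⟨B, hB⟩ := (isCompact_range hF).bddBelow
  refine le_csSup ⟨A - B, ?_⟩ ⟨ξ, η, h, rfl⟩
  rintro _ ⟨ξ', η', -, rfl⟩
  exact sub_le_sub (hA ⟨ξ', rfl⟩) (hB ⟨η', rfl⟩)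

lemma sq_sub_flipAt_le_osc {F : Config → ℝ} (hF : Continuous F) (k : ℤ) (ω : Config) :
    (F ω - F (flipAt k ω)) ^ 2 ≤ osc F k ^ 2 := by
  refine sq_le_sq' ?_ (sub_le_osc hF fun j hj => (flipAt_of_ne hj ω).symm)
  linarith [sub_le_osc hF (fun j hj => flipAt_of_ne hj ω : ∀ j, j ≠ k → flipAt k ω j = ω j)]

lemma osc_eq_zero {F : Config → ℝ} {S : Finset ℤ}
    (hS : ∀ ω η : Config, (∀ i ∈ S, ω i = η i) → F ω = F η) {k : ℤ} (hk : k ∉ S) :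
    osc F k = 0 := by
  have : {d : ℝ | ∃ ξ η : Config, (∀ j : ℤ, j ≠ k → ξ j = η j) ∧ d = F ξ - F η} = {0} := by
    ext d
    constructor
    · rintro ⟨ξ, η, h, rfl⟩
      exact sub_eq_zero.2 (hS ξ η fun i hi => h i (ne_of_mem_of_not_mem hi hk))
    · rintro rfl
      exact ⟨fun _ => true, fun _ => true, fun _ _ => rfl, (sub_self _).symm⟩
  rw [osc, this, csSup_singleton]

lemma integral_comp_flipAt_le {μ : Measure Config} [IsProbabilityMeasure μ] {M : ℝ} (hM : 0 < M)
    {i : ℤ} (hac : μ.map (flipAt i) ≪ μ)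
    (hbound : ∀ᵐ ω ∂μ, (μ.map (flipAt i)).rnDeriv μ ω ≤ ENNReal.ofReal M)
    {g : Config → ℝ} (hg : Continuous g) (hg0 : 0 ≤ g) :
    ∫ ω, g (flipAt i ω) ∂μ ≤ M * ∫ ω, g ω ∂μ := by
  have : (μ.map (flipAt i)).HaveLebesgueDecomposition μ :=
    Measure.haveLebesgueDecomposition_of_sigmaFinite _ _
  have hle : μ.map (flipAt i) ≤ ENNReal.ofReal M • μ := by
    rw [← Measure.withDensity_rnDeriv_eq _ _ hac, ← withDensity_const]
    exact withDensity_mono hbound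
  calc ∫ ω, g (flipAt i ω) ∂μ = ∫ ω, g ω ∂(μ.map (flipAt i)) :=
        (integral_map (continuous_flipAt i).aemeasurable hg.aestronglyMeasurable).symm
    _ ≤ ∫ ω, g ω ∂(ENNReal.ofReal M • μ) :=
        integral_mono_measure hle (Filter.Eventually.of_forall hg0)
          (hg.integrable_config.smul_measure ENNReal.ofReal_ne_top)
    _ = M * ∫ ω, g ω ∂μ := by
        rw [integral_smul_measure, ENNReal.toReal_ofReal hM.le, smul_eq_mul]

/-- Herbst's argument: a differential inequality for the cumulant generating function yields a
bound on its value at `1`. -/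
lemma cgf_one_le_of_deriv_le {Ω : Type*} [MeasurableSpace Ω] {μ : Measure Ω}
    [IsProbabilityMeasure μ] {F : Ω → ℝ} (hF : ∀ t, Integrable (fun ω => exp (t * F ω)) μ)
    {C : ℝ} (h : ∀ t, 0 < t →
      t * deriv (ProbabilityTheory.cgf F μ) t - ProbabilityTheory.cgf F μ t ≤ C * t ^ 2) :
    ProbabilityTheory.cgf F μ 1 ≤ (∫ ω, F ω ∂μ) + C := by
  have hmem : ∀ t, t ∈ interior (ProbabilityTheory.integrableExpSet F μ) := fun t => by
    rw [Set.eq_univ_of_forall (s := ProbabilityTheory.integrableExpSet F μ) hF, interior_univ]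
    trivial
  set K := ProbabilityTheory.cgf F μ
  have hK : ∀ t, HasDerivAt K (deriv K t) t := fun t =>
    (ProbabilityTheory.analyticAt_cgf (hmem t)).differentiableAt.hasDerivAt
  have hquot : ∀ t, 0 < t → HasDerivAt (fun s => K s / s - C * s)
      ((deriv K t * t - K t * 1) / t ^ 2 - C * 1) t := fun t ht =>
    ((hK t).div (hasDerivAt_id t) ht.ne').sub ((hasDerivAt_id t).const_mul C)
  have hanti : AntitoneOn (fun s => K s / s - C * s) (Set.Ioi 0) := by
    refine antitoneOn_of_deriv_nonpos (convex_Ioi 0)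
      (fun t ht => (hquot t ht).continuousAt.continuousWithinAt) ?_ ?_ <;>
      rw [interior_Ioi]
    · exact fun t ht => (hquot t ht).differentiableAt.differentiableWithinAt
    · intro t ht
      rw [(hquot t ht).deriv, sub_nonpos, div_le_iff₀ (pow_pos ht 2)]
      linarith [h t ht]
  have hlim : Filter.Tendsto (fun s => K s / s - C * s) (nhdsWithin 0 (Set.Ioi 0))
      (nhds (∫ ω, F ω ∂μ)) := by
    have hslope := (hK 0).tendsto_slope_zero_right
    have hlin : Filter.Tendsto (fun s : ℝ => C * s) (nhdsWithin 0 (Set.Ioi 0)) (nhds (C * 0)) :=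
      ((continuous_const_mul C).tendsto 0).mono_left nhdsWithin_le_nhds
    have hK' : deriv K 0 = ∫ ω, F ω ∂μ := by
      simpa using ProbabilityTheory.deriv_cgf_zero (hmem 0)
    have hK0 : K 0 = 0 := ProbabilityTheory.cgf_zero
    simpa [hK', hK0, div_eq_inv_mul] using hslope.sub hlin
  have hle : K 1 / 1 - C * 1 ≤ ∫ ω, F ω ∂μ := by
    refine ge_of_tendsto hlim ?_
    filter_upwards [Ioc_mem_nhdsGT (zero_lt_one' ℝ)] with t ht
    exact hanti ht.1 (Set.mem_Ioi.2 zero_lt_one) ht.2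
  linarith

lemma entropy_exp_mul {μ : Measure Config} [IsProbabilityMeasure μ] {F : Config → ℝ}
    (hF : Continuous F) (t : ℝ) :
    entropy μ (fun ω => exp (t * F ω)) = ProbabilityTheory.mgf F μ t *
      (t * deriv (ProbabilityTheory.cgf F μ) t - ProbabilityTheory.cgf F μ t) := by
  have hint : ∀ t, Integrable (fun ω => exp (t * F ω)) μ := fun t =>
    Continuous.integrable_config (by fun_prop)
  have hmem : t ∈ interior (ProbabilityTheory.integrableExpSet F μ) := by
    rw [Set.eq_univ_of_forall (s := ProbabilityTheory.integrableExpSet F μ) hint, interior_univ]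
    trivial
  have hpos : 0 < ProbabilityTheory.mgf F μ t := ProbabilityTheory.mgf_pos (hint t)
  have hmul : ∫ ω, exp (t * F ω) * (t * F ω) ∂μ = t * ∫ ω, F ω * exp (t * F ω) ∂μ := by
    rw [← integral_const_mul]
    congr 1 with ω
    ring
  rw [ProbabilityTheory.deriv_cgf hmem, mul_sub, mul_left_comm, mul_div_cancel₀ _ hpos.ne',
    ProbabilityTheory.cgf]
  simp only [entropy, log_exp, hmul, ProbabilityTheory.mgf]

lemma entropy_exp_mul_le {μ : Measure Config} [IsProbabilityMeasure μ]
    {D : ℝ} (hD : 0 < D) (hLSI : SatisfiesLSI μ D) {M : ℝ} (hM : 0 < M)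
    (hflip : ∀ i : ℤ, μ.map (flipAt i) ≪ μ ∧
      ∀ᵐ ω ∂μ, (μ.map (flipAt i)).rnDeriv μ ω ≤ ENNReal.ofReal M)
    {F : Config → ℝ} (hloc : IsLocal F) (hF : Continuous F) (t : ℝ) :
    entropy μ (fun ω => exp (t * F ω)) ≤
      ProbabilityTheory.mgf F μ t * (D * (M + 1) / 2 * oscSq F * t ^ 2) := by
  obtain ⟨S, hS⟩ := hloc
  have hosc : oscSq F = ∑ k ∈ S, osc F k ^ 2 :=
    tsum_eq_sum fun k hk => by rw [osc_eq_zero hS hk, zero_pow two_ne_zero]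
  have hlsi := hLSI (fun ω => exp (t * F ω / 2))
    ⟨S, fun ω η h => by simp only [hS ω η h]⟩ (by fun_prop)
  have hsq : ∀ ω, exp (t * F ω / 2) ^ 2 = exp (t * F ω) := fun ω => by
    rw [← exp_nat_mul]; congr 1; push_cast; ring
  simp only [hsq] at hlsi
  have hsum : ∀ ω, ∑' i : ℤ, (exp (t * F ω / 2) - exp (t * F (flipAt i ω) / 2)) ^ 2 =
      ∑ i ∈ S, (exp (t * F ω / 2) - exp (t * F (flipAt i ω) / 2)) ^ 2 := fun ω =>
    tsum_eq_sum fun k hk => by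
      rw [hS (flipAt k ω) ω fun i hi => flipAt_of_ne (ne_of_mem_of_not_mem hi hk) ω]
      simp
  simp only [hsum] at hlsi
  have hexp : Continuous fun ω => exp (t * F ω) := by fun_prop
  have hsite : ∀ i, ∫ ω, (exp (t * F ω / 2) - exp (t * F (flipAt i ω) / 2)) ^ 2 ∂μ ≤
      t ^ 2 * osc F i ^ 2 / 4 * ((M + 1) * ProbabilityTheory.mgf F μ t) := fun i => by
    have hcexp : Continuous fun ω => exp (t * F (flipAt i ω)) := by fun_prop
    calc ∫ ω, (exp (t * F ω / 2) - exp (t * F (flipAt i ω) / 2)) ^ 2 ∂μ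
        ≤ ∫ ω, t ^ 2 * osc F i ^ 2 / 4 * (exp (t * F ω) + exp (t * F (flipAt i ω))) ∂μ := by
          refine integral_mono (Continuous.integrable_config (by fun_prop))
            (Continuous.integrable_config (by fun_prop)) fun ω => ?_
          refine (sq_exp_half_sub_le _ _).trans ?_
          rw [← mul_sub, mul_pow]
          have := sq_sub_flipAt_le_osc hF i ω
          gcongr ?_ ^ 2 * ?_ / 4 * ?_
      _ = t ^ 2 * osc F i ^ 2 / 4 *
            (ProbabilityTheory.mgf F μ t + ∫ ω, exp (t * F (flipAt i ω)) ∂μ) := by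
          rw [integral_const_mul, integral_add hexp.integrable_config hcexp.integrable_config,
            ProbabilityTheory.mgf]
      _ ≤ _ := by
          gcongr
          have := integral_comp_flipAt_le hM (hflip i).1 (hflip i).2 hexp fun ω => (exp_pos _).le
          rw [ProbabilityTheory.mgf]
          linarith
  calc entropy μ (fun ω => exp (t * F ω))
      ≤ 2 * D * ∑ i ∈ S, ∫ ω, (exp (t * F ω / 2) - exp (t * F (flipAt i ω) / 2)) ^ 2 ∂μ := by
        rwa [← integral_finsetSum]
        intro i _
        exact Continuous.integrable_config (by fun_prop)
    _ ≤ 2 * D * ∑ i ∈ S, t ^ 2 * osc F i ^ 2 / 4 * ((M + 1) * ProbabilityTheory.mgf F μ t) := by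
        gcongr with i
        exact hsite i
    _ = _ := by
        rw [← Finset.sum_mul, ← Finset.sum_div, ← Finset.mul_sum, hosc]
        ring

/-- If `μ` satisfies the log-Sobolev inequality with constant `D > 0`
and each spin-flip pushforward `μ^{(i)}` is absolutely continuous w.r.t. `μ` with
density bounded by `M`, then `μ` satisfies the Gaussian Concentration Bound with
constant `D(M+1)/2`. -/
theorem statement7 (μ : Measure Config) [IsProbabilityMeasure μ]
    (D : ℝ) (hD : 0 < D) (hLSI : SatisfiesLSI μ D)
    (M : ℝ) (hM : 0 < M)
    (hflip : ∀ i : ℤ, μ.map (flipAt i) ≪ μ ∧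
      ∀ᵐ ω ∂μ, (μ.map (flipAt i)).rnDeriv μ ω ≤ ENNReal.ofReal M) :
    GCB μ (D * (M + 1) / 2) := by
  intro F hloc hF
  have hint : ∀ t, Integrable (fun ω => exp (t * F ω)) μ := fun t =>
    Continuous.integrable_config (by fun_prop)
  have hcgf : ProbabilityTheory.cgf F μ 1 ≤ (∫ ω, F ω ∂μ) + D * (M + 1) / 2 * oscSq F := by
    refine cgf_one_le_of_deriv_le hint fun t _ => ?_
    have hent := entropy_exp_mul_le hD hLSI hM hflip hloc hF t
    rw [entropy_exp_mul hF t] at hent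
    exact le_of_mul_le_mul_left hent (ProbabilityTheory.mgf_pos (hint t))
  have hmgf : ∫ ω, exp (F ω) ∂μ = exp (ProbabilityTheory.cgf F μ 1) := by
    rw [ProbabilityTheory.exp_cgf (hint 1)]
    simp [ProbabilityTheory.mgf]
  simp only [exp_sub, integral_div, hmgf]
  rw [← exp_sub]
  exact exp_le_exp.2 (by linarith)

end
end
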